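/- arXiv:2605.12815 — 10 statements merged into one kernel-verified Lean document; each statement's English description precedes it below -/
import Mathlib

section
/- As ρ → 0⁺, I(ρ) is asymptotically equivalent to log(1/ρ)/ρ; that is, lim_{ρ→0⁺} ρ·I(ρ)/log(1/ρ) = 1. -/
open Real Filter MeasureTheory

/-- The arclength-rescaled Möbius energy density integrand of the helix of pitch `ρ`. -/
noncomputable def helixM (ρ t : ℝ) : ℝ :=
  (ρ ^ 2 + 1) / (ρ ^ 2 * t ^ 2 + 4 * Real.sin (t / 2) ^ 2) - 1 / t ^ 2

/-- The arclength-rescaled Möbius energy density of the helix of pitch `ρ`. -/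
noncomputable def helixI (ρ : ℝ) : ℝ := ∫ t : ℝ, helixM ρ t

lemma intervalIntegrable_inv_sq_add_four_mul_sin_sq {a : ℝ} (ha : 0 < a) (x y : ℝ) :
    IntervalIntegrable (fun t : ℝ => 1 / (a ^ 2 + 4 * sin (t / 2) ^ 2)) volume x y := by
  refine Continuous.intervalIntegrable (continuous_const.div (by fun_prop) ?_) _ _
  intro t
  positivity

lemma integral_inv_sq_add_four_mul_sin_sq {a : ℝ} (ha : 0 < a) :
    ∫ t in (-π)..π, 1 / (a ^ 2 + 4 * sin (t / 2) ^ 2) = 2 * π / (a * √(a ^ 2 + 4)) := by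
  set b := √(a ^ 2 + 4) with hb
  have hb0 : 0 < b := by positivity
  have hb2 : b ^ 2 = a ^ 2 + 4 := Real.sq_sqrt (by positivity)
  have hder : ∀ t ∈ Set.Ioo (-π) π,
      HasDerivAt (fun t => 2 / (a * b) * arctan (b / a * tan (t / 2)))
        (1 / (a ^ 2 + 4 * sin (t / 2) ^ 2)) t := by
    intro t ht
    have hc : 0 < cos (t / 2) :=
      cos_pos_of_mem_Ioo ⟨by linarith [ht.1], by linarith [ht.2]⟩
    have h1 : HasDerivAt (fun t : ℝ => tan (t / 2)) (1 / cos (t / 2) ^ 2 * (1 / 2)) t :=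
      (hasDerivAt_tan hc.ne').comp (h := fun t : ℝ => t / 2) t ((hasDerivAt_id' t).div_const 2)
    refine (((h1.const_mul (b / a)).arctan).const_mul (2 / (a * b))).congr_deriv ?_
    have hs := sin_sq_add_cos_sq (t / 2)
    have hpos : 0 < a ^ 2 + 4 * sin (t / 2) ^ 2 := by positivity
    have h2 : 1 + (b / a * tan (t / 2)) ^ 2
        = (a ^ 2 + 4 * sin (t / 2) ^ 2) / (a ^ 2 * cos (t / 2) ^ 2) := by
      rw [tan_eq_sin_div_cos, eq_div_iff (by positivity)]
      field_simp
      rw [hb2]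
      linear_combination (a ^ 2) * hs
    rw [h2]
    field_simp
  have hhalf : Tendsto (fun t : ℝ => t / 2) (nhdsWithin π (Set.Iio π))
      (nhdsWithin (π / 2) (Set.Iio (π / 2))) := by
    refine tendsto_nhdsWithin_iff.2 ⟨?_, ?_⟩
    · exact ((continuous_id.div_const (2 : ℝ)).tendsto π).mono_left nhdsWithin_le_nhds
    · filter_upwards [self_mem_nhdsWithin] with t ht
      simp only [Set.mem_Iio] at *
      linarith
  have hhalf' : Tendsto (fun t : ℝ => t / 2) (nhdsWithin (-π) (Set.Ioi (-π)))
      (nhdsWithin (-(π / 2)) (Set.Ioi (-(π / 2)))) := by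
    refine tendsto_nhdsWithin_iff.2 ⟨?_, ?_⟩
    · rw [← neg_div]
      exact ((continuous_id.div_const (2 : ℝ)).tendsto (-π)).mono_left nhdsWithin_le_nhds
    · filter_upwards [self_mem_nhdsWithin] with t ht
      simp only [Set.mem_Ioi] at *
      linarith
  have hba : 0 < b / a := by positivity
  have hright := ((tendsto_arctan_atTop.mono_right nhdsWithin_le_nhds).comp
    ((tendsto_tan_pi_div_two.comp hhalf).const_mul_atTop hba)).const_mul (2 / (a * b))
  have hleft := ((tendsto_arctan_atBot.mono_right nhdsWithin_le_nhds).comp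
    ((tendsto_tan_neg_pi_div_two.comp hhalf').const_mul_atBot hba)).const_mul (2 / (a * b))
  rw [intervalIntegral.integral_eq_sub_of_hasDerivAt_of_tendsto (by linarith [pi_pos]) hder
    (intervalIntegrable_inv_sq_add_four_mul_sin_sq ha _ _) hleft hright]
  field_simp
  ring

lemma integral_period_inv_sq_add_four_mul_sin_sq {a : ℝ} (ha : 0 < a) (k : ℕ) :
    ∫ t in ((2 * k + 1) * π)..((2 * (k + 1 : ℕ) + 1) * π), 1 / (a ^ 2 + 4 * sin (t / 2) ^ 2) =
      2 * π / (a * √(a ^ 2 + 4)) := by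
  have hper : Function.Periodic (fun t : ℝ => 1 / (a ^ 2 + 4 * sin (t / 2) ^ 2)) (2 * π) := by
    intro t
    have : (t + 2 * π) / 2 = t / 2 + π := by ring
    simp only [this, sin_add_pi, neg_sq]
  have h := hper.intervalIntegral_add_eq ((2 * k + 1) * π) (-π)
  have e1 : (2 * (k : ℝ) + 1) * π + 2 * π = (2 * (k + 1 : ℕ) + 1) * π := by push_cast; ring
  have e2 : -π + 2 * π = π := by ring
  rw [e1, e2] at h
  rw [h, integral_inv_sq_add_four_mul_sin_sq ha]

lemma four_mul_sin_half_sq_le (t : ℝ) : 4 * sin (t / 2) ^ 2 ≤ t ^ 2 := by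
  have := sq_le_sq.2 (abs_sin_le_abs (x := t / 2))
  nlinarith

lemma helixM_eq {ρ t : ℝ} (hρ : 0 < ρ) (ht : t ≠ 0) :
    helixM ρ t = (t ^ 2 - 4 * sin (t / 2) ^ 2) /
      (t ^ 2 * (ρ ^ 2 * t ^ 2 + 4 * sin (t / 2) ^ 2)) := by
  have : 0 < ρ ^ 2 * t ^ 2 + 4 * sin (t / 2) ^ 2 := by positivity
  unfold helixM
  field_simp
  ring

lemma helixM_nonneg {ρ t : ℝ} (hρ : 0 < ρ) : 0 ≤ helixM ρ t := by
  rcases eq_or_ne t 0 with rfl | ht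
  · simp [helixM]
  · rw [helixM_eq hρ ht]
    exact div_nonneg (sub_nonneg.2 (four_mul_sin_half_sq_le t)) (by positivity)

lemma sq_sub_four_mul_sin_half_sq_le {t : ℝ} (ht : 0 < t) :
    t ^ 2 - 4 * sin (t / 2) ^ 2 ≤ t ^ 4 / 4 := by
  rcases le_or_gt (t / 2) 1 with h | h
  · have h1 := sin_gt_sub_cube (x := t / 2) (by positivity)
    have h0 : 0 ≤ t / 2 - (t / 2) ^ 3 / 6 := by nlinarith [pow_pos ht 2]
    have h2 := pow_le_pow_left₀ h0 h1.le 2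
    nlinarith [pow_pos ht 4, pow_pos ht 6]
  · have h1 : 4 ≤ t ^ 2 := by nlinarith
    nlinarith [sq_nonneg (sin (t / 2))]

lemma helixM_le_one {ρ t : ℝ} (hρ : 0 < ρ) (ht : 0 < t) (htπ : t ≤ π) : helixM ρ t ≤ 1 := by
  rw [helixM_eq hρ ht.ne', div_le_one (by positivity)]
  have h1 := sq_sub_four_mul_sin_half_sq_le ht
  have h2 := mul_le_sin (x := t / 2) (by positivity) (by linarith)
  have h3 : t / 4 ≤ sin (t / 2) := by
    refine le_trans ?_ h2
    rw [show 2 / π * (t / 2) = t / π by ring]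
    exact div_le_div_of_nonneg_left ht.le pi_pos pi_le_four
  have h4 := pow_le_pow_left₀ (by positivity) h3 2
  nlinarith [mul_le_mul_of_nonneg_left h4 (sq_nonneg t), mul_pos (pow_pos hρ 2) (pow_pos ht 4)]

lemma helixM_le_div_sq {ρ t : ℝ} (hρ : 0 < ρ) (ht : 0 < t) :
    helixM ρ t ≤ (ρ ^ 2 + 1) / ρ ^ 2 * t ^ (-2 : ℝ) := by
  have h : (ρ ^ 2 + 1) / (ρ ^ 2 * t ^ 2 + 4 * sin (t / 2) ^ 2) ≤ (ρ ^ 2 + 1) / (ρ ^ 2 * t ^ 2) :=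
    div_le_div_of_nonneg_left (by positivity) (by positivity)
      (le_add_of_nonneg_right (by positivity))
  have h' : (0 : ℝ) ≤ 1 / t ^ 2 := by positivity
  rw [rpow_neg ht.le, rpow_two, ← div_eq_mul_inv, div_div]
  unfold helixM
  linarith

lemma sum_inv_two_mul_add_one_le (N : ℕ) :
    ∑ k ∈ Finset.range N, 1 / (2 * (k : ℝ) + 1) ≤ (harmonic N : ℝ) / 2 + 1 - 1 / (2 * N + 1) := by
  induction N with
  | zero => simp
  | succ n ih =>
    rw [Finset.sum_range_succ, harmonic_succ]
    push_cast
    have : 1 / (2 * ((n : ℝ) + 1) + 1) ≤ ((n : ℝ) + 1)⁻¹ / 2 := by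
      rw [inv_eq_one_div, div_div]
      exact one_div_le_one_div_of_le (by positivity) (by linarith)
    linarith

lemma le_sum_inv_two_mul_add_three (N : ℕ) :
    (harmonic N : ℝ) / 2 - 1 + 1 / (2 * N + 1) ≤
      ∑ k ∈ Finset.range N, 1 / (2 * ((k + 1 : ℕ) : ℝ) + 1) := by
  induction N with
  | zero => simp
  | succ n ih =>
    rw [Finset.sum_range_succ, harmonic_succ]
    push_cast at *
    have : ((n : ℝ) + 1)⁻¹ / 2 ≤ 1 / (2 * (n : ℝ) + 1) := by
      rw [inv_eq_one_div, div_div]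
      exact one_div_le_one_div_of_le (by positivity) (by linarith)
    linarith

lemma intervalIntegrable_helix_kernel {ρ x y : ℝ} (hρ : 0 < ρ) (hx : 0 < x) (hy : 0 < y) :
    IntervalIntegrable (fun t : ℝ => 1 / (ρ ^ 2 * t ^ 2 + 4 * sin (t / 2) ^ 2)) volume x y := by
  refine ContinuousOn.intervalIntegrable (ContinuousOn.div (by fun_prop) (by fun_prop) ?_)
  intro t ht
  have : 0 < t := lt_of_lt_of_le (lt_min hx hy) ht.1
  positivity

lemma integral_period_helix_kernel_le {ρ : ℝ} (hρ : 0 < ρ) (k : ℕ) :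
    ∫ t in ((2 * k + 1) * π)..((2 * (k + 1 : ℕ) + 1) * π),
      1 / (ρ ^ 2 * t ^ 2 + 4 * sin (t / 2) ^ 2) ≤ 1 / ρ * (1 / (2 * k + 1)) := by
  set a := ρ * ((2 * k + 1) * π) with ha_def
  have ha : 0 < a := by positivity
  have hxy : (2 * (k : ℝ) + 1) * π ≤ (2 * (k + 1 : ℕ) + 1) * π := by
    push_cast
    nlinarith [pi_pos]
  have hmono := intervalIntegral.integral_mono_on hxy
    (intervalIntegrable_helix_kernel hρ (by positivity) (by positivity))
    (intervalIntegrable_inv_sq_add_four_mul_sin_sq ha _ _) (fun t ht => by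
      refine one_div_le_one_div_of_le (by positivity) ?_
      rw [ha_def, mul_pow]
      gcongr
      exact ht.1)
  rw [integral_period_inv_sq_add_four_mul_sin_sq ha] at hmono
  refine hmono.trans ?_
  have h2 : 2 ≤ √(a ^ 2 + 4) := Real.le_sqrt_of_sq_le (by nlinarith [sq_nonneg a])
  calc 2 * π / (a * √(a ^ 2 + 4)) ≤ 2 * π / (a * 2) := by gcongr
    _ = 1 / ρ * (1 / (2 * k + 1)) := by
      rw [ha_def]
      field_simp

lemma le_integral_period_helix_kernel {ρ : ℝ} (hρ : 0 < ρ) (k : ℕ) :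
    1 / ρ * (1 / (2 * (k + 1 : ℕ) + 1)) - π / 2 ≤
      ∫ t in ((2 * k + 1) * π)..((2 * (k + 1 : ℕ) + 1) * π),
        1 / (ρ ^ 2 * t ^ 2 + 4 * sin (t / 2) ^ 2) := by
  set a := ρ * ((2 * (k + 1 : ℕ) + 1) * π) with ha_def
  have ha : 0 < a := by positivity
  have hxy : (2 * (k : ℝ) + 1) * π ≤ (2 * (k + 1 : ℕ) + 1) * π := by
    push_cast
    nlinarith [pi_pos]
  have hmono := intervalIntegral.integral_mono_on hxy
    (intervalIntegrable_inv_sq_add_four_mul_sin_sq ha _ _)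
    (intervalIntegrable_helix_kernel hρ (by positivity) (by positivity)) (fun t ht => by
      have ht0 : 0 < t := lt_of_lt_of_le (by positivity) ht.1
      refine one_div_le_one_div_of_le (by positivity) ?_
      rw [ha_def, mul_pow]
      gcongr
      exact ht.2)
  rw [integral_period_inv_sq_add_four_mul_sin_sq ha] at hmono
  refine le_trans ?_ hmono
  have h2 : √(a ^ 2 + 4) ≤ a + 2 := Real.sqrt_le_iff.2 ⟨by positivity, by nlinarith⟩
  have h3 : 1 / (a + 2) ≤ 1 / 2 := one_div_le_one_div_of_le two_pos (by linarith)
  have h4 : 1 / ρ * (1 / (2 * (k + 1 : ℕ) + 1)) = π / a := by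
    rw [ha_def]
    field_simp
  calc 1 / ρ * (1 / (2 * (k + 1 : ℕ) + 1)) - π / 2 ≤ π / a - π * (1 / (a + 2)) := by
        rw [h4]
        nlinarith [pi_pos]
    _ = 2 * π / (a * (a + 2)) := by
        field_simp
        ring
    _ ≤ 2 * π / (a * √(a ^ 2 + 4)) := by gcongr

lemma sum_integral_period_helix_kernel {ρ : ℝ} (hρ : 0 < ρ) (N : ℕ) :
    ∑ k ∈ Finset.range N, ∫ t in ((2 * k + 1) * π)..((2 * (k + 1 : ℕ) + 1) * π),
      1 / (ρ ^ 2 * t ^ 2 + 4 * sin (t / 2) ^ 2) =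
    ∫ t in π..((2 * N + 1) * π), 1 / (ρ ^ 2 * t ^ 2 + 4 * sin (t / 2) ^ 2) := by
  have h := intervalIntegral.sum_integral_adjacent_intervals (μ := volume) (n := N)
    (a := fun k : ℕ => (2 * (k : ℝ) + 1) * π)
    (f := fun t : ℝ => 1 / (ρ ^ 2 * t ^ 2 + 4 * sin (t / 2) ^ 2))
    (fun k _ => intervalIntegrable_helix_kernel hρ (by positivity) (by positivity))
  simpa using h

lemma integral_helix_kernel_le {ρ : ℝ} (hρ : 0 < ρ) (N : ℕ) :
    ∫ t in π..((2 * N + 1) * π), 1 / (ρ ^ 2 * t ^ 2 + 4 * sin (t / 2) ^ 2) ≤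
      1 / ρ * ((harmonic N : ℝ) / 2 + 1) := by
  rw [← sum_integral_period_helix_kernel hρ]
  refine (Finset.sum_le_sum fun k _ => integral_period_helix_kernel_le hρ k).trans ?_
  rw [← Finset.mul_sum]
  gcongr
  have : (0 : ℝ) ≤ 1 / (2 * N + 1) := by positivity
  linarith [sum_inv_two_mul_add_one_le N]

lemma le_integral_helix_kernel {ρ : ℝ} (hρ : 0 < ρ) (N : ℕ) :
    1 / ρ * ((harmonic N : ℝ) / 2 - 1) - N * (π / 2) ≤
      ∫ t in π..((2 * N + 1) * π), 1 / (ρ ^ 2 * t ^ 2 + 4 * sin (t / 2) ^ 2) := by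
  rw [← sum_integral_period_helix_kernel hρ]
  refine le_trans ?_ (Finset.sum_le_sum fun k _ => le_integral_period_helix_kernel hρ k)
  rw [Finset.sum_sub_distrib, ← Finset.mul_sum, Finset.sum_const, Finset.card_range, nsmul_eq_mul]
  gcongr
  have : (0 : ℝ) ≤ 1 / (2 * N + 1) := by positivity
  linarith [le_sum_inv_two_mul_add_three N]

lemma measurable_helixM (ρ : ℝ) : Measurable (helixM ρ) := by
  unfold helixM
  fun_prop

lemma integrableOn_helixM_Ioc_zero_pi {ρ : ℝ} (hρ : 0 < ρ) :
    IntegrableOn (helixM ρ) (Set.Ioc 0 π) := by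
  refine Measure.integrableOn_of_bounded (M := 1) (by simp)
    (measurable_helixM ρ).aestronglyMeasurable ?_
  filter_upwards [ae_restrict_mem measurableSet_Ioc] with t ht
  rw [norm_of_nonneg (helixM_nonneg hρ)]
  exact helixM_le_one hρ ht.1 ht.2

lemma integrableOn_helixM_Ioi {ρ c : ℝ} (hρ : 0 < ρ) (hc : 0 < c) :
    IntegrableOn (helixM ρ) (Set.Ioi c) := by
  refine ((integrableOn_Ioi_rpow_of_lt (a := -2) (by norm_num) hc).const_mul
    ((ρ ^ 2 + 1) / ρ ^ 2)).mono' (measurable_helixM ρ).aestronglyMeasurable ?_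
  filter_upwards [ae_restrict_mem measurableSet_Ioi] with t ht
  rw [norm_of_nonneg (helixM_nonneg hρ)]
  exact helixM_le_div_sq hρ (hc.trans ht)

lemma setIntegral_helixM_Ioc_zero_pi_le {ρ : ℝ} (hρ : 0 < ρ) :
    ∫ t in Set.Ioc 0 π, helixM ρ t ≤ π := by
  have h := setIntegral_mono_on (integrableOn_helixM_Ioc_zero_pi hρ)
    (integrableOn_const (C := (1 : ℝ)) (by simp)) measurableSet_Ioc
    (fun t ht => helixM_le_one hρ ht.1 ht.2)
  simpa [pi_pos.le] using h

lemma setIntegral_helixM_Ioi_le {ρ c : ℝ} (hρ : 0 < ρ) (hc : 0 < c) :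
    ∫ t in Set.Ioi c, helixM ρ t ≤ (ρ ^ 2 + 1) / (ρ ^ 2 * c) := by
  have h := setIntegral_mono_on (integrableOn_helixM_Ioi hρ hc)
    ((integrableOn_Ioi_rpow_of_lt (a := -2) (by norm_num) hc).const_mul
      ((ρ ^ 2 + 1) / ρ ^ 2)) measurableSet_Ioi
    (fun t ht => helixM_le_div_sq hρ (hc.trans ht))
  rw [integral_const_mul, integral_Ioi_rpow_of_lt (by norm_num) hc] at h
  refine h.trans_eq ?_
  norm_num [rpow_neg_one]
  field_simp

lemma intervalIntegral_helixM {ρ x y : ℝ} (hρ : 0 < ρ) (hx : 0 < x) (hy : 0 < y) :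
    ∫ t in x..y, helixM ρ t =
      (ρ ^ 2 + 1) * (∫ t in x..y, 1 / (ρ ^ 2 * t ^ 2 + 4 * sin (t / 2) ^ 2)) -
        (1 / x - 1 / y) := by
  have h0 : (0 : ℝ) ∉ Set.uIcc x y := fun h => absurd h.1 (not_le.2 (lt_min hx hy))
  have hint : IntervalIntegrable (fun t : ℝ => 1 / t ^ 2) volume x y := by
    refine ContinuousOn.intervalIntegrable (ContinuousOn.div (by fun_prop) (by fun_prop) ?_)
    intro t ht
    exact pow_ne_zero 2 fun h => h0 (h ▸ ht)
  have hsq : ∫ t in x..y, 1 / t ^ 2 = 1 / x - 1 / y := by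
    have h := integral_zpow (a := x) (b := y) (n := -2) (Or.inr ⟨by norm_num, h0⟩)
    norm_num [zpow_neg] at h
    simp only [one_div]
    rw [h]
    ring
  rw [← hsq, ← intervalIntegral.integral_const_mul, ← intervalIntegral.integral_sub
    ((intervalIntegrable_helix_kernel hρ hx hy).const_mul _) hint]
  simp only [helixM, mul_one_div]

lemma helixI_eq {ρ T : ℝ} (hρ : 0 < ρ) (hT : π ≤ T) :
    helixI ρ = 2 * ((∫ t in Set.Ioc 0 π, helixM ρ t) + (∫ t in π..T, helixM ρ t) +
      ∫ t in Set.Ioi T, helixM ρ t) := by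
  have heven : ∀ t, helixM ρ t = helixM ρ |t| := by
    intro t
    rcases abs_choice t with h | h <;> rw [h]
    simp [helixM, neg_div]
  have hπ := integrableOn_helixM_Ioi hρ pi_pos
  have h1 : ∫ t in Set.Ioi (0 : ℝ), helixM ρ t =
      (∫ t in Set.Ioc 0 π, helixM ρ t) + ∫ t in Set.Ioi π, helixM ρ t := by
    rw [← Set.Ioc_union_Ioi_eq_Ioi pi_pos.le]
    exact setIntegral_union Set.Ioc_disjoint_Ioi_same measurableSet_Ioi
      (integrableOn_helixM_Ioc_zero_pi hρ) hπ
  have h2 : ∫ t in Set.Ioi π, helixM ρ t =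
      (∫ t in Set.Ioc π T, helixM ρ t) + ∫ t in Set.Ioi T, helixM ρ t := by
    rw [← Set.Ioc_union_Ioi_eq_Ioi hT]
    exact setIntegral_union Set.Ioc_disjoint_Ioi_same measurableSet_Ioi
      (hπ.mono_set Set.Ioc_subset_Ioi_self)
      (hπ.mono_set (Set.Ioi_subset_Ioi hT))
  rw [helixI, integral_congr_ae (ae_of_all _ heven), integral_comp_abs, h1, h2,
    intervalIntegral.integral_of_le hT]
  ring

lemma log_inv_le_harmonic_floor {ρ : ℝ} (hρ : 0 < ρ) :
    log (1 / ρ) ≤ harmonic ⌊1 / ρ⌋₊ := by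
  refine le_trans (log_le_log (by positivity) ?_) (log_add_one_le_harmonic _)
  push_cast
  exact (Nat.lt_floor_add_one _).le

lemma harmonic_floor_le_one_add_log_inv {ρ : ℝ} (hρ : 0 < ρ) (hρ1 : ρ ≤ 1) :
    (harmonic ⌊1 / ρ⌋₊ : ℝ) ≤ 1 + log (1 / ρ) := by
  refine (harmonic_le_one_add_log _).trans ?_
  have h1 : 1 ≤ ⌊1 / ρ⌋₊ := Nat.one_le_floor_iff _ |>.2 (one_le_one_div hρ hρ1)
  gcongr
  exact Nat.floor_le (by positivity)

lemma mul_helixI_le {ρ : ℝ} (hρ : 0 < ρ) (hρ1 : ρ ≤ 1) :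
    ρ * helixI ρ ≤ (ρ ^ 2 + 1) * (log (1 / ρ) + 3) + 12 := by
  set N := ⌊1 / ρ⌋₊ with hN
  have hT : π ≤ (2 * N + 1) * π := by nlinarith [pi_pos, (Nat.cast_nonneg N : (0 : ℝ) ≤ N)]
  have hT0 : 0 < (2 * (N : ℝ) + 1) * π := by positivity
  have hNρ : 1 ≤ ρ * (2 * N + 1) := by
    have h := (Nat.lt_floor_add_one (1 / ρ)).le
    rw [← hN, div_le_iff₀ hρ] at h
    nlinarith
  have hH := harmonic_floor_le_one_add_log_inv hρ hρ1
  rw [← hN] at hH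
  have hK := mul_le_mul_of_nonneg_left (integral_helix_kernel_le hρ N) hρ.le
  rw [← mul_assoc, mul_one_div_cancel hρ.ne', one_mul] at hK
  have hmid := intervalIntegral_helixM hρ pi_pos hT0
  have hsq : 0 ≤ 1 / π - 1 / ((2 * (N : ℝ) + 1) * π) :=
    sub_nonneg.2 (one_div_le_one_div_of_le pi_pos hT)
  have htail : ρ * ∫ t in Set.Ioi ((2 * (N : ℝ) + 1) * π), helixM ρ t ≤ 2 := by
    calc _ ≤ ρ * ((ρ ^ 2 + 1) / (ρ ^ 2 * ((2 * (N : ℝ) + 1) * π))) := by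
          gcongr
          exact setIntegral_helixM_Ioi_le hρ hT0
      _ = (ρ ^ 2 + 1) / (ρ * (2 * N + 1) * π) := by field_simp
      _ ≤ 2 := by
          rw [div_le_iff₀ (by positivity)]
          nlinarith [pi_gt_three]
  have hcentre := mul_le_mul hρ1 (setIntegral_helixM_Ioc_zero_pi_le hρ)
    (setIntegral_nonneg measurableSet_Ioc fun t _ => helixM_nonneg hρ) zero_le_one
  rw [helixI_eq hρ hT, hmid]
  have := mul_le_mul_of_nonneg_left hK (by positivity : 0 ≤ 2 * (ρ ^ 2 + 1))
  have := mul_le_mul_of_nonneg_left hH (by positivity : 0 ≤ ρ ^ 2 + 1)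
  nlinarith [pi_le_four, mul_nonneg hρ.le hsq]

lemma le_mul_helixI {ρ : ℝ} (hρ : 0 < ρ) (hρ1 : ρ ≤ 1) :
    log (1 / ρ) - 8 ≤ ρ * helixI ρ := by
  set N := ⌊1 / ρ⌋₊ with hN
  have hT : π ≤ (2 * N + 1) * π := by nlinarith [pi_pos, (Nat.cast_nonneg N : (0 : ℝ) ≤ N)]
  have hT0 : 0 < (2 * (N : ℝ) + 1) * π := by positivity
  have hNρ : ρ * N ≤ 1 := by
    have h := Nat.floor_le (by positivity : 0 ≤ 1 / ρ)
    rw [← hN, le_div_iff₀ hρ] at h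
    linarith
  have hH := log_inv_le_harmonic_floor hρ
  rw [← hN] at hH
  have hK := mul_le_mul_of_nonneg_left (le_integral_helix_kernel hρ N) hρ.le
  rw [mul_sub, ← mul_assoc, mul_one_div_cancel hρ.ne', one_mul] at hK
  have hmid := intervalIntegral_helixM hρ pi_pos hT0
  have hK0 : 0 ≤ ∫ t in π..((2 * N + 1) * π), 1 / (ρ ^ 2 * t ^ 2 + 4 * sin (t / 2) ^ 2) :=
    intervalIntegral.integral_nonneg hT fun t _ => by positivity
  have hsq : 1 / π - 1 / ((2 * (N : ℝ) + 1) * π) ≤ 1 := by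
    have h1 : 1 / π ≤ 1 / 1 := one_div_le_one_div_of_le one_pos (by linarith [pi_gt_three])
    have h2 : 0 ≤ 1 / ((2 * (N : ℝ) + 1) * π) := by positivity
    linarith
  have htail : 0 ≤ ∫ t in Set.Ioi ((2 * (N : ℝ) + 1) * π), helixM ρ t :=
    setIntegral_nonneg measurableSet_Ioi fun t _ => helixM_nonneg hρ
  have hcentre : 0 ≤ ∫ t in Set.Ioc 0 π, helixM ρ t :=
    setIntegral_nonneg measurableSet_Ioc fun t _ => helixM_nonneg hρ
  rw [helixI_eq hρ hT, hmid]
  have h1 := mul_nonneg hρ.le htail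
  have h2 := mul_nonneg hρ.le hcentre
  have h3 := mul_le_mul_of_nonneg_left hsq hρ.le
  have h4 := mul_nonneg (pow_pos hρ 3).le hK0
  have h5 := mul_le_mul_of_nonneg_right hNρ (pi_pos.le)
  nlinarith [pi_le_four]

theorem helixI_asymptotics_zero :
    Filter.Tendsto (fun ρ : ℝ => ρ * helixI ρ / Real.log (1 / ρ))
      (nhdsWithin 0 (Set.Ioi 0)) (nhds 1) := by
  have hlog : Tendsto (fun ρ : ℝ => log (1 / ρ)) (nhdsWithin 0 (Set.Ioi 0)) atTop := by
    simp only [one_div, log_inv]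
    exact tendsto_neg_atBot_atTop.comp tendsto_log_nhdsGT_zero
  have hρ0 : Tendsto (fun ρ : ℝ => ρ) (nhdsWithin 0 (Set.Ioi 0)) (nhds 0) :=
    tendsto_id.mono_left nhdsWithin_le_nhds
  have hinv (c : ℝ) : Tendsto (fun ρ : ℝ => c / log (1 / ρ)) (nhdsWithin 0 (Set.Ioi 0)) (nhds 0) :=
    hlog.const_div_atTop c
  have hlower : Tendsto (fun ρ : ℝ => 1 - 8 / log (1 / ρ)) (nhdsWithin 0 (Set.Ioi 0)) (nhds 1) := by
    simpa using (hinv 8).const_sub 1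
  have hupper : Tendsto (fun ρ : ℝ => (ρ ^ 2 + 1) * (1 + 3 / log (1 / ρ)) + 12 / log (1 / ρ))
      (nhdsWithin 0 (Set.Ioi 0)) (nhds 1) := by
    simpa using (((hρ0.pow 2).add_const 1).mul ((hinv 3).const_add 1)).add (hinv 12)
  have hmem : ∀ᶠ ρ : ℝ in nhdsWithin 0 (Set.Ioi 0), ρ ∈ Set.Ioo 0 1 :=
    Ioo_mem_nhdsGT one_pos
  refine tendsto_of_tendsto_of_tendsto_of_le_of_le' hlower hupper ?_ ?_
  · filter_upwards [hmem] with ρ hρ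
    have hL : 0 < log (1 / ρ) := log_pos (one_lt_one_div hρ.1 hρ.2)
    rw [le_div_iff₀ hL, sub_mul, one_mul, div_mul_cancel₀ _ hL.ne']
    exact le_mul_helixI hρ.1 hρ.2.le
  · filter_upwards [hmem] with ρ hρ
    have hL : 0 < log (1 / ρ) := log_pos (one_lt_one_div hρ.1 hρ.2)
    rw [div_le_iff₀ hL]
    refine (mul_helixI_le hρ.1 hρ.2.le).trans_eq ?_
    field_simp
end

section
/- As ρ → ∞, ρ²·I(ρ) → π/3; equivalently, I(ρ) is asymptotically equivalent to π/(3ρ²) as ρ → ∞. -/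
open Real Filter MeasureTheory

lemma sq_sub_two_add_two_mul_cos_nonneg (t : ℝ) : 0 ≤ t ^ 2 - 2 + 2 * cos t := by
  linarith [one_sub_sq_div_two_le_cos (x := t)]

/-- An antiderivative of `t ↦ (t ^ 2 - 2 + 2 * cos t) * exp (-(x * t))`. -/
noncomputable def cosRemainderPrimitive (x t : ℝ) : ℝ :=
  (-t ^ 2 / x - 2 * t / x ^ 2 - 2 / x ^ 3 + 2 / x
    + 2 * (sin t - x * cos t) / (x ^ 2 + 1)) * exp (-(x * t))

lemma hasDerivAt_cosRemainderPrimitive {x : ℝ} (hx : 0 < x) (t : ℝ) :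
    HasDerivAt (cosRemainderPrimitive x)
      ((t ^ 2 - 2 + 2 * cos t) * exp (-(x * t))) t := by
  have hpoly : HasDerivAt
      (fun t : ℝ => -t ^ 2 / x - 2 * t / x ^ 2 - 2 / x ^ 3 + 2 / x
        + 2 * (sin t - x * cos t) / (x ^ 2 + 1))
      (-(2 * t) / x - 2 / x ^ 2 + 2 * (cos t + x * sin t) / (x ^ 2 + 1)) t := by
    have hsq := ((hasDerivAt_pow 2 t).neg.div_const x)
    have hlin := ((hasDerivAt_id t).const_mul 2).div_const (x ^ 2)
    have htrig := (((hasDerivAt_sin t).sub ((hasDerivAt_cos t).const_mul x)).const_mul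
      2).div_const (x ^ 2 + 1)
    convert! (((hsq.sub hlin).sub_const (2 / x ^ 3)).add_const (2 / x)).add htrig using 1
    simp
  have hexp : HasDerivAt (fun t : ℝ => exp (-(x * t))) (exp (-(x * t)) * -(x * 1)) t :=
    (((hasDerivAt_id t).const_mul x).neg).exp
  convert! hpoly.mul hexp using 1
  field_simp
  ring

lemma tendsto_cosRemainderPrimitive {x : ℝ} (hx : 0 < x) :
    Tendsto (cosRemainderPrimitive x) atTop (nhds 0) := by
  have hpow (n : ℕ) : Tendsto (fun t : ℝ => t ^ n * exp (-(x * t))) atTop (nhds 0) := by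
    simpa using tendsto_rpow_mul_exp_neg_mul_atTop_nhds_zero n x hx
  have hexp : Tendsto (fun t : ℝ => exp (-(x * t))) atTop (nhds 0) := by simpa using hpow 0
  have htrig : Tendsto (fun t : ℝ => (sin t - x * cos t) * exp (-(x * t))) atTop (nhds 0) := by
    refine squeeze_zero_norm (a := fun t => (1 + x) * exp (-(x * t))) (fun t => ?_)
      (by simpa using hexp.const_mul (1 + x))
    rw [norm_mul, norm_of_nonneg (exp_pos _).le, Real.norm_eq_abs]
    gcongr
    rw [abs_le]
    constructor <;> nlinarith [sin_le_one t, neg_one_le_sin t, cos_le_one t, neg_one_le_cos t]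
  have hsum := ((((hpow 2).const_mul (-1 / x)).add ((hpow 1).const_mul (-2 / x ^ 2))).add
    (hexp.const_mul (-2 / x ^ 3 + 2 / x))).add (htrig.const_mul (2 / (x ^ 2 + 1)))
  simp only [mul_zero, add_zero] at hsum
  refine hsum.congr fun t => ?_
  unfold cosRemainderPrimitive
  ring

lemma integrableOn_cosRemainder_mul_exp {x : ℝ} (hx : 0 < x) :
    IntegrableOn (fun t : ℝ => (t ^ 2 - 2 + 2 * cos t) * exp (-(x * t))) (Set.Ioi 0) :=
  integrableOn_Ioi_deriv_of_nonneg' (fun t _ => hasDerivAt_cosRemainderPrimitive hx t)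
    (fun t _ => mul_nonneg (sq_sub_two_add_two_mul_cos_nonneg t) (exp_pos _).le)
    (tendsto_cosRemainderPrimitive hx)

lemma integral_cosRemainder_mul_exp {x : ℝ} (hx : 0 < x) :
    ∫ t in Set.Ioi (0 : ℝ), (t ^ 2 - 2 + 2 * cos t) * exp (-(x * t))
      = 2 / x ^ 3 * (1 + x ^ 2)⁻¹ := by
  rw [integral_Ioi_of_hasDerivAt_of_nonneg'
    (fun t _ => hasDerivAt_cosRemainderPrimitive hx t)
    (fun t _ => mul_nonneg (sq_sub_two_add_two_mul_cos_nonneg t) (exp_pos _).le)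
    (tendsto_cosRemainderPrimitive hx)]
  simp only [cosRemainderPrimitive, sin_zero, cos_zero, mul_zero, neg_zero, exp_zero]
  field_simp
  ring

lemma integral_pow_three_mul_exp {t : ℝ} (ht : 0 < t) :
    ∫ x in Set.Ioi (0 : ℝ), x ^ 3 * exp (-(x * t)) = 6 / t ^ 4 := by
  have h := integral_rpow_mul_exp_neg_mul_Ioi (a := 4) (by norm_num) ht
  have hGamma : Gamma 4 = 6 := by
    rw [show (4 : ℝ) = (3 : ℕ) + 1 by norm_num, Gamma_nat_eq_factorial]
    norm_num [Nat.factorial]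
  have h3 : (4 - 1 : ℝ) = (3 : ℕ) := by norm_num
  have h4 : (4 : ℝ) = (4 : ℕ) := by norm_num
  rw [hGamma, h3] at h
  simp only [rpow_natCast] at h
  rw [h4, rpow_natCast] at h
  simp only [mul_comm _ t]
  rw [h]
  field_simp

lemma integral_Ioi_cosRemainder_div_pow_four :
    ∫ t in Set.Ioi (0 : ℝ), (t ^ 2 - 2 + 2 * cos t) / t ^ 4 = π / 6 := by
  let F : ℝ → ℝ → ℝ := fun x t => x ^ 3 * ((t ^ 2 - 2 + 2 * cos t) * exp (-(x * t)))
  have hinner {x : ℝ} (hx : 0 < x) :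
      ∫ t in Set.Ioi (0 : ℝ), F x t = 2 * (1 + x ^ 2)⁻¹ := by
    simp only [F]
    rw [integral_const_mul, integral_cosRemainder_mul_exp hx]
    field_simp
  have hnorm {x : ℝ} (hx : 0 < x) (t : ℝ) : ‖F x t‖ = F x t :=
    norm_of_nonneg (mul_nonneg (by positivity)
      (mul_nonneg (sq_sub_two_add_two_mul_cos_nonneg t) (exp_pos _).le))
  have hF : Integrable (Function.uncurry F)
      ((volume.restrict (Set.Ioi (0 : ℝ))).prod (volume.restrict (Set.Ioi (0 : ℝ)))) := by
    have hcont : Continuous (Function.uncurry F) := by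
      simp only [F, Function.uncurry_def]
      fun_prop
    rw [integrable_prod_iff hcont.aestronglyMeasurable]
    constructor
    · filter_upwards [ae_restrict_mem measurableSet_Ioi] with x hx
      exact (integrableOn_cosRemainder_mul_exp hx).const_mul (x ^ 3)
    · refine ((integrable_inv_one_add_sq.const_mul 2).integrableOn (s := Set.Ioi 0)).congr ?_
      filter_upwards [ae_restrict_mem measurableSet_Ioi] with x hx
      simp only [Function.uncurry_apply_pair, hnorm hx, hinner hx]
  have hswap := integral_integral_swap hF
  rw [setIntegral_congr_fun measurableSet_Ioi (fun x hx => hinner hx), integral_const_mul,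
    integral_Ioi_inv_one_add_sq] at hswap
  have houter : ∫ t in Set.Ioi (0 : ℝ), ∫ x in Set.Ioi (0 : ℝ), F x t
      = 6 * ∫ t in Set.Ioi (0 : ℝ), (t ^ 2 - 2 + 2 * cos t) / t ^ 4 := by
    rw [← integral_const_mul]
    refine setIntegral_congr_fun measurableSet_Ioi fun t ht => ?_
    have hcomm : ∀ x, F x t = (t ^ 2 - 2 + 2 * cos t) * (x ^ 3 * exp (-(x * t))) :=
      fun x => by simp only [F]; ring
    simp only [hcomm]
    rw [integral_const_mul, integral_pow_three_mul_exp ht]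
    ring
  rw [houter, arctan_zero] at hswap
  linarith

lemma integral_cosRemainder_div_pow_four :
    ∫ t : ℝ, (t ^ 2 - 2 + 2 * cos t) / t ^ 4 = π / 3 := by
  have h := integral_comp_abs (f := fun t : ℝ => (t ^ 2 - 2 + 2 * cos t) / t ^ 4)
  simp only [sq_abs, cos_abs, Even.pow_abs (show Even 4 by decide)] at h
  rw [h, integral_Ioi_cosRemainder_div_pow_four]
  ring

lemma integrable_cosRemainder_div_pow_four :
    Integrable (fun t : ℝ => (t ^ 2 - 2 + 2 * cos t) / t ^ 4) :=
  .of_integral_ne_zero (by rw [integral_cosRemainder_div_pow_four]; positivity)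

lemma sq_mul_helixM_eq {ρ t : ℝ} (hρ : 0 < ρ) (ht : t ≠ 0) :
    ρ ^ 2 * helixM ρ t = (t ^ 2 - 2 + 2 * cos t) / t ^ 4
      * (t ^ 2 / (t ^ 2 + 4 * sin (t / 2) ^ 2 / ρ ^ 2)) := by
  have hsin : 4 * sin (t / 2) ^ 2 = 2 - 2 * cos t := by
    rw [sin_sq_eq_half_sub]
    ring_nf
  have hnum : t ^ 2 - 2 + 2 * cos t = t ^ 2 - 4 * sin (t / 2) ^ 2 := by linarith
  have hden : ρ ^ 2 * t ^ 2 + 4 * sin (t / 2) ^ 2 ≠ 0 := by positivity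
  rw [helixM, hnum]
  field_simp
  ring

theorem helixI_asymptotics_infty :
    Filter.Tendsto (fun ρ : ℝ => ρ ^ 2 * helixI ρ) Filter.atTop (nhds (π / 3)) := by
  have hne : ∀ᵐ t : ℝ, t ≠ 0 := by simp [ae_iff]
  simp only [helixI, ← integral_const_mul]
  rw [← integral_cosRemainder_div_pow_four]
  refine tendsto_integral_filter_of_dominated_convergence _ (.of_forall fun ρ => ?_) ?_
    integrable_cosRemainder_div_pow_four ?_
  · unfold helixM
    exact Measurable.aestronglyMeasurable (by fun_prop)
  · filter_upwards [eventually_gt_atTop 0] with ρ hρ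
    filter_upwards [hne] with t ht
    have hg : 0 ≤ (t ^ 2 - 2 + 2 * cos t) / t ^ 4 :=
      div_nonneg (sq_sub_two_add_two_mul_cos_nonneg t) (by positivity)
    rw [sq_mul_helixM_eq hρ ht, norm_of_nonneg (mul_nonneg hg (by positivity))]
    refine mul_le_of_le_one_right hg (div_le_one_of_le₀ ?_ (by positivity))
    exact le_add_of_nonneg_right (by positivity)
  · filter_upwards [hne] with t ht
    have hsmall : Tendsto (fun ρ : ℝ => 4 * sin (t / 2) ^ 2 / ρ ^ 2) atTop (nhds 0) :=
      tendsto_const_nhds.div_atTop (tendsto_pow_atTop two_ne_zero)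
    have ht2 : t ^ 2 ≠ 0 := pow_ne_zero 2 ht
    have hratio := ((tendsto_const_nhds (x := t ^ 2)).div
      ((tendsto_const_nhds (x := t ^ 2)).add hsmall) (by simpa using ht)).const_mul
      ((t ^ 2 - 2 + 2 * cos t) / t ^ 4)
    rw [add_zero, div_self ht2, mul_one] at hratio
    refine hratio.congr' ?_
    filter_upwards [eventually_gt_atTop 0] with ρ hρ
    exact (sq_mul_helixM_eq hρ ht).symm
end

section
/- For each integer k ≥ 1, the equation θ·tan θ + 1 = 0 has exactly one solution c_k in the open interval ((k − 1/2)π, (k + 1/2)π); moreover this solution lies in ((k − 1/2)π, kπ), and the sequence c_k satisfies c_k/(kπ) → 1 as k → ∞. -/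
open Real Filter

/-- For `a > π / 2`, the function `t ↦ (a + t) sin t + cos t` is strictly increasing on
`[-π / 2, π / 2]`: its derivative is `(a + t) cos t`. -/
lemma strictMonoOn_add_mul_sin_add_cos {a : ℝ} (ha : π / 2 < a) :
    StrictMonoOn (fun t => (a + t) * sin t + cos t) (Set.Icc (-(π / 2)) (π / 2)) := by
  refine strictMonoOn_of_deriv_pos (convex_Icc _ _) (by fun_prop) fun t ht => ?_
  rw [interior_Icc] at ht
  have hd : HasDerivAt (fun t => (a + t) * sin t + cos t) ((a + t) * cos t) t := by
    refine ((((hasDerivAt_id' t).const_add a).mul (hasDerivAt_sin t)).add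
      (hasDerivAt_cos t)).congr_deriv ?_
    ring
  rw [hd.deriv]
  exact mul_pos (by linarith [ht.1]) (cos_pos_of_mem_Ioo ht)

lemma add_nat_mul_pi_mul_tan_add_one_eq_zero_iff (k : ℕ) {t : ℝ}
    (ht : t ∈ Set.Ioo (-(π / 2)) (π / 2)) :
    (k * π + t) * tan (k * π + t) + 1 = 0 ↔ (k * π + t) * sin t + cos t = 0 := by
  have hc : cos t ≠ 0 := (cos_pos_of_mem_Ioo ht).ne'
  rw [add_comm (k * π) t, tan_add_nat_mul_pi, tan_eq_sin_div_cos]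
  field_simp
  rw [mul_zero]

lemma exists_unique_root_mul_tan_add_one {k : ℕ} (hk : 1 ≤ k) :
    ∃ c ∈ Set.Ioo (((k : ℝ) - 1 / 2) * π) ((k : ℝ) * π), c * tan c + 1 = 0 ∧
      ∀ θ ∈ Set.Ioo (((k : ℝ) - 1 / 2) * π) (((k : ℝ) + 1 / 2) * π),
        θ * tan θ + 1 = 0 → θ = c := by
  have hpi := pi_pos
  have ha : π / 2 < k * π := by
    have : (1 : ℝ) ≤ k := by exact_mod_cast hk
    nlinarith
  have hmono := strictMonoOn_add_mul_sin_add_cos ha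
  obtain ⟨t, ht, hroot⟩ : ∃ t ∈ Set.Ioo (-(π / 2)) 0, (k * π + t) * sin t + cos t = 0 := by
    refine intermediate_value_Ioo (f := fun t => (k * π + t) * sin t + cos t)
      (by linarith) (by fun_prop) ⟨?_, ?_⟩
    · simp only [sin_neg, sin_pi_div_two, cos_neg, cos_pi_div_two]
      linarith
    · simp
  have ht' : t ∈ Set.Ioo (-(π / 2)) (π / 2) := ⟨ht.1, by linarith [ht.2]⟩
  refine ⟨k * π + t, ⟨by linarith [ht.1], by linarith [ht.2]⟩,
    (add_nat_mul_pi_mul_tan_add_one_eq_zero_iff k ht').2 hroot, fun θ hθ hθ0 => ?_⟩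
  obtain ⟨s, rfl⟩ : ∃ s, θ = k * π + s := ⟨θ - k * π, by ring⟩
  have hs : s ∈ Set.Ioo (-(π / 2)) (π / 2) := ⟨by linarith [hθ.1], by linarith [hθ.2]⟩
  have hs0 := (add_nat_mul_pi_mul_tan_add_one_eq_zero_iff k hs).1 hθ0
  rw [hmono.injOn (Set.Ioo_subset_Icc_self hs) (Set.Ioo_subset_Icc_self ht')
    (hs0.trans hroot.symm)]

/-- For each `k ≥ 1`, the equation `θ tan θ + 1 = 0` has exactly one solution in the interval
`((k - 1/2)π, (k + 1/2)π)`, this solution lies in `((k - 1/2)π, kπ)`, and the sequence of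
solutions satisfies `c_k / (kπ) → 1` as `k → ∞`. -/
theorem xtanx_roots :
    ∃ c : ℕ → ℝ,
      (∀ k : ℕ, 1 ≤ k →
        c k ∈ Set.Ioo (((k : ℝ) - 1 / 2) * π) ((k : ℝ) * π) ∧
        c k * Real.tan (c k) + 1 = 0 ∧
        ∀ θ ∈ Set.Ioo (((k : ℝ) - 1 / 2) * π) (((k : ℝ) + 1 / 2) * π),
          θ * Real.tan θ + 1 = 0 → θ = c k) ∧
      Filter.Tendsto (fun k : ℕ => c k / ((k : ℝ) * π)) Filter.atTop (nhds 1) := by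
  choose! c hc using fun (k : ℕ) (hk : 1 ≤ k) => exists_unique_root_mul_tan_add_one hk
  refine ⟨c, hc, ?_⟩
  have hlow : Tendsto (fun k : ℕ => 1 - 1 / 2 / (k : ℝ)) atTop (nhds 1) := by
    simpa using (tendsto_const_div_atTop_nhds_zero_nat (1 / 2 : ℝ)).const_sub 1
  refine tendsto_of_tendsto_of_tendsto_of_le_of_le' hlow tendsto_const_nhds ?_ ?_
  all_goals
    filter_upwards [eventually_ge_atTop 1] with k hk
    have hk0 : (0 : ℝ) < k := by exact_mod_cast hk
    have hkpi : 0 < k * π := mul_pos hk0 pi_pos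
  · rw [le_div_iff₀ hkpi]
    refine le_of_eq_of_le ?_ (hc k hk).1.1.le
    field_simp
  · exact (div_le_one hkpi).2 (hc k hk).1.2.le
end

section
/- Let c_k denote, for each integer k ≥ 1, the unique solution of θ·tan θ + 1 = 0 in ((k − 1/2)π, kπ), and set a_k = kπ − c_k. Then for every real p > 1 the series Σ_{k=1}^∞ |a_k|^p converges. -/
open Real

/-- A solution of `θ tan θ + 1 = 0` in `((k + 1/2)π, (k + 1)π)` is within `1 / (k + 1)` of the
right endpoint. -/
theorem gap_le_one_div {k : ℕ} {θ : ℝ} (hlo : (((k + 1 : ℕ) : ℝ) - 1 / 2) * π < θ)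
    (hhi : θ < ((k + 1 : ℕ) : ℝ) * π) (heq : θ * Real.tan θ + 1 = 0) :
    |((k + 1 : ℕ) : ℝ) * π - θ| ≤ 1 / ((k + 1 : ℕ) : ℝ) := by
  have htan : Real.tan (((k + 1 : ℕ) : ℝ) * π - θ) = -Real.tan θ := Real.tan_nat_mul_pi_sub θ _
  have hlt := Real.lt_tan (sub_pos.mpr hhi) (by linarith)
  have hk : (1 : ℝ) ≤ ((k + 1 : ℕ) : ℝ) := by exact_mod_cast Nat.le_add_left 1 k
  have hθ : ((k + 1 : ℕ) : ℝ) ≤ θ := by nlinarith [Real.pi_gt_three]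
  rw [abs_of_pos (sub_pos.mpr hhi)]
  calc ((k + 1 : ℕ) : ℝ) * π - θ ≤ -Real.tan θ := by linarith
    _ = 1 / θ := by
      rw [eq_div_iff (by linarith)]
      linarith
    _ ≤ 1 / ((k + 1 : ℕ) : ℝ) := one_div_le_one_div_of_le (by linarith) hθ

/-- If `c k` is for each `k ≥ 1` the unique solution of `θ tan θ + 1 = 0` in
`((k - 1/2)π, kπ)` and `a_k = kπ - c_k`, then `Σ |a_k|^p` converges for every real `p > 1`. -/
theorem xtanx_gaps_summable (c : ℕ → ℝ)
    (hc : ∀ k : ℕ, 1 ≤ k →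
      c k ∈ Set.Ioo (((k : ℝ) - 1 / 2) * π) ((k : ℝ) * π) ∧
      c k * Real.tan (c k) + 1 = 0 ∧
      ∀ θ ∈ Set.Ioo (((k : ℝ) - 1 / 2) * π) ((k : ℝ) * π),
        θ * Real.tan θ + 1 = 0 → θ = c k)
    (p : ℝ) (hp : 1 < p) :
    Summable (fun k : ℕ => |((k : ℝ) + 1) * π - c (k + 1)| ^ p) := by
  have hsum : Summable (fun k : ℕ => (1 / ((k : ℝ) + 1)) ^ p) := by
    have h := (summable_nat_add_iff 1).mpr (Real.summable_one_div_nat_rpow.mpr hp)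
    refine h.congr fun k => ?_
    rw [Real.div_rpow zero_le_one (by positivity), Real.one_rpow]
    push_cast
    rfl
  refine hsum.of_nonneg_of_le (fun k => by positivity) fun k => ?_
  obtain ⟨⟨hlo, hhi⟩, heq, -⟩ := hc (k + 1) (Nat.le_add_left 1 k)
  exact Real.rpow_le_rpow (abs_nonneg _)
    (by exact_mod_cast gap_le_one_div hlo hhi heq) (by linarith)
end

section
/- For every ρ > 0 and every integer k ≥ 1, the function E_ρ has exactly one root z with Re z ∈ [(2k−1)π, 2kπ] and Im z > 0. Moreover, every root z of E_ρ with Re z ≥ 0 and Im z > 0 satisfies Re z ∈ [(2k−1)π, 2kπ] for some integer k ≥ 1, so these roots enumerate all roots of E_ρ in the closed upper-right quadrant with positive imaginary part. -/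
open Real Complex

/-- The exponential polynomial `E_ρ(z) = ρ²z² + 4 sin²(z/2)` whose roots are the poles of the
helix Möbius density. -/
noncomputable def helixE (ρ : ℝ) (z : ℂ) : ℂ :=
  (ρ : ℂ) ^ 2 * z ^ 2 + 4 * Complex.sin (z / 2) ^ 2

/-- The map `x ↦ (m - arctan x) * x` is a diffeomorphism of `ℝ` for `m ≥ π`. -/
theorem exists_inverse_sub_arctan_mul (m : ℝ) (hm : π ≤ m) :
    ∃ g : ℝ → ℝ, (∀ s, (m - Real.arctan (g s)) * g s = s) ∧
      (∀ x, g ((m - Real.arctan x) * x) = x) ∧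
      ∀ s, 0 < m - Real.arctan (g s) - g s / (1 + g s ^ 2) ∧
        HasDerivAt g (m - Real.arctan (g s) - g s / (1 + g s ^ 2))⁻¹ s := by
  set χ : ℝ → ℝ := fun x ↦ (m - Real.arctan x) * x with hχ
  have hπ := Real.pi_gt_three
  have hderiv (x : ℝ) : HasDerivAt χ (m - Real.arctan x - x / (1 + x ^ 2)) x := by
    refine (((Real.hasDerivAt_arctan x).const_sub m).mul (hasDerivAt_id x)).congr_deriv ?_
    simp only [id]
    ring
  have hpos (x : ℝ) : 0 < m - Real.arctan x - x / (1 + x ^ 2) := by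
    have h₁ := Real.arctan_lt_pi_div_two x
    have h₂ : x / (1 + x ^ 2) ≤ 1 / 2 := by
      rw [div_le_div_iff₀ (by positivity) (by norm_num)]
      nlinarith [sq_nonneg (x - 1)]
    linarith
  have hmono : StrictMono χ := strictMono_of_deriv_pos fun x ↦ by
    rw [(hderiv x).deriv]
    exact hpos x
  have hcont : Continuous χ := continuous_iff_continuousAt.2 fun x ↦ (hderiv x).continuousAt
  have hsurj : Function.Surjective χ := by
    refine hcont.surjective ?_ ?_
    · refine Filter.tendsto_atTop_mono' _ ?_ Filter.tendsto_id
      filter_upwards [Filter.eventually_ge_atTop 0] with x hx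
      have h₁ := Real.arctan_lt_pi_div_two x
      simp only [hχ, id]
      nlinarith
    · refine Filter.tendsto_atBot_mono' _ ?_ Filter.tendsto_id
      filter_upwards [Filter.eventually_le_atBot 0] with x hx
      have h₁ := Real.arctan_lt_pi_div_two x
      simp only [hχ, id]
      nlinarith
  let e := hmono.orderIsoOfSurjective χ hsurj
  have he (s : ℝ) : χ (e.symm s) = s := e.apply_symm_apply s
  refine ⟨e.symm, he, fun x ↦ e.symm_apply_apply x, fun s ↦ ⟨hpos _, ?_⟩⟩
  exact (hderiv _).of_local_left_inverse e.symm.continuous.continuousAt (hpos _).ne'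
    (Filter.Eventually.of_forall he)

theorem Real.hasDerivAt_mul_tanh (b : ℝ) :
    HasDerivAt (fun x ↦ x * Real.tanh x) (Real.tanh b + b * (1 - Real.tanh b ^ 2)) b := by
  have hc := (Real.cosh_pos b).ne'
  have h := (hasDerivAt_id b).mul ((Real.hasDerivAt_sinh b).div (Real.hasDerivAt_cosh b) hc)
  have hfun : (fun x ↦ x * Real.tanh x) = id * (Real.sinh / Real.cosh) := by
    funext x
    simp [Real.tanh_eq_sinh_div_cosh]
  rw [hfun]
  refine h.congr_deriv ?_
  simp only [Real.tanh_eq_sinh_div_cosh, id, Pi.div_apply]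
  field_simp

theorem sq_div_four_le_sinh {b : ℝ} (hb : 0 ≤ b) : b ^ 2 / 4 ≤ Real.sinh b := by
  have h₁ := Real.quadratic_le_exp_of_nonneg hb
  have h₂ : Real.exp (-b) ≤ 1 := Real.exp_le_one_iff.2 (by linarith)
  rw [Real.sinh_eq]
  linarith

/-- The system characterising the roots of `helixE ρ`, with `z = 2 (m - arctan t + b I)`. -/
theorem existsUnique_root_system (ρ m : ℝ) (hρ : 0 < ρ) (hm : π ≤ m) :
    ∃! p : ℝ × ℝ, 0 < p.1 ∧ (m - Real.arctan p.2) * p.2 = p.1 * Real.tanh p.1 ∧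
      Real.sinh p.1 ^ 2 = ρ ^ 2 * ((m - Real.arctan p.2) ^ 2 * (1 + p.2 ^ 2)) := by
  obtain ⟨g, hg, hg', hderiv⟩ := exists_inverse_sub_arctan_mul m hm
  have hπ := Real.pi_gt_three
  set t : ℝ → ℝ := fun b ↦ g (b * Real.tanh b) with ht
  set a : ℝ → ℝ := fun b ↦ m - Real.arctan (t b) with ha
  have hat (b : ℝ) : a b * t b = b * Real.tanh b := hg _
  have hapos (b : ℝ) : 0 < a b := by
    have := Real.arctan_lt_pi_div_two (t b)
    simp only [ha]
    linarith
  set P : ℝ → ℝ := fun b ↦ a b ^ 2 * (1 + t b ^ 2) with hP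
  have hPpos (b : ℝ) : 0 < P b := by
    have := hapos b
    positivity
  set Q : ℝ → ℝ := fun b ↦ Real.sinh b ^ 2 / P b with hQ
  have hden (b : ℝ) : 0 < a b * (1 + t b ^ 2) - t b := by
    have h := mul_pos (hderiv (b * Real.tanh b)).1 (by positivity : 0 < 1 + t b ^ 2)
    have h' : (m - Real.arctan (t b) - t b / (1 + t b ^ 2)) * (1 + t b ^ 2) =
        a b * (1 + t b ^ 2) - t b := by
      simp only [ha]
      field_simp
    rwa [← h']
  have hdt (b : ℝ) : HasDerivAt t ((Real.tanh b + b * (1 - Real.tanh b ^ 2)) * (1 + t b ^ 2) /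
      (a b * (1 + t b ^ 2) - t b)) b := by
    refine ((hderiv (b * Real.tanh b)).2.comp b (Real.hasDerivAt_mul_tanh b)).congr_deriv ?_
    change (m - Real.arctan (t b) - t b / (1 + t b ^ 2))⁻¹ * _ = _
    have h3 : m - Real.arctan (t b) - t b / (1 + t b ^ 2) =
        (a b * (1 + t b ^ 2) - t b) / (1 + t b ^ 2) := by
      simp only [ha]
      field_simp
    rw [h3, inv_div]
    ring
  have hdP (b : ℝ) : HasDerivAt P (2 * a b * (a b * t b - 1) *
      ((Real.tanh b + b * (1 - Real.tanh b ^ 2)) * (1 + t b ^ 2) /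
      (a b * (1 + t b ^ 2) - t b))) b := by
    have hda := (hdt b).arctan.const_sub m
    refine ((hda.pow 2).mul (((hdt b).pow 2).const_add 1)).congr_deriv ?_
    have h2 := (hden b).ne'
    simp only [Pi.pow_apply]
    change _ * (a b) ^ _ * _ * _ + (a b) ^ _ * _ = _
    field_simp
    ring
  have hdQ (b : ℝ) : HasDerivAt Q ((2 * Real.sinh b * Real.cosh b * P b - Real.sinh b ^ 2 *
      (2 * a b * (a b * t b - 1) * ((Real.tanh b + b * (1 - Real.tanh b ^ 2)) * (1 + t b ^ 2) /
      (a b * (1 + t b ^ 2) - t b)))) / P b ^ 2) b := by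
    refine (((Real.hasDerivAt_sinh b).pow 2).div (hdP b) (hPpos b).ne').congr_deriv ?_
    simp
  have hQcont : Continuous Q := continuous_iff_continuousAt.2 fun b ↦ (hdQ b).continuousAt
  have hQmono : StrictMonoOn Q (Set.Ici 0) := by
    refine strictMonoOn_of_deriv_pos (convex_Ici 0) hQcont.continuousOn fun b hb ↦ ?_
    rw [interior_Ici, Set.mem_Ioi] at hb
    rw [(hdQ b).deriv]
    refine div_pos ?_ (pow_pos (hPpos b) 2)
    have hs := Real.sinh_pos_iff.2 hb
    have hc := Real.cosh_pos b
    have hsT : Real.sinh b = Real.tanh b * Real.cosh b := by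
      rw [Real.tanh_eq_sinh_div_cosh]
      field_simp
    have hfac : 2 * Real.sinh b * Real.cosh b * P b - Real.sinh b ^ 2 *
        (2 * a b * (a b * t b - 1) * ((Real.tanh b + b * (1 - Real.tanh b ^ 2)) * (1 + t b ^ 2) /
        (a b * (1 + t b ^ 2) - t b))) =
        2 * Real.sinh b * Real.cosh b * (a b * (1 + t b ^ 2)) / (a b * (1 + t b ^ 2) - t b) *
        (a b ^ 2 + (Real.tanh b - b * Real.tanh b ^ 2) ^ 2) := by
      have h2 := (hden b).ne'
      have key : a b * (a b * (1 + t b ^ 2) - t b) - Real.tanh b * (a b * t b - 1) *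
          (Real.tanh b + b * (1 - Real.tanh b ^ 2)) =
          a b ^ 2 + (Real.tanh b - b * Real.tanh b ^ 2) ^ 2 := by
        linear_combination (a b * t b + b * Real.tanh b - 1 - Real.tanh b *
          (Real.tanh b + b * (1 - Real.tanh b ^ 2))) * hat b
      rw [← key, pow_two (Real.sinh b)]
      nth_rewrite 3 [hsT]
      simp only [hP]
      field_simp
    rw [hfac]
    have := hden b
    have := hapos b
    positivity
  obtain ⟨M, hM, hQM⟩ : ∃ M, 0 ≤ M ∧ ρ ^ 2 ≤ Q M := by
    set c := m + π with hcdef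
    have hc : 0 < c := by linarith
    refine ⟨1 + 4 * ρ * (c + 1), by positivity, ?_⟩
    set b := 1 + 4 * ρ * (c + 1) with hb
    have hb1 : 1 ≤ b := by
      have : 0 < 4 * ρ * (c + 1) := by positivity
      linarith
    have hPb : P b ≤ c ^ 2 + b ^ 2 := by
      have h1 : P b = a b ^ 2 + (b * Real.tanh b) ^ 2 := by
        rw [← hat]
        simp only [hP]
        ring
      have h2 : a b ≤ c := by
        have := Real.neg_pi_div_two_lt_arctan (t b)
        simp only [ha]
        linarith
      have h3 : Real.tanh b ^ 2 ≤ 1 := (Real.tanh_sq_lt_one b).le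
      have h4 := pow_le_pow_left₀ (hapos b).le h2 2
      have h5 := mul_le_mul_of_nonneg_left h3 (sq_nonneg b)
      rw [h1, mul_pow]
      linarith
    have hsinh : (b ^ 2 / 4) ^ 2 ≤ Real.sinh b ^ 2 :=
      pow_le_pow_left₀ (by positivity) (sq_div_four_le_sinh (by linarith)) 2
    rw [hQ, le_div_iff₀ (hPpos b)]
    have h6 : 16 * ρ ^ 2 * (c ^ 2 + 1) ≤ b ^ 2 := by
      have : 0 < ρ * c := by positivity
      have : 0 < ρ ^ 2 * c := by positivity
      rw [hb]
      nlinarith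
    have h7 : c ^ 2 + b ^ 2 ≤ (c ^ 2 + 1) * b ^ 2 := by
      have : 1 ≤ b ^ 2 := one_le_pow₀ hb1
      nlinarith [sq_nonneg c]
    calc ρ ^ 2 * P b ≤ ρ ^ 2 * ((c ^ 2 + 1) * b ^ 2) := by gcongr; linarith
      _ = 16 * ρ ^ 2 * (c ^ 2 + 1) * b ^ 2 / 16 := by ring
      _ ≤ b ^ 2 * b ^ 2 / 16 := by gcongr
      _ ≤ Real.sinh b ^ 2 := by linarith
  have hQ0 : Q 0 = 0 := by simp [hQ]
  obtain ⟨b, hb, hQb⟩ := intermediate_value_Icc hM hQcont.continuousOn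
    (show ρ ^ 2 ∈ Set.Icc (Q 0) (Q M) from ⟨by rw [hQ0]; positivity, hQM⟩)
  have hb0 : 0 < b := by
    refine hb.1.lt_of_ne fun h ↦ ?_
    rw [← h, hQ0] at hQb
    exact (pow_pos hρ 2).ne hQb
  refine ⟨(b, t b), ⟨hb0, hat b, ?_⟩, ?_⟩
  · exact (div_eq_iff (hPpos b).ne').1 hQb
  · rintro ⟨b', t'⟩ ⟨hb', h1, h2⟩
    simp only at hb' h1 h2
    have htt : t' = t b' := by
      simp only [ht]
      rw [← h1, hg']
    subst htt
    have hQb' : Q b' = ρ ^ 2 := (div_eq_iff (hPpos b').ne').2 h2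
    have : b' = b := hQmono.injOn hb'.le hb0.le (hQb'.trans hQb.symm)
    rw [this]

/-- Roots of `helixE ρ` in Cartesian coordinates. -/
theorem helixE_eq_zero_iff (ρ a b : ℝ) :
    helixE ρ (2 * (a + b * Complex.I)) = 0 ↔
      ∃ τ : ℝ, τ ^ 2 = 1 ∧ Real.sin a * Real.cosh b = -(τ * ρ * b) ∧
        Real.cos a * Real.sinh b = τ * ρ * a := by
  have hsin : Complex.sin (a + b * Complex.I) =
      ((Real.sin a * Real.cosh b : ℝ) : ℂ) + ((Real.cos a * Real.sinh b : ℝ) : ℂ) * Complex.I := by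
    rw [Complex.sin_add_mul_I]
    push_cast
    ring
  have hE : helixE ρ (2 * (a + b * Complex.I)) =
      4 * ((Complex.sin (a + b * Complex.I)) ^ 2 - (Complex.I * ρ * (a + b * Complex.I)) ^ 2) := by
    rw [helixE, mul_div_cancel_left₀ _ two_ne_zero, mul_pow, mul_pow, mul_pow, Complex.I_sq]
    ring
  have hlin (τ : ℝ) : Complex.sin (a + b * Complex.I) = τ * (Complex.I * ρ * (a + b * Complex.I)) ↔
      Real.sin a * Real.cosh b = -(τ * ρ * b) ∧ Real.cos a * Real.sinh b = τ * ρ * a := by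
    have : (τ : ℂ) * (Complex.I * ρ * (a + b * Complex.I)) =
        ((-(τ * ρ * b) : ℝ) : ℂ) + ((τ * ρ * a : ℝ) : ℂ) * Complex.I := by
      push_cast
      linear_combination (τ : ℂ) * ρ * b * Complex.I_sq
    rw [hsin, this, Complex.ext_iff]
    simp only [Complex.add_re, Complex.add_im, Complex.re_ofReal_mul, Complex.im_ofReal_mul,
      Complex.ofReal_re, Complex.ofReal_im, Complex.I_re, Complex.I_im, mul_zero, mul_one,
      add_zero, zero_add]
  rw [hE, mul_eq_zero, or_iff_right (by norm_num : (4 : ℂ) ≠ 0), sub_eq_zero]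
  constructor
  · intro h
    rcases sq_eq_sq_iff_eq_or_eq_neg.1 h with h | h
    · exact ⟨1, by norm_num, (hlin 1).1 (by simpa using h)⟩
    · exact ⟨-1, by norm_num, (hlin (-1)).1 (by simpa using h)⟩
  · rintro ⟨τ, hτ, h⟩
    have hτ' : (τ : ℂ) ^ 2 = 1 := by exact_mod_cast hτ
    rw [(hlin τ).2 h, mul_pow, hτ', one_mul]

/-- At a root of `helixE ρ` in the right half of the upper half-plane, `sin (Re z)` is
negative. -/
theorem sin_two_mul_neg_of_root {ρ a b τ : ℝ} (hρ : 0 < ρ) (ha : 0 ≤ a) (hb : 0 < b)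
    (hτ : τ ^ 2 = 1) (h₁ : Real.sin a * Real.cosh b = -(τ * ρ * b))
    (h₂ : Real.cos a * Real.sinh b = τ * ρ * a) : Real.sin (2 * a) < 0 := by
  have hs := Real.sinh_pos_iff.2 hb
  have hc := Real.cosh_pos b
  have ha0 : 0 < a := by
    refine ha.lt_of_ne fun h ↦ ?_
    rw [← h] at h₂
    simp at h₂
    exact hb.ne' h₂
  have h : Real.sin (2 * a) * (Real.cosh b * Real.sinh b) = -(2 * ρ ^ 2 * a * b) := by
    rw [Real.sin_two_mul]
    linear_combination 2 * Real.cos a * Real.sinh b * h₁ - 2 * τ * ρ * b * h₂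
      - 2 * ρ ^ 2 * a * b * hτ
  have : 0 < ρ ^ 2 * a * b := by positivity
  by_contra! hn
  have := mul_nonneg hn (mul_pos hc hs).le
  linarith

theorem exists_mem_Icc_of_sin_neg {x : ℝ} (hx : 0 ≤ x) (hsin : Real.sin x < 0) :
    ∃ k : ℕ, 1 ≤ k ∧ x ∈ Set.Icc ((2 * (k : ℝ) - 1) * π) (2 * (k : ℝ) * π) := by
  have hπ := Real.pi_pos
  set n := ⌊x / (2 * π)⌋₊ with hn
  have h1 : n * (2 * π) ≤ x := (le_div_iff₀ (by positivity)).1 (Nat.floor_le (by positivity))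
  have h2 : x < (n + 1) * (2 * π) := (div_lt_iff₀ (by positivity)).1 (Nat.lt_floor_add_one _)
  refine ⟨n + 1, by omega, ?_, ?_⟩
  · by_contra! h
    push_cast at h
    have := Real.sin_nonneg_of_nonneg_of_le_pi (x := x - n * (2 * π)) (by linarith) (by linarith)
    rw [Real.sin_sub_nat_mul_two_pi] at this
    linarith
  · push_cast
    linarith

/-- For every `ρ > 0` and `k ≥ 1`, `E_ρ` has exactly one root in the vertical half-strip
`[(2k-1)π, 2kπ] × ℝ⁺`, and these enumerate all roots of `E_ρ` in the open upper-right
quadrant (closed on the imaginary axis side). -/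
theorem helixE_roots (ρ : ℝ) (hρ : 0 < ρ) :
    (∀ k : ℕ, 1 ≤ k → ∃! z : ℂ,
      helixE ρ z = 0 ∧
      z.re ∈ Set.Icc ((2 * (k : ℝ) - 1) * π) (2 * (k : ℝ) * π) ∧ 0 < z.im) ∧
    (∀ z : ℂ, helixE ρ z = 0 → 0 ≤ z.re → 0 < z.im →
      ∃ k : ℕ, 1 ≤ k ∧ z.re ∈ Set.Icc ((2 * (k : ℝ) - 1) * π) (2 * (k : ℝ) * π)) := by
  have hπ := Real.pi_pos
  have hz (z : ℂ) : z = 2 * (((z.re / 2 : ℝ) : ℂ) + ((z.im / 2 : ℝ) : ℂ) * Complex.I) := by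
    conv_lhs => rw [← Complex.re_add_im z]
    push_cast
    ring
  refine ⟨fun k hk ↦ ?_, fun z hE hre him ↦ ?_⟩
  · have hk' : (1 : ℝ) ≤ k := by exact_mod_cast hk
    have hm : π ≤ k * π := by nlinarith
    obtain ⟨⟨b, t⟩, ⟨hb, h1, h2⟩, huniq⟩ := existsUnique_root_system ρ (k * π) hρ hm
    simp only at hb h1 h2
    set a := k * π - Real.arctan t with ha
    have hs := Real.sinh_pos_iff.2 hb
    have hc := Real.cosh_pos b
    have hapos : 0 < a := by
      have := Real.arctan_lt_pi_div_two t
      linarith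
    have h1' : a * t * Real.cosh b = b * Real.sinh b := by
      rw [h1, Real.tanh_eq_sinh_div_cosh]
      field_simp
    have htpos : 0 < t := by
      by_contra! hn
      have := mul_nonneg (mul_nonneg hapos.le (neg_nonneg.2 hn)) hc.le
      nlinarith [mul_pos hb hs]
    have harc := Real.arctan_pos.2 htpos
    have harc' := Real.arctan_lt_pi_div_two t
    refine ⟨2 * ((a : ℂ) + b * Complex.I), ⟨?_, ?_, ?_⟩, ?_⟩
    · rw [helixE_eq_zero_iff]
      set r := Real.sqrt (1 + t ^ 2) with hr
      have hr2 : r ^ 2 = 1 + t ^ 2 := Real.sq_sqrt (by positivity)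
      have hrpos : 0 < r := Real.sqrt_pos.2 (by positivity)
      have hsr : Real.sinh b = ρ * a * r := by
        rw [← hr2] at h2
        refine (pow_left_inj₀ hs.le (by positivity) two_ne_zero).1 ?_
        rw [h2]
        ring
      refine ⟨(-1) ^ k, by rw [← pow_mul, mul_comm, pow_mul]; norm_num, ?_, ?_⟩
      · rw [ha, Real.sin_nat_mul_pi_sub, Real.sin_arctan, ← hr]
        have : t * Real.cosh b = ρ * b * r := by
          refine mul_left_cancel₀ hapos.ne' ?_
          rw [← mul_assoc, h1', hsr]
          ring
        field_simp
        linear_combination -this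
      · rw [ha, Real.cos_nat_mul_pi_sub, Real.cos_arctan, ← hr, hsr, ← ha]
        field_simp
    · have hre : (2 * ((a : ℂ) + b * Complex.I)).re = 2 * a := by simp
      rw [hre]
      constructor <;> linarith
    · simpa using hb
    · rintro z ⟨hE, ⟨hl, hu⟩, him⟩
      rw [hz z, helixE_eq_zero_iff] at hE
      rw [hz z]
      set x := z.re / 2 with hx
      set y := z.im / 2 with hy
      obtain ⟨τ, hτ, e1, e2⟩ := hE
      have hy0 : 0 < y := by linarith
      have hx0 : 0 ≤ x := by nlinarith
      have hsin := sin_two_mul_neg_of_root hρ hx0 hy0 hτ e1 e2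
      rw [Real.sin_two_mul] at hsin
      have hcos : Real.cos x ≠ 0 := fun h ↦ by
        rw [h] at hsin
        simp at hsin
      have hlt : k * π - x < π / 2 := by
        refine lt_of_le_of_ne (by linarith) fun h ↦ hcos ?_
        have hxeq : x = k * π - π / 2 := by linarith
        rw [hxeq, Real.cos_nat_mul_pi_sub, Real.cos_pi_div_two, mul_zero]
      have harctan : k * π - Real.arctan (-Real.tan x) = x := by
        have : -Real.tan x = Real.tan (k * π - x) := by rw [Real.tan_nat_mul_pi_sub]
        rw [this, Real.arctan_tan (by linarith) hlt]
        ring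
      have hcy := Real.cosh_pos y
      have hp := huniq (y, -Real.tan x) ⟨hy0, by
        simp only [harctan]
        rw [Real.tan_eq_sin_div_cos, Real.tanh_eq_sinh_div_cosh, ← neg_div, mul_div_assoc',
          mul_div_assoc', div_eq_div_iff hcos hcy.ne']
        linear_combination -x * e1 - y * e2, by
        simp only [harctan]
        rw [Real.tan_eq_sin_div_cos]
        field_simp
        rw [Real.cos_sq_add_sin_sq]
        linear_combination (Real.cos x * Real.sinh y + τ * ρ * x) * e2 + ρ ^ 2 * x ^ 2 * hτ⟩
      rw [Prod.mk.injEq] at hp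
      rw [ha, ← hp.2, harctan, hp.1]
  · rw [hz z, helixE_eq_zero_iff] at hE
    obtain ⟨τ, hτ, h1, h2⟩ := hE
    have h := sin_two_mul_neg_of_root hρ (by linarith) (by linarith) hτ h1 h2
    rw [mul_div_cancel₀ _ two_ne_zero] at h
    exact exists_mem_Icc_of_sin_neg hre h
end

section
/- For every ρ > 0 and every function z : {k ∈ ℕ : k ≥ 1} → ℂ such that for each k ≥ 1, z(k) is a root of E_ρ with Re z(k) ∈ [(2k−1)π, 2kπ] and Im z(k) > 0, the series Σ_{k=1}^∞ Im(1/E'_ρ(z(k))) converges absolutely and I(ρ) = −4π(ρ² + 1) · Σ_{k=1}^∞ Im(1/E'_ρ(z(k))). -/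
open Real Complex Filter MeasureTheory

/-- The derivative `E'_ρ(z) = 2ρ²z + 2 sin z` of `E_ρ`. -/
noncomputable def helixE' (ρ : ℝ) (z : ℂ) : ℂ :=
  2 * (ρ : ℂ) ^ 2 * z + 2 * Complex.sin z

open Set Topology

/-- The integral of `f` along the positively oriented boundary of `[a, b] × [c, d]`. -/
noncomputable def rectIntegral (f : ℂ → ℂ) (a b c d : ℝ) : ℂ :=
  (∫ x : ℝ in a..b, f (x + c * I)) - (∫ x : ℝ in a..b, f (x + d * I)) +
    I * (∫ y : ℝ in c..d, f (b + y * I)) - I * (∫ y : ℝ in c..d, f (a + y * I))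

theorem rectIntegral_eq_zero {f : ℂ → ℂ} {a b c d : ℝ} (hab : a ≤ b) (hcd : c ≤ d)
    (hf : ∀ z ∈ Icc a b ×ℂ Icc c d, DifferentiableAt ℂ f z) :
    rectIntegral f a b c d = 0 := by
  have := integral_boundary_rect_eq_zero_of_differentiableOn f ⟨a, c⟩ ⟨b, d⟩ (by
    intro z hz
    simp only [uIcc_of_le hab, uIcc_of_le hcd] at hz
    exact (hf z hz).differentiableWithinAt)
  simpa [rectIntegral] using this

theorem rectIntegral_sub {f g : ℂ → ℂ} {a b c d : ℝ} (hab : a ≤ b) (hcd : c ≤ d)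
    (hf : ∀ z ∈ (Icc a b ×ℂ Icc c d) \ (Ioo a b ×ℂ Ioo c d), ContinuousAt f z)
    (hg : ∀ z ∈ (Icc a b ×ℂ Icc c d) \ (Ioo a b ×ℂ Ioo c d), ContinuousAt g z) :
    rectIntegral (fun z => f z - g z) a b c d
      = rectIntegral f a b c d - rectIntegral g a b c d := by
  have hor : ∀ h : ℂ → ℂ,
      (∀ z ∈ (Icc a b ×ℂ Icc c d) \ (Ioo a b ×ℂ Ioo c d), ContinuousAt h z) →
      ∀ y : ℝ, y = c ∨ y = d →
        IntervalIntegrable (fun x : ℝ => h (x + y * I)) volume a b := by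
    intro h hh y hy
    refine ContinuousOn.intervalIntegrable fun x hx => ?_
    rw [uIcc_of_le hab] at hx
    refine ContinuousAt.continuousWithinAt ?_
    refine ContinuousAt.comp (f := fun x : ℝ => (x + y * I : ℂ)) (hh _ ?_) (by fun_prop)
    rcases hy with rfl | rfl <;> simp [mem_reProdIm, hx.1, hx.2, hcd]
  have ver : ∀ h : ℂ → ℂ,
      (∀ z ∈ (Icc a b ×ℂ Icc c d) \ (Ioo a b ×ℂ Ioo c d), ContinuousAt h z) →
      ∀ x : ℝ, x = a ∨ x = b →
        IntervalIntegrable (fun y : ℝ => h (x + y * I)) volume c d := by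
    intro h hh x hx
    refine ContinuousOn.intervalIntegrable fun y hy => ?_
    rw [uIcc_of_le hcd] at hy
    refine ContinuousAt.continuousWithinAt ?_
    refine ContinuousAt.comp (f := fun y : ℝ => (x + y * I : ℂ)) (hh _ ?_) (by fun_prop)
    rcases hx with rfl | rfl <;> simp [mem_reProdIm, hy.1, hy.2, hab]
  unfold rectIntegral
  rw [intervalIntegral.integral_sub (hor f hf c (by simp)) (hor g hg c (by simp)),
    intervalIntegral.integral_sub (hor f hf d (by simp)) (hor g hg d (by simp)),
    intervalIntegral.integral_sub (ver f hf a (by simp)) (ver g hg a (by simp)),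
    intervalIntegral.integral_sub (ver f hf b (by simp)) (ver g hg b (by simp))]
  ring

theorem rectIntegral_congr {f g : ℂ → ℂ} {a b c d : ℝ} (hab : a ≤ b) (hcd : c ≤ d)
    (h : ∀ z ∈ (Icc a b ×ℂ Icc c d) \ (Ioo a b ×ℂ Ioo c d), f z = g z) :
    rectIntegral f a b c d = rectIntegral g a b c d := by
  have hor : ∀ y : ℝ, y = c ∨ y = d →
      (∫ x : ℝ in a..b, f (x + y * I)) = ∫ x : ℝ in a..b, g (x + y * I) := by
    intro y hy
    refine intervalIntegral.integral_congr fun x hx => h _ ?_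
    rw [uIcc_of_le hab] at hx
    rcases hy with rfl | rfl <;> simp [mem_reProdIm, hx.1, hx.2, hcd]
  have ver : ∀ x : ℝ, x = a ∨ x = b →
      (∫ y : ℝ in c..d, f (x + y * I)) = ∫ y : ℝ in c..d, g (x + y * I) := by
    intro x hx
    refine intervalIntegral.integral_congr fun y hy => h _ ?_
    rw [uIcc_of_le hcd] at hy
    rcases hx with rfl | rfl <;> simp [mem_reProdIm, hy.1, hy.2, hab]
  unfold rectIntegral
  rw [hor c (by simp), hor d (by simp), ver a (by simp), ver b (by simp)]

theorem log_sub_log_neg_of_im_pos {w : ℂ} (hw : 0 < w.im) :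
    Complex.log w - Complex.log (-w) = π * I := by
  rw [Complex.log, Complex.log, arg_neg_eq_arg_sub_pi_of_im_pos hw, norm_neg]
  push_cast; ring

theorem rectIntegral_inv_sub {a b c d : ℝ} {s : ℂ} (hs : s ∈ Ioo a b ×ℂ Ioo c d) (r : ℂ) :
    rectIntegral (fun z => r / (z - s)) a b c d = 2 * π * I * r := by
  obtain ⟨⟨h1, h2⟩, h3, h4⟩ := hs
  have hor : ∀ y : ℝ, y ≠ s.im → (∫ x : ℝ in a..b, r / ((x + y * I : ℂ) - s)) =
      r * Complex.log (b + y * I - s) - r * Complex.log (a + y * I - s) := by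
    intro y hy
    have hsl : ∀ x : ℝ, (x + y * I - s : ℂ) ∈ slitPlane := fun x =>
      Or.inr (by simpa using sub_ne_zero.2 hy)
    refine intervalIntegral.integral_eq_sub_of_hasDerivAt
      (f := fun x : ℝ => r * Complex.log (x + y * I - s)) (fun x _ => ?_) ?_
    · have h5 : HasDerivAt (fun x : ℝ => (x + y * I - s : ℂ)) 1 x :=
        ((ofRealCLM.hasDerivAt (x := x)).add_const _).sub_const _
      convert! (h5.clog_real (hsl x)).const_mul r using 1
      ring
    · refine Continuous.intervalIntegrable ?_ _ _
      exact continuous_const.div (by fun_prop) fun x => slitPlane_ne_zero (hsl x)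
  have hright : I * (∫ y : ℝ in c..d, r / ((b + y * I : ℂ) - s)) =
      r * Complex.log (b + d * I - s) - r * Complex.log (b + c * I - s) := by
    have hsl : ∀ y : ℝ, (b + y * I - s : ℂ) ∈ slitPlane := fun y =>
      Or.inl (by simpa using h2)
    rw [← intervalIntegral.integral_const_mul]
    refine intervalIntegral.integral_eq_sub_of_hasDerivAt
      (f := fun y : ℝ => r * Complex.log (b + y * I - s)) (fun y _ => ?_) ?_
    · have h5 : HasDerivAt (fun y : ℝ => (b + y * I - s : ℂ)) (1 * I) y :=
        (((ofRealCLM.hasDerivAt (x := y)).mul_const I).const_add _).sub_const _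
      convert! (h5.clog_real (hsl y)).const_mul r using 1
      ring
    · refine Continuous.intervalIntegrable ?_ _ _
      exact continuous_const.mul
        (continuous_const.div (by fun_prop) fun y => slitPlane_ne_zero (hsl y))
  have hleft : I * (∫ y : ℝ in c..d, r / ((a + y * I : ℂ) - s)) =
      r * Complex.log (-(a + d * I - s)) - r * Complex.log (-(a + c * I - s)) := by
    have hsl : ∀ y : ℝ, (-(a + y * I - s) : ℂ) ∈ slitPlane := fun y =>
      Or.inl (by simpa using h1)
    rw [← intervalIntegral.integral_const_mul]
    refine intervalIntegral.integral_eq_sub_of_hasDerivAt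
      (f := fun y : ℝ => r * Complex.log (-(a + y * I - s))) (fun y _ => ?_) ?_
    · have h5 : HasDerivAt (fun y : ℝ => (-(a + y * I - s) : ℂ)) (-(1 * I)) y :=
        ((((ofRealCLM.hasDerivAt (x := y)).mul_const I).const_add _).sub_const _).neg
      convert! (h5.clog_real (hsl y)).const_mul r using 1
      rw [neg_div_neg_eq]
      ring
    · refine Continuous.intervalIntegrable ?_ _ _
      refine continuous_const.mul (continuous_const.div (by fun_prop) fun y => ?_)
      have := slitPlane_ne_zero (hsl y)
      simpa using neg_ne_zero.1 this
  have htop := log_sub_log_neg_of_im_pos (w := a + d * I - s) (by simpa using h4)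
  have hbot := log_sub_log_neg_of_im_pos (w := -(a + c * I - s)) (by simpa using h3)
  rw [neg_neg] at hbot
  unfold rectIntegral
  rw [hor c h3.ne, hor d h4.ne', hright, hleft]
  linear_combination r * htop + r * hbot

/-- Riemann's removable singularity theorem, phrased with a vanishing residue. -/
theorem differentiableAt_update_limUnder {f : ℂ → ℂ} {s : ℂ}
    (hd : ∀ᶠ z in 𝓝[≠] s, DifferentiableAt ℂ f z)
    (h : Tendsto (fun z => (z - s) * f z) (𝓝[≠] s) (𝓝 0)) :
    DifferentiableAt ℂ (Function.update f s (limUnder (𝓝[≠] s) f)) s := by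
  rw [eventually_nhdsWithin_iff] at hd
  refine DifferentiableOn.differentiableAt (s := {z | z ≠ s → DifferentiableAt ℂ f z}) ?_ hd
  refine differentiableOn_update_limUnder_of_isLittleO hd
    (fun z hz => (hz.1 hz.2).differentiableWithinAt) ?_
  have h0 : Tendsto (fun z : ℂ => (z - s) * f s) (𝓝[≠] s) (𝓝 0) := by
    have : Tendsto (fun z : ℂ => (z - s) * f s) (𝓝 s) (𝓝 ((s - s) * f s)) :=
      Continuous.tendsto (by fun_prop) s
    simpa using this.mono_left nhdsWithin_le_nhds
  rw [Asymptotics.isLittleO_iff_tendsto']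
  · have := h.sub h0
    rw [sub_zero] at this
    refine this.congr fun z => ?_
    rw [div_inv_eq_mul]; ring
  · filter_upwards [self_mem_nhdsWithin] with z hz h
    exact absurd (inv_eq_zero.1 h) (sub_ne_zero.2 hz)

/-- The residue theorem on a rectangle for a function with at most simple poles. -/
theorem rectIntegral_eq_sum_residues {a b c d : ℝ} (hab : a ≤ b) (hcd : c ≤ d) (r : ℂ → ℂ)
    (S : Finset ℂ) (hS : ∀ s ∈ S, s ∈ Ioo a b ×ℂ Ioo c d) (f : ℂ → ℂ)
    (hf : ∀ z ∈ Icc a b ×ℂ Icc c d, z ∉ S → DifferentiableAt ℂ f z)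
    (hr : ∀ s ∈ S, Tendsto (fun z => (z - s) * f z) (𝓝[≠] s) (𝓝 (r s))) :
    rectIntegral f a b c d = 2 * π * I * ∑ s ∈ S, r s := by
  classical
  induction S using Finset.induction_on generalizing f with
  | empty => simpa using rectIntegral_eq_zero hab hcd fun z hz => hf z hz (by simp)
  | insert s T hsT ih =>
    have hs := hS s (by simp)
    set g : ℂ → ℂ := fun z => f z - r s / (z - s) with hg
    set h : ℂ → ℂ := Function.update g s (limUnder (𝓝[≠] s) g) with hh
    have hgd : ∀ z ∈ Icc a b ×ℂ Icc c d, z ∉ insert s T → DifferentiableAt ℂ g z := by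
      intro z hz hzS
      have hzs : z - s ≠ 0 := sub_ne_zero.2 fun h => hzS (by simp [h])
      exact (hf z hz hzS).sub (by fun_prop (disch := assumption))
    have heq : ∀ z, z ≠ s → h =ᶠ[𝓝 z] g := fun z hz => by
      filter_upwards [isOpen_ne.mem_nhds hz] with w hw
      exact Function.update_of_ne hw _ _
    have hopen : IsOpen (Ioo a b ×ℂ Ioo c d) := isOpen_Ioo.reProdIm isOpen_Ioo
    have hsub : Ioo a b ×ℂ Ioo c d ⊆ Icc a b ×ℂ Icc c d := fun z hz =>
      ⟨Ioo_subset_Icc_self hz.1, Ioo_subset_Icc_self hz.2⟩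
    have hhd : ∀ z ∈ Icc a b ×ℂ Icc c d, z ∉ T → DifferentiableAt ℂ h z := by
      intro z hz hzT
      by_cases hzs : z = s
      · subst hzs
        refine differentiableAt_update_limUnder ?_ ?_
        · have h1 : ∀ᶠ w in 𝓝[≠] z, w ∈ Ioo a b ×ℂ Ioo c d :=
            nhdsWithin_le_nhds (hopen.mem_nhds hs)
          have h2 : ∀ᶠ w in 𝓝[≠] z, w ∉ T :=
            nhdsWithin_le_nhds (T.finite_toSet.isClosed.isOpen_compl.mem_nhds hzT)
          filter_upwards [h1, h2, self_mem_nhdsWithin] with w hw1 hw2 hw3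
          exact hgd w (hsub hw1) (by simpa [hw2] using hw3)
        · have := (hr z (by simp)).sub (tendsto_const_nhds (x := r z))
          rw [sub_self] at this
          refine this.congr' ?_
          filter_upwards [self_mem_nhdsWithin] with w hw
          have : w - z ≠ 0 := sub_ne_zero.2 hw
          simp only [hg]
          field_simp
      · exact (hgd z hz (by simp [hzs, hzT])).congr_of_eventuallyEq (heq z hzs)
    have hhr : ∀ t ∈ T, Tendsto (fun z => (z - t) * h z) (𝓝[≠] t) (𝓝 (r t)) := by
      intro t ht
      have hts : t ≠ s := fun h => hsT (h ▸ ht)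
      have hts' : t - s ≠ 0 := sub_ne_zero.2 hts
      have h1 : Tendsto (fun z => (z - t) * (r s / (z - s))) (𝓝[≠] t) (𝓝 0) := by
        have : ContinuousAt (fun z => (z - t) * (r s / (z - s))) t := by
          fun_prop (disch := assumption)
        simpa [ContinuousAt] using this.tendsto.mono_left nhdsWithin_le_nhds
      have := (hr t (by simp [ht])).sub h1
      rw [sub_zero] at this
      refine this.congr' ?_
      filter_upwards [nhdsWithin_le_nhds (heq t hts)] with w hw
      rw [hw, hg]; ring
    have hmain := ih (fun t ht => hS t (by simp [ht])) h hhd hhr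
    have hb : ∀ z ∈ (Icc a b ×ℂ Icc c d) \ (Ioo a b ×ℂ Ioo c d), z ∉ insert s T :=
      fun z hz hzS => hz.2 (hS z hzS)
    rw [rectIntegral_congr (g := g) hab hcd fun z hz =>
        Function.update_of_ne (fun h : z = s => hz.2 (h ▸ hs)) _ _,
      rectIntegral_sub hab hcd (fun z hz => (hf z hz.1 (hb z hz)).continuousAt) ?_,
      rectIntegral_inv_sub hs] at hmain
    · rw [Finset.sum_insert hsT]
      linear_combination hmain
    · intro z hz
      have : z - s ≠ 0 := sub_ne_zero.2 fun h => hz.2 (h ▸ hs)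
      fun_prop (disch := assumption)

theorem sin_eq_mk (w : ℂ) : Complex.sin w =
    ⟨Real.sin w.re * Real.cosh w.im, Real.cos w.re * Real.sinh w.im⟩ := by
  rw [Complex.sin_eq, Complex.mk_eq_add_mul_I]; push_cast; rfl

theorem sin_ne_zero_of_im_pos {w : ℂ} (hw : 0 < w.im) : Complex.sin w ≠ 0 := by
  intro h
  obtain ⟨k, hk⟩ := Complex.sin_eq_zero_iff.1 h
  have : w.im = 0 := by rw [hk]; simp
  exact hw.ne' this

theorem sinh_lt_mul_cosh {v : ℝ} (hv : 0 < v) : Real.sinh v < v * Real.cosh v := by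
  have hd : ∀ x : ℝ, HasDerivAt (fun x => x * Real.cosh x - Real.sinh x)
      (1 * Real.cosh x + x * Real.sinh x - Real.cosh x) x := fun x =>
    ((hasDerivAt_id x).mul (Real.hasDerivAt_cosh x)).sub (Real.hasDerivAt_sinh x)
  have hmono : StrictMonoOn (fun x => x * Real.cosh x - Real.sinh x) (Ici 0) := by
    refine strictMonoOn_of_deriv_pos (convex_Ici 0) (by fun_prop) fun x hx => ?_
    rw [interior_Ici] at hx
    rw [(hd x).deriv]
    have := mul_pos hx (Real.sinh_pos_iff.2 hx)
    linarith
  have := hmono (mem_Ici.2 le_rfl) hv.le hv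
  simp at this
  linarith

/-- The logarithmic derivative of `sin w / w` has negative imaginary part on the upper
half-plane. -/
theorem im_cot_sub_inv_neg {w : ℂ} (hw : 0 < w.im) :
    (Complex.cos w / Complex.sin w - 1 / w).im < 0 := by
  set u := w.re
  set v := w.im
  have hS := Real.sinh_pos_iff.2 hw
  have hC := Real.cosh_pos v
  have hsin : Complex.sin w = ⟨Real.sin u * Real.cosh v, Real.cos u * Real.sinh v⟩ :=
    sin_eq_mk w
  have hcos : Complex.cos w = ⟨Real.cos u * Real.cosh v, -(Real.sin u * Real.sinh v)⟩ := by
    rw [Complex.cos_eq, Complex.mk_eq_add_mul_I]; push_cast; ring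
  have hcs := Real.cosh_sq v
  have hsc := Real.sin_sq_add_cos_sq u
  have hden : (Real.sin u * Real.cosh v) * (Real.sin u * Real.cosh v)
      + (Real.cos u * Real.sinh v) * (Real.cos u * Real.sinh v)
      = Real.sin u ^ 2 + Real.sinh v ^ 2 := by
    linear_combination Real.sin u ^ 2 * hcs + Real.sinh v ^ 2 * hsc
  have hdpos : 0 < Real.sin u ^ 2 + Real.sinh v ^ 2 := by positivity
  have hwpos : 0 < u * u + v * v := by nlinarith [mul_self_nonneg u, mul_pos hw hw]
  have him : (Complex.cos w / Complex.sin w - 1 / w).im =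
      v / (u * u + v * v)
        - Real.sinh v * Real.cosh v / (Real.sin u ^ 2 + Real.sinh v ^ 2) := by
    rw [Complex.sub_im, Complex.div_im, Complex.div_im, hsin, hcos]
    have hnw : Complex.normSq w = u * u + v * v := Complex.normSq_apply w
    have hr : w.re = u := rfl
    have hi : w.im = v := rfl
    simp only [Complex.normSq_mk, Complex.one_re, Complex.one_im, hnw, hr, hi]
    rw [hden]
    field_simp
    linear_combination (-(u ^ 2 + v ^ 2) * Real.sinh v * Real.cosh v) * hsc
  rw [him, sub_neg, div_lt_div_iff₀ hwpos hdpos]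
  have h1 : Real.sin u ^ 2 ≤ u ^ 2 := sq_le_sq.2 Real.abs_sin_le_abs
  have h2 : v ≤ Real.sinh v := (Real.self_le_sinh_iff).2 hw.le
  have h3 : 1 ≤ Real.cosh v := Real.one_le_cosh v
  have h4 := sinh_lt_mul_cosh hw
  have h5 : v ≤ Real.sinh v * Real.cosh v := by nlinarith
  have h6 : v * Real.sin u ^ 2 ≤ Real.sinh v * Real.cosh v * u ^ 2 := by
    gcongr
  have h7 : v * Real.sinh v * Real.sinh v < v * Real.sinh v * (v * Real.cosh v) := by
    gcongr
  nlinarith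

/-- A branch of `log (-2i sin w / w)` on the upper half-plane. -/
noncomputable def logSinc (w : ℂ) : ℂ :=
  -I * w + Complex.log (1 - Complex.exp (2 * I * w)) - Complex.log w

theorem one_sub_exp_re_pos {w : ℂ} (hw : 0 < w.im) :
    0 < (1 - Complex.exp (2 * I * w)).re := by
  have h1 : ‖Complex.exp (2 * I * w)‖ < 1 := by
    rw [Complex.norm_exp]
    simpa using hw
  have h2 := Complex.re_le_norm (Complex.exp (2 * I * w))
  rw [Complex.sub_re, Complex.one_re]
  linarith

theorem exp_logSinc {w : ℂ} (hw : 0 < w.im) :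
    Complex.exp (logSinc w) = -2 * I * Complex.sin w / w := by
  have h0 : w ≠ 0 := by rintro rfl; simp at hw
  have h1 : 1 - Complex.exp (2 * I * w) ≠ 0 := fun h => by
    have := one_sub_exp_re_pos hw
    rw [h] at this; simp at this
  rw [logSinc, Complex.exp_sub, Complex.exp_add, Complex.exp_log h1, Complex.exp_log h0,
    Complex.sin, mul_sub, mul_one, ← Complex.exp_add]
  have e1 : -I * w + 2 * I * w = w * I := by ring
  have e2 : -I * w = -w * I := by ring
  rw [e1, e2]
  congr 1
  linear_combination (Complex.exp (-w * I) - Complex.exp (w * I)) * Complex.I_sq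

theorem hasDerivAt_logSinc {w : ℂ} (hw : 0 < w.im) :
    HasDerivAt logSinc (Complex.cos w / Complex.sin w - 1 / w) w := by
  have hs := sin_ne_zero_of_im_pos hw
  have h1 : HasDerivAt (fun w : ℂ => 1 - Complex.exp (2 * I * w))
      (-(Complex.exp (2 * I * w) * (2 * I * 1))) w :=
    (((hasDerivAt_id w).const_mul (2 * I)).cexp).const_sub 1
  have h2 := h1.clog (Or.inl (one_sub_exp_re_pos hw))
  have h3 := Complex.hasDerivAt_log (z := w) (Or.inr hw.ne')
  have h4 := (((hasDerivAt_id w).const_mul (-I)).add h2).sub h3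
  refine h4.congr_deriv ?_
  have hne : 1 - Complex.exp (2 * I * w) ≠ 0 := fun h => by
    have := one_sub_exp_re_pos hw
    rw [h] at this; simp at this
  rw [one_div]
  congr 1
  rw [eq_div_iff hs, add_mul, div_mul_eq_mul_div, ← eq_sub_iff_add_eq', div_eq_iff hne,
    Complex.sin, Complex.cos]
  have e1 : Complex.exp (2 * I * w) = Complex.exp (w * I) * Complex.exp (w * I) := by
    rw [← Complex.exp_add]; ring_nf
  have e2 : Complex.exp (w * I) * Complex.exp (-w * I) = 1 := by
    rw [← Complex.exp_add]; simp
  rw [e1]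
  set p := Complex.exp (w * I)
  set q := Complex.exp (-w * I)
  ring_nf
  simp only [Complex.I_sq]
  linear_combination p * e2

theorem logSinc_injOn : InjOn logSinc {w | 0 < w.im} := by
  intro w₁ h₁ w₂ h₂ heq
  by_contra hne
  have hδ : w₂ - w₁ ≠ 0 := sub_ne_zero.2 (Ne.symm hne)
  set γ : ℝ → ℂ := fun t => w₁ + t * (w₂ - w₁) with hγ
  have him : ∀ t ∈ Icc (0 : ℝ) 1, 0 < (γ t).im := by
    intro t ht
    have : (γ t).im = (1 - t) * w₁.im + t * w₂.im := by simp [hγ]; ring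
    rw [this]
    rcases eq_or_lt_of_le ht.1 with h | h
    · rw [← h]; simpa using h₁
    · exact add_pos_of_nonneg_of_pos (mul_nonneg (by linarith [ht.2]) (le_of_lt h₁))
        (mul_pos h h₂)
  have hd : ∀ t ∈ Icc (0 : ℝ) 1, HasDerivAt (fun t => (logSinc (γ t) / (w₂ - w₁)).im)
      ((Complex.cos (γ t) / Complex.sin (γ t) - 1 / γ t).im) t := by
    intro t ht
    have h1 : HasDerivAt γ (1 * (w₂ - w₁)) t :=
      ((ofRealCLM.hasDerivAt (x := t)).mul_const _).const_add _
    have h2 := ((hasDerivAt_logSinc (him t ht)).comp_of_eq t h1 rfl).div_const (w₂ - w₁)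
    rw [one_mul, mul_div_cancel_right₀ _ hδ] at h2
    exact (imCLM.hasFDerivAt.comp_hasDerivAt t h2)
  have hanti : StrictAntiOn (fun t => (logSinc (γ t) / (w₂ - w₁)).im) (Icc 0 1) := by
    refine strictAntiOn_of_deriv_neg (convex_Icc 0 1)
      (fun t ht => (hd t ht).continuousAt.continuousWithinAt) fun t ht => ?_
    have ht' := interior_subset ht
    rw [(hd t ht').deriv]
    exact im_cot_sub_inv_neg (him t ht')
  have := hanti (left_mem_Icc.2 zero_le_one) (right_mem_Icc.2 zero_le_one) zero_lt_one
  simp [hγ, heq] at this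

/-- The function `sin w / w` is injective on half-strips of width `π / 2` in the first quadrant. -/
theorem eq_of_sin_mul_eq {w₁ w₂ : ℂ} (hr₁ : 0 < w₁.re) (hi₁ : 0 < w₁.im) (hr₂ : 0 < w₂.re)
    (hi₂ : 0 < w₂.im) (hre : |w₁.re - w₂.re| ≤ π / 2)
    (h : Complex.sin w₁ * w₂ = Complex.sin w₂ * w₁) : w₁ = w₂ := by
  have h10 : w₁ ≠ 0 := by rintro rfl; simp at hi₁
  have h20 : w₂ ≠ 0 := by rintro rfl; simp at hi₂
  refine logSinc_injOn hi₁ hi₂ ?_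
  have hexp : Complex.exp (logSinc w₁) = Complex.exp (logSinc w₂) := by
    rw [exp_logSinc hi₁, exp_logSinc hi₂, div_eq_div_iff h10 h20]
    linear_combination -2 * I * h
  obtain ⟨n, hn⟩ := Complex.exp_eq_exp_iff_exists_int.1 hexp
  have him : ∀ w : ℂ, (logSinc w).im =
      -w.re + (1 - Complex.exp (2 * I * w)).arg - w.arg := by
    intro w; simp [logSinc, Complex.log_im]
  have hn' : (logSinc w₁).im - (logSinc w₂).im = n * (2 * π) := by
    rw [hn]; simp
  have a1 := abs_lt.1 (abs_arg_lt_pi_div_two_iff.2 (Or.inl (one_sub_exp_re_pos hi₁)))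
  have a2 := abs_lt.1 (abs_arg_lt_pi_div_two_iff.2 (Or.inl (one_sub_exp_re_pos hi₂)))
  have b1 := abs_lt.1 (abs_arg_lt_pi_div_two_iff.2 (Or.inl hr₁))
  have b2 := abs_lt.1 (abs_arg_lt_pi_div_two_iff.2 (Or.inl hr₂))
  have c1 := arg_nonneg_iff.2 hi₁.le
  have c2 := arg_nonneg_iff.2 hi₂.le
  have hre' := abs_le.1 hre
  rw [him, him] at hn'
  have hπ := Real.pi_pos
  have hn0 : n = 0 := by
    have u1 : (n : ℝ) < 1 := by nlinarith
    have u2 : (-1 : ℝ) < n := by nlinarith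
    have u1' : n < 1 := by exact_mod_cast u1
    have u2' : -1 < n := by exact_mod_cast u2
    omega
  rw [hn, hn0]; simp

theorem helixE_eq (ρ : ℝ) (z : ℂ) :
    helixE ρ z = (ρ : ℂ) ^ 2 * z ^ 2 + 2 - 2 * Complex.cos z := by
  have h1 : Complex.cos z = 2 * Complex.cos (z / 2) ^ 2 - 1 := by
    rw [← Complex.cos_two_mul]; congr 1; ring
  have h2 := Complex.sin_sq_add_cos_sq (z / 2)
  rw [helixE, h1]
  linear_combination 4 * h2

theorem helixE_eq_mk (ρ : ℝ) (z : ℂ) :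
    helixE ρ z = ⟨ρ ^ 2 * (z.re ^ 2 - z.im ^ 2) + 2 - 2 * (Real.cos z.re * Real.cosh z.im),
      2 * ρ ^ 2 * z.re * z.im + 2 * (Real.sin z.re * Real.sinh z.im)⟩ := by
  rw [helixE_eq, Complex.cos_eq, Complex.mk_eq_add_mul_I]
  conv_lhs => rw [← Complex.re_add_im z]
  simp only [Complex.add_re, Complex.ofReal_re, Complex.mul_re, Complex.I_re, Complex.ofReal_im,
    Complex.add_im, Complex.mul_im, Complex.I_im]
  push_cast
  ring_nf
  simp only [Complex.I_sq]
  ring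

theorem helixE_neg_conj (ρ : ℝ) (z : ℂ) :
    helixE ρ (-(starRingEnd ℂ) z) = (starRingEnd ℂ) (helixE ρ z) := by
  have h2 : (starRingEnd ℂ) 2 = 2 := map_ofNat _ 2
  simp [helixE_eq, Complex.cos_conj, h2]

theorem helixE'_neg_conj (ρ : ℝ) (z : ℂ) :
    helixE' ρ (-(starRingEnd ℂ) z) = -(starRingEnd ℂ) (helixE' ρ z) := by
  have h2 : (starRingEnd ℂ) 2 = 2 := map_ofNat _ 2
  simp [helixE', Complex.sin_conj, h2]
  ring

theorem hasDerivAt_helixE (ρ : ℝ) (z : ℂ) : HasDerivAt (helixE ρ) (helixE' ρ z) z := by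
  have h : HasDerivAt (fun z : ℂ => (ρ : ℂ) ^ 2 * z ^ 2 + 2 - 2 * Complex.cos z)
      ((ρ : ℂ) ^ 2 * (2 * z ^ (2 - 1)) - 2 * (-Complex.sin z)) z := by
    have h1 := hasDerivAt_pow 2 z
    exact ((h1.const_mul ((ρ : ℂ) ^ 2)).add_const 2).sub
      ((Complex.hasDerivAt_cos z).const_mul 2)
  rw [show helixE ρ = fun z : ℂ => (ρ : ℂ) ^ 2 * z ^ 2 + 2 - 2 * Complex.cos z from
    funext (helixE_eq ρ)]
  refine h.congr_deriv ?_
  rw [helixE']; norm_num; ring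

theorem sin_re_neg_of_helixE_eq_zero {ρ : ℝ} (hρ : 0 < ρ) {z : ℂ} (hz : helixE ρ z = 0)
    (hr : 0 < z.re) (hi : 0 < z.im) : Real.sin z.re < 0 := by
  have h := congrArg Complex.im hz
  rw [helixE_eq_mk] at h
  simp only [Complex.zero_im] at h
  have hS := Real.sinh_pos_iff.2 hi
  have : 0 < ρ ^ 2 * z.re * z.im := by positivity
  by_contra! hc
  nlinarith [mul_nonneg hc hS.le]

theorem helixE_ne_zero_of_re_eq_zero {ρ : ℝ} (hρ : 0 < ρ) {z : ℂ} (hr : z.re = 0)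
    (hi : z.im ≠ 0) : helixE ρ z ≠ 0 := by
  intro hz
  have h := congrArg Complex.re hz
  rw [helixE_eq_mk, hr] at h
  simp at h
  have : 0 < ρ ^ 2 * z.im ^ 2 := by positivity
  linarith [Real.one_le_cosh z.im]

theorem helixE_ne_zero_of_im_eq_zero {ρ : ℝ} (hρ : 0 < ρ) {z : ℂ} (hi : z.im = 0)
    (hr : z.re ≠ 0) : helixE ρ z ≠ 0 := by
  intro hz
  have h := congrArg Complex.re hz
  rw [helixE_eq_mk, hi] at h
  simp at h
  have : 0 < ρ ^ 2 * z.re ^ 2 := by positivity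
  linarith [Real.cos_le_one z.re]

theorem sin_half_sq_of_helixE_eq_zero {ρ : ℝ} {z : ℂ} (hz : helixE ρ z = 0) :
    Complex.sin (z / 2) ^ 2 = -((ρ : ℂ) ^ 2 * (z / 2) ^ 2) := by
  rw [helixE] at hz
  linear_combination hz / 4

theorem helixE'_ne_zero {ρ : ℝ} {z : ℂ} (hz : helixE ρ z = 0) (hi : 0 < z.im) :
    helixE' ρ z ≠ 0 := by
  have hw : 0 < (z / 2).im := by simpa using hi
  have h := sin_half_sq_of_helixE_eq_zero hz
  have hs := sin_ne_zero_of_im_pos hw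
  have hneg := im_cot_sub_inv_neg hw
  have hz2 : z = 2 * (z / 2) := by ring
  generalize z / 2 = w at *
  have hw0 : w ≠ 0 := by rintro rfl; simp at hw
  have hne : Complex.cos w / Complex.sin w - 1 / w ≠ 0 := fun h0 => by
    rw [h0] at hneg; simp at hneg
  have key : helixE' ρ z * w =
      4 * w * Complex.sin w ^ 2 * (Complex.cos w / Complex.sin w - 1 / w) := by
    rw [helixE', hz2, Complex.sin_two_mul]
    field_simp
    linear_combination 4 * h
  intro h0
  rw [h0, zero_mul] at key
  have : 4 * w * Complex.sin w ^ 2 * (Complex.cos w / Complex.sin w - 1 / w) ≠ 0 := by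
    simp only [ne_eq, mul_eq_zero, not_or]
    exact ⟨⟨⟨by norm_num, hw0⟩, pow_ne_zero _ hs⟩, hne⟩
  exact this key.symm

/-- Each half-strip `[(2k-1)π, 2kπ] × ℝ⁺` contains at most one root of `E_ρ`. -/
theorem helixE_root_unique {ρ : ℝ} (hρ : 0 < ρ) {k : ℕ} (hk : 1 ≤ k) {z₁ z₂ : ℂ}
    (h₁ : helixE ρ z₁ = 0) (hr₁ : z₁.re ∈ Icc ((2 * (k : ℝ) - 1) * π) (2 * (k : ℝ) * π))
    (hi₁ : 0 < z₁.im)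
    (h₂ : helixE ρ z₂ = 0) (hr₂ : z₂.re ∈ Icc ((2 * (k : ℝ) - 1) * π) (2 * (k : ℝ) * π))
    (hi₂ : 0 < z₂.im) : z₁ = z₂ := by
  have hπ := Real.pi_pos
  have hk' : (1 : ℝ) ≤ k := by exact_mod_cast hk
  suffices h : z₁ / 2 = z₂ / 2 by linear_combination 2 * h
  have split : ∀ z : ℂ, helixE ρ z = 0 →
      Complex.sin (z / 2) = I * ρ * (z / 2) ∨ Complex.sin (z / 2) = -(I * ρ * (z / 2)) := by
    intro z hz
    rw [← sq_eq_sq_iff_eq_or_eq_neg, sin_half_sq_of_helixE_eq_zero hz]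
    linear_combination (-(ρ : ℂ) ^ 2 * (z / 2) ^ 2) * Complex.I_sq
  have sgn : ∀ (z : ℂ) (e : ℝ), 0 < z.im → Complex.sin (z / 2) = e * (I * ρ * (z / 2)) →
      Real.sin (z.re / 2) * Real.cosh (z.im / 2) = -e * (ρ * (z.im / 2)) := by
    intro z e hi h
    have h' := congrArg Complex.re h
    rw [sin_eq_mk] at h'
    simp at h'
    rw [h']
    ring
  have hprod : 0 ≤ Real.sin (z₁.re / 2) * Real.sin (z₂.re / 2) := by
    have s1 := Real.sin_nonpos_of_nonpos_of_neg_pi_le (x := z₁.re / 2 - k * π)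
      (by linarith [hr₁.2]) (by nlinarith [hr₁.1])
    have s2 := Real.sin_nonpos_of_nonpos_of_neg_pi_le (x := z₂.re / 2 - k * π)
      (by linarith [hr₂.2]) (by nlinarith [hr₂.1])
    rw [Real.sin_sub_nat_mul_pi] at s1 s2
    have h := mul_nonneg_of_nonpos_of_nonpos s1 s2
    have h1 : ((-1 : ℝ) ^ k) * (-1) ^ k = 1 := by rw [← mul_pow]; simp
    calc (0 : ℝ) ≤ _ := h
      _ = ((-1 : ℝ) ^ k * (-1) ^ k) * (Real.sin (z₁.re / 2) * Real.sin (z₂.re / 2)) := by ring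
      _ = _ := by rw [h1, one_mul]
  have hopp : ∀ e : ℝ, e * e = 1 → Complex.sin (z₁ / 2) = e * (I * ρ * (z₁ / 2)) →
      ¬ Complex.sin (z₂ / 2) = (-e : ℝ) * (I * ρ * (z₂ / 2)) := by
    intro e he q1 q2
    have p1 := sgn z₁ e hi₁ q1
    have p2 := sgn z₂ (-e) hi₂ q2
    have hpos : 0 < (ρ * (z₁.im / 2)) * (ρ * (z₂.im / 2)) := by positivity
    have hc : 0 < Real.cosh (z₁.im / 2) * Real.cosh (z₂.im / 2) :=
      mul_pos (Real.cosh_pos _) (Real.cosh_pos _)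
    have : (Real.sin (z₁.re / 2) * Real.sin (z₂.re / 2)) *
        (Real.cosh (z₁.im / 2) * Real.cosh (z₂.im / 2)) =
        -((ρ * (z₁.im / 2)) * (ρ * (z₂.im / 2))) := by
      calc _ = (Real.sin (z₁.re / 2) * Real.cosh (z₁.im / 2)) *
            (Real.sin (z₂.re / 2) * Real.cosh (z₂.im / 2)) := by ring
        _ = -(e * e) * ((ρ * (z₁.im / 2)) * (ρ * (z₂.im / 2))) := by rw [p1, p2]; ring
        _ = _ := by rw [he]; ring
    linarith [mul_nonneg hprod hc.le]
  have hx₁ : 0 < z₁.re := lt_of_lt_of_le (by nlinarith) hr₁.1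
  have hx₂ : 0 < z₂.re := lt_of_lt_of_le (by nlinarith) hr₂.1
  refine eq_of_sin_mul_eq (by simpa using hx₁) (by simpa using hi₁) (by simpa using hx₂)
    (by simpa using hi₂) ?_ ?_
  · have e : ∀ z : ℂ, (z / 2).re = z.re / 2 := fun z => by simp
    rw [e, e, abs_le]
    constructor <;> linarith [hr₁.1, hr₁.2, hr₂.1, hr₂.2]
  · rcases split z₁ h₁ with q1 | q1 <;> rcases split z₂ h₂ with q2 | q2
    · rw [q1, q2]; ring
    · exact absurd (by rw [q2]; push_cast; ring)
        (hopp 1 (by norm_num) (by rw [q1]; push_cast; ring))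
    · exact absurd (by rw [q2]; push_cast; ring)
        (hopp (-1) (by norm_num) (by rw [q1]; push_cast; ring))
    · rw [q1, q2]; ring

theorem sq_norm_le_norm_helixE' {ρ : ℝ} {z : ℂ} (hz : helixE ρ z = 0)
    (h6 : 6 ≤ ‖z‖) (h8 : 8 ≤ ρ ^ 2 * ‖z‖ ^ 2) : ρ ^ 2 * ‖z‖ ^ 2 / 3 ≤ ‖helixE' ρ z‖ := by
  have h := sin_half_sq_of_helixE_eq_zero hz
  have hsq : Complex.sin z ^ 2 = -((ρ : ℂ) ^ 2 * z ^ 2) * (1 + (ρ : ℂ) ^ 2 * z ^ 2 / 4) := by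
    have h1 : Complex.sin z = 2 * Complex.sin (z / 2) * Complex.cos (z / 2) := by
      rw [← Complex.sin_two_mul]; congr 1; ring
    rw [h1, mul_pow, mul_pow, Complex.cos_sq', h]
    ring
  have hn : ‖Complex.sin z‖ ^ 2 = ρ ^ 2 * ‖z‖ ^ 2 * ‖1 + (ρ : ℂ) ^ 2 * z ^ 2 / 4‖ := by
    rw [← norm_pow, hsq, norm_mul, norm_neg]; simp
  have hge : ρ ^ 2 * ‖z‖ ^ 2 / 4 - 1 ≤ ‖1 + (ρ : ℂ) ^ 2 * z ^ 2 / 4‖ := by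
    have := norm_sub_norm_le ((ρ : ℂ) ^ 2 * z ^ 2 / 4) (-1)
    rw [sub_neg_eq_add, add_comm _ (1 : ℂ)] at this
    simpa using this
  set A := ρ ^ 2 * ‖z‖ ^ 2 with hA
  have hs : A / 3 ≤ ‖Complex.sin z‖ := by
    refine abs_le_of_sq_le_sq' ?_ (norm_nonneg _) |>.2
    rw [hn]
    nlinarith
  have htri : 2 * ‖Complex.sin z‖ - 2 * ρ ^ 2 * ‖z‖ ≤ ‖helixE' ρ z‖ := by
    have := norm_sub_norm_le (2 * Complex.sin z) (-(2 * (ρ : ℂ) ^ 2 * z))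
    rw [sub_neg_eq_add, add_comm] at this
    rw [helixE']
    simpa using this
  have : 6 * (ρ ^ 2 * ‖z‖) ≤ A := by
    rw [hA]; nlinarith [mul_nonneg (sq_nonneg ρ) (norm_nonneg z)]
  linarith

theorem norm_helixE_ge_of_cos_re {ρ : ℝ} {z : ℂ} (hc : Real.cos z.re = -1) :
    3 / 4 * (ρ ^ 2 * z.re ^ 2) ≤ ‖helixE ρ z‖ := by
  have hs : Real.sin z.re = 0 := by
    nlinarith [Real.sin_sq_add_cos_sq z.re, sq_nonneg (Real.sin z.re)]
  have hre := Complex.abs_re_le_norm (helixE ρ z)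
  have him := Complex.abs_im_le_norm (helixE ρ z)
  rw [helixE_eq_mk] at hre him ⊢
  simp only [hc, hs] at hre him ⊢
  have hC := Real.cosh_pos z.im
  rcases le_total (|z.im|) (|z.re| / 2) with h | h
  · refine le_trans ?_ ((le_abs_self _).trans hre)
    have h2 : z.im ^ 2 ≤ z.re ^ 2 / 4 := by
      rw [← sq_abs z.im, ← sq_abs z.re]; nlinarith [abs_nonneg z.im]
    nlinarith [mul_le_mul_of_nonneg_left h2 (sq_nonneg ρ)]
  · refine le_trans ?_ him
    rw [show 2 * ρ ^ 2 * z.re * z.im + 2 * (0 * Real.sinh z.im) = 2 * ρ ^ 2 * (z.re * z.im) by ring,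
      abs_mul, abs_of_nonneg (by positivity : 0 ≤ 2 * ρ ^ 2), abs_mul, ← sq_abs z.re]
    have h2 : |z.re| ^ 2 / 2 ≤ |z.re| * |z.im| := by nlinarith [abs_nonneg z.re]
    nlinarith [mul_le_mul_of_nonneg_left h2 (sq_nonneg ρ),
      mul_nonneg (sq_nonneg ρ) (sq_nonneg |z.re|)]

theorem norm_helixE_ge_of_im {ρ : ℝ} (hρ : 0 < ρ) {z : ℂ} (hi : 16 * ρ ≤ z.im)
    (hr : |z.re| ≤ z.im) : 2 * (ρ ^ 2 * z.im ^ 2) ≤ ‖helixE ρ z‖ := by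
  have hy : 0 < z.im := by linarith
  have hsinh : z.im ^ 2 / 16 ≤ Real.sinh (z.im / 2) := by
    rw [Real.sinh_eq]
    have h1 := Real.quadratic_le_exp_of_nonneg (x := z.im / 2) (by linarith)
    have h2 : Real.exp (-(z.im / 2)) ≤ 1 := Real.exp_le_one_iff.2 (by linarith)
    nlinarith
  have hsinh2 : ρ * z.im ≤ Real.sinh (z.im / 2) := by nlinarith
  have hsin : Real.sinh (z.im / 2) ^ 2 ≤ ‖Complex.sin (z / 2)‖ ^ 2 := by
    have e1 : (z / 2).re = z.re / 2 := by simp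
    have e2 : (z / 2).im = z.im / 2 := by simp
    rw [← Complex.normSq_eq_norm_sq, sin_eq_mk, Complex.normSq_mk, e1, e2]
    nlinarith [Real.sin_sq_add_cos_sq (z.re / 2), Real.cosh_sq (z.im / 2),
      sq_nonneg (Real.sin (z.re / 2))]
  have hnz : ‖z‖ ^ 2 ≤ 2 * z.im ^ 2 := by
    rw [← Complex.normSq_eq_norm_sq, Complex.normSq_apply]
    nlinarith [sq_abs z.re, abs_nonneg z.re]
  have htri : 4 * ‖Complex.sin (z / 2)‖ ^ 2 - ρ ^ 2 * ‖z‖ ^ 2 ≤ ‖helixE ρ z‖ := by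
    have := norm_sub_norm_le (4 * Complex.sin (z / 2) ^ 2) (-((ρ : ℂ) ^ 2 * z ^ 2))
    rw [sub_neg_eq_add, add_comm] at this
    rw [helixE]
    simpa using this
  have h3 : (ρ * z.im) ^ 2 ≤ Real.sinh (z.im / 2) ^ 2 := by
    have : 0 ≤ ρ * z.im := by positivity
    gcongr
  nlinarith [mul_le_mul_of_nonneg_left hnz (sq_nonneg ρ)]

/-- The entire function `E_ρ(z) / z²`. -/
noncomputable def helixK (ρ : ℝ) (z : ℂ) : ℂ :=
  (ρ : ℂ) ^ 2 + dslope Complex.sin 0 (z / 2) ^ 2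

theorem helixE_eq_sq_mul_helixK (ρ : ℝ) (z : ℂ) : helixE ρ z = z ^ 2 * helixK ρ z := by
  have h := sub_smul_dslope Complex.sin 0 (z / 2)
  simp only [sub_zero, Complex.sin_zero, smul_eq_mul] at h
  rw [helixE, helixK, ← h]
  ring

theorem differentiable_helixK (ρ : ℝ) : Differentiable ℂ (helixK ρ) := by
  have h : Differentiable ℂ (dslope Complex.sin 0) := by
    rw [← differentiableOn_univ, differentiableOn_dslope univ_mem, differentiableOn_univ]
    exact Complex.differentiable_sin
  unfold helixK
  fun_prop

theorem helixK_zero (ρ : ℝ) : helixK ρ 0 = (ρ : ℂ) ^ 2 + 1 := by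
  simp [helixK]

theorem helixK_neg (ρ : ℝ) (z : ℂ) : helixK ρ (-z) = helixK ρ z := by
  rcases eq_or_ne z 0 with rfl | hz
  · simp
  · have h1 := helixE_eq_sq_mul_helixK ρ z
    have h2 := helixE_eq_sq_mul_helixK ρ (-z)
    rw [helixE_eq, Complex.cos_neg, neg_sq, ← helixE_eq, h1] at h2
    exact (mul_left_cancel₀ (pow_ne_zero 2 hz) h2).symm

/-- The analytic continuation of `M_ρ`, with the singularity at the origin removed. -/
noncomputable def helixF (ρ : ℝ) : ℂ → ℂ :=
  dslope (dslope (fun z => ((ρ : ℂ) ^ 2 + 1) / helixK ρ z - 1) 0) 0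

theorem ofReal_sq_add_one_ne_zero (ρ : ℝ) : (ρ : ℂ) ^ 2 + 1 ≠ 0 := by
  have : (ρ ^ 2 + 1 : ℝ) ≠ 0 := by positivity
  exact_mod_cast this

theorem helixF_of_ne_zero (ρ : ℝ) {z : ℂ} (hz : z ≠ 0) :
    helixF ρ z = ((ρ : ℂ) ^ 2 + 1) / helixE ρ z - 1 / z ^ 2 := by
  set φ : ℂ → ℂ := fun z => ((ρ : ℂ) ^ 2 + 1) / helixK ρ z - 1 with hφ
  have hd : deriv φ 0 = 0 := by
    have h1 := deriv_comp_neg φ 0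
    have h2 : (fun x => φ (-x)) = φ := by
      funext x; simp [hφ, helixK_neg]
    rw [h2, neg_zero] at h1
    linear_combination h1 / 2
  rw [helixF, dslope_of_ne _ hz, slope_def_field, dslope_same, hd, dslope_of_ne _ hz,
    slope_def_field, helixK_zero, div_self (ofReal_sq_add_one_ne_zero ρ), helixE_eq_sq_mul_helixK]
  simp only [sub_zero, sub_self]
  rcases eq_or_ne (helixK ρ z) 0 with hK | hK
  · rw [hK]; field_simp
  · field_simp

theorem differentiableAt_helixF {ρ : ℝ} {z : ℂ} (hz : helixE ρ z ≠ 0 ∨ z = 0) :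
    DifferentiableAt ℂ (helixF ρ) z := by
  have hopen : IsOpen {z | helixK ρ z ≠ 0} :=
    isOpen_ne.preimage (differentiable_helixK ρ).continuous
  have h0 : {z | helixK ρ z ≠ 0} ∈ 𝓝 (0 : ℂ) := hopen.mem_nhds (by
    simpa [helixK_zero] using ofReal_sq_add_one_ne_zero ρ)
  have hz' : {z | helixK ρ z ≠ 0} ∈ 𝓝 z := by
    rcases hz with hz | rfl
    · refine hopen.mem_nhds fun h => hz ?_
      rw [helixE_eq_sq_mul_helixK, h, mul_zero]
    · exact h0
  refine DifferentiableOn.differentiableAt ?_ hz'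
  rw [helixF, differentiableOn_dslope h0, differentiableOn_dslope h0]
  intro w hw
  exact (((differentiableAt_const _).div (differentiable_helixK ρ w) hw).sub_const
    1).differentiableWithinAt

theorem helixF_ofReal (ρ : ℝ) {t : ℝ} (ht : t ≠ 0) : helixF ρ t = helixM ρ t := by
  rw [helixF_of_ne_zero ρ (by exact_mod_cast ht), helixM, helixE]
  push_cast
  rfl

theorem tendsto_sub_mul_helixF {ρ : ℝ} {s : ℂ} (hs0 : s ≠ 0) (hs : helixE ρ s = 0)
    (hs' : helixE' ρ s ≠ 0) :
    Tendsto (fun z => (z - s) * helixF ρ z) (𝓝[≠] s)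
      (𝓝 (((ρ : ℂ) ^ 2 + 1) / helixE' ρ s)) := by
  have h1 := (((hasDerivAt_iff_tendsto_slope.1 (hasDerivAt_helixE ρ s)).inv₀ hs').const_mul
    ((ρ : ℂ) ^ 2 + 1))
  have h2 : Tendsto (fun z : ℂ => (z - s) * (1 / z ^ 2)) (𝓝[≠] s) (𝓝 0) := by
    have hs2 : s ^ 2 ≠ 0 := pow_ne_zero 2 hs0
    have : ContinuousAt (fun z : ℂ => (z - s) * (1 / z ^ 2)) s := by
      fun_prop (disch := assumption)
    simpa [ContinuousAt] using this.tendsto.mono_left nhdsWithin_le_nhds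
  have h3 := h1.sub h2
  rw [sub_zero, ← div_eq_mul_inv] at h3
  refine h3.congr' ?_
  filter_upwards [nhdsWithin_le_nhds (isOpen_ne.mem_nhds hs0)] with z hz
  rw [helixF_of_ne_zero ρ hz, slope_def_field, hs, sub_zero, inv_div]
  ring

theorem norm_helixF_le {ρ : ℝ} (hρ : 0 < ρ) {z : ℂ} {X : ℝ} (hX : 0 < X) (hz : X ≤ ‖z‖)
    (hE : 3 / 4 * (ρ ^ 2 * X ^ 2) ≤ ‖helixE ρ z‖) :
    ‖helixF ρ z‖ ≤ ((ρ ^ 2 + 1) / (3 / 4 * ρ ^ 2) + 1) / X ^ 2 := by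
  have hz0 : z ≠ 0 := norm_pos_iff.1 (hX.trans_le hz)
  rw [helixF_of_ne_zero ρ hz0]
  refine (norm_sub_le _ _).trans ?_
  have hn : ‖(ρ : ℂ) ^ 2 + 1‖ = ρ ^ 2 + 1 := by
    have : (ρ : ℂ) ^ 2 + 1 = ((ρ ^ 2 + 1 : ℝ) : ℂ) := by push_cast; rfl
    rw [this, Complex.norm_real, Real.norm_of_nonneg (by positivity)]
  rw [norm_div, norm_div, hn, norm_one, norm_pow,
    add_div _ 1 (X ^ 2), div_div]
  rw [← mul_assoc] at hE
  gcongr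

theorem continuous_helixF_ofReal {ρ : ℝ} (hρ : 0 < ρ) :
    Continuous fun t : ℝ => helixF ρ t := by
  refine continuous_iff_continuousAt.2 fun t => ?_
  refine ContinuousAt.comp (f := fun t : ℝ => (t : ℂ)) (DifferentiableAt.continuousAt
    (differentiableAt_helixF ?_)) (by fun_prop)
  rcases eq_or_ne t 0 with rfl | ht
  · simp
  · exact Or.inl (helixE_ne_zero_of_im_eq_zero hρ (by simp) (by simpa using ht))

theorem integrable_helixF_ofReal {ρ : ℝ} (hρ : 0 < ρ) :
    Integrable fun t : ℝ => helixF ρ t := by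
  refine (continuous_helixF_ofReal hρ).locallyIntegrable.integrable_of_isBigO_cocompact
    (g := fun t : ℝ => (1 + t ^ 2)⁻¹) ?_ (integrable_inv_one_add_sq.integrableAtFilter _)
  set C := (ρ ^ 2 + 1) / (3 / 4 * ρ ^ 2) + 1 with hC
  refine Asymptotics.IsBigO.of_bound (2 * C) ?_
  filter_upwards [(tendsto_norm_cocompact_atTop (E := ℝ)).eventually_ge_atTop 1] with t ht
  have h1 : (1 : ℝ) ≤ t ^ 2 := by
    rw [← sq_abs]; rw [Real.norm_eq_abs] at ht; nlinarith
  have h2 := norm_helixF_le hρ (z := t) (X := |t|) (by linarith [Real.norm_eq_abs t]) (by simp) (by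
    refine le_trans ?_ ((le_abs_self _).trans (Complex.abs_re_le_norm _))
    rw [helixE_eq_mk]
    simp
    nlinarith [Real.cos_le_one t, mul_nonneg (sq_nonneg ρ) (sq_nonneg t)])
  refine h2.trans ?_
  rw [sq_abs, ← hC, Real.norm_of_nonneg (by positivity), ← div_eq_mul_inv,
    div_le_div_iff₀ (by positivity) (by positivity)]
  have : 0 < C := by positivity
  nlinarith

theorem ofReal_helixI (ρ : ℝ) : (helixI ρ : ℂ) = ∫ t : ℝ, helixF ρ t := by
  rw [helixI, ← integral_complex_ofReal]
  refine integral_congr_ae ?_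
  filter_upwards [compl_mem_ae_iff.2 (measure_singleton (0 : ℝ))] with t ht
  exact (helixF_ofReal ρ ht).symm

/-- The positive-quadrant roots of `E_ρ` lie in the half-strips `[(2k-1)π, 2kπ] × ℝ⁺`. -/
theorem exists_strip_of_helixE_eq_zero {ρ : ℝ} (hρ : 0 < ρ) {z : ℂ} (hz : helixE ρ z = 0)
    (hr : 0 < z.re) (hi : 0 < z.im) {N : ℕ} (hN : z.re ≤ (2 * (N : ℝ) + 1) * π) :
    ∃ k < N, z.re ∈ Icc ((2 * ((k + 1 : ℕ) : ℝ) - 1) * π) (2 * ((k + 1 : ℕ) : ℝ) * π) := by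
  have hπ := Real.pi_pos
  have hs := sin_re_neg_of_helixE_eq_zero hρ hz hr hi
  have h2π : 0 < 2 * π := by positivity
  set k := ⌊z.re / (2 * π)⌋₊ with hk
  have hk1 : k * (2 * π) ≤ z.re :=
    (le_div_iff₀ h2π).1 (Nat.floor_le (by positivity))
  have hk2 : z.re < (k + 1) * (2 * π) := (div_lt_iff₀ h2π).1 (Nat.lt_floor_add_one _)
  have hk3 : (2 * (k : ℝ) + 1) * π < z.re := by
    by_contra! hc
    have := Real.sin_nonneg_of_nonneg_of_le_pi (x := z.re - k * (2 * π)) (by linarith)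
      (by linarith)
    rw [Real.sin_sub_nat_mul_two_pi] at this
    linarith
  refine ⟨k, ?_, ?_, ?_⟩
  · have : (2 * (k : ℝ) + 1) < 2 * N + 1 := lt_of_mul_lt_mul_right (hk3.trans_le hN) hπ.le
    have : (k : ℝ) < N := by linarith
    exact_mod_cast this
  · push_cast; linarith
  · push_cast; linarith

theorem summable_abs_im_inv_helixE' {ρ : ℝ} (hρ : 0 < ρ) {z : ℕ → ℂ}
    (hz : ∀ k : ℕ, 1 ≤ k → helixE ρ (z k) = 0 ∧
      (z k).re ∈ Set.Icc ((2 * (k : ℝ) - 1) * π) (2 * (k : ℝ) * π) ∧ 0 < (z k).im) :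
    Summable (fun k : ℕ => |(1 / helixE' ρ (z (k + 1))).im|) := by
  have hsum : Summable (fun k : ℕ => 3 / ρ ^ 2 * (1 / ((k + 1 : ℕ) : ℝ) ^ 2)) :=
    ((summable_nat_add_iff 1).2 (Real.summable_one_div_nat_pow.2 one_lt_two)).mul_left _
  refine Summable.of_norm_bounded_eventually_nat hsum ?_
  have hnorm : ∀ k : ℕ, ((k + 1 : ℕ) : ℝ) ≤ ‖z (k + 1)‖ := by
    intro k
    have h1 := (hz (k + 1) (by omega)).2.1.1
    refine le_trans ?_ (h1.trans (Complex.re_le_norm _))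
    push_cast
    nlinarith [Real.pi_gt_three, (Nat.cast_nonneg k : (0 : ℝ) ≤ k)]
  filter_upwards [eventually_ge_atTop (max 6 ⌈8 / ρ ^ 2⌉₊)] with k hk
  have hk6 : (6 : ℝ) ≤ k := by exact_mod_cast (le_max_left _ _).trans hk
  have hk8 : 8 / ρ ^ 2 ≤ k := (Nat.le_ceil _).trans (by exact_mod_cast (le_max_right _ _).trans hk)
  have hn := hnorm k
  have hn' : (k : ℝ) + 1 ≤ ‖z (k + 1)‖ := by exact_mod_cast hn
  have hρ2 : 0 < ρ ^ 2 := by positivity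
  rw [div_le_iff₀ hρ2] at hk8
  have hb := sq_norm_le_norm_helixE' (hz (k + 1) (by omega)).1 (by linarith) (by
    have : (k : ℝ) ≤ ‖z (k + 1)‖ ^ 2 := by nlinarith
    nlinarith)
  have hkpos : (0 : ℝ) < (k + 1 : ℕ) := by positivity
  rw [Real.norm_eq_abs, abs_abs]
  refine (Complex.abs_im_le_norm _).trans ?_
  rw [norm_div, norm_one]
  calc 1 / ‖helixE' ρ (z (k + 1))‖ ≤ 1 / (ρ ^ 2 * ((k + 1 : ℕ) : ℝ) ^ 2 / 3) := by
        refine one_div_le_one_div_of_le (by positivity) (le_trans ?_ hb)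
        gcongr
    _ = _ := by field_simp

theorem sum_residues_eq_rectIntegral {ρ : ℝ} (hρ : 0 < ρ) {z : ℕ → ℂ}
    (hz : ∀ k : ℕ, 1 ≤ k → helixE ρ (z k) = 0 ∧
      (z k).re ∈ Set.Icc ((2 * (k : ℝ) - 1) * π) (2 * (k : ℝ) * π) ∧ 0 < (z k).im)
    {N : ℕ} (hN : 16 * ρ ≤ (2 * (N : ℝ) + 1) * π) :
    rectIntegral (helixF ρ) (-((2 * (N : ℝ) + 1) * π)) ((2 * (N : ℝ) + 1) * π) 0
        ((2 * (N : ℝ) + 1) * π) =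
      ((-4 * π * (ρ ^ 2 + 1) * ∑ k ∈ Finset.range N, (1 / helixE' ρ (z (k + 1))).im : ℝ) : ℂ) := by
  classical
  have hπ := Real.pi_pos
  set X := (2 * (N : ℝ) + 1) * π with hX
  have hXpos : 0 < X := by positivity
  have him : ∀ w : ℂ, helixE ρ w = 0 → |w.re| ≤ X → w.im < X := by
    intro w hw hwr
    by_contra! hc
    have := norm_helixE_ge_of_im hρ (hN.trans hc) (hwr.trans hc)
    rw [hw, norm_zero] at this
    have : 0 < w.im := hXpos.trans_le hc
    have : 0 < ρ ^ 2 * w.im ^ 2 := by positivity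
    linarith
  have hroot : ∀ k < N, helixE ρ (z (k + 1)) = 0 ∧ 0 < (z (k + 1)).re ∧ (z (k + 1)).re < X ∧
      0 < (z (k + 1)).im ∧ (z (k + 1)).im < X := by
    intro k hk
    obtain ⟨h1, ⟨h2, h3⟩, h4⟩ := hz (k + 1) (by omega)
    push_cast at h2 h3
    have hkN : (k : ℝ) + 1 ≤ N := by exact_mod_cast hk
    have hk0 : (0 : ℝ) ≤ k := Nat.cast_nonneg k
    have h5 : 0 < (z (k + 1)).re := lt_of_lt_of_le (by nlinarith) h2
    have h6 : (z (k + 1)).re < X := h3.trans_lt (by rw [hX]; nlinarith)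
    exact ⟨h1, h5, h6, h4, him _ h1 (by rw [abs_of_pos h5]; exact h6.le)⟩
  set S₁ := (Finset.range N).image fun k => z (k + 1) with hS₁
  set S₂ := (Finset.range N).image fun k => -(starRingEnd ℂ) (z (k + 1)) with hS₂
  have hmemS : ∀ s ∈ S₁ ∪ S₂, helixE ρ s = 0 ∧ s ∈ Ioo (-X) X ×ℂ Ioo 0 X := by
    intro s hs
    rcases Finset.mem_union.1 hs with hs | hs <;> obtain ⟨k, hk, rfl⟩ := Finset.mem_image.1 hs <;>
      obtain ⟨h1, h2, h3, h4, h5⟩ := hroot k (Finset.mem_range.1 hk)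
    · exact ⟨h1, ⟨⟨by linarith, h3⟩, h4, h5⟩⟩
    · refine ⟨by rw [helixE_neg_conj, h1, map_zero], ?_⟩
      simp only [mem_reProdIm, Complex.neg_re, Complex.conj_re, Complex.neg_im, Complex.conj_im,
        neg_neg]
      exact ⟨⟨by linarith, by linarith⟩, h4, h5⟩
  have hposre : ∀ w : ℂ, helixE ρ w = 0 → 0 < w.re → w.re ≤ X → 0 < w.im → w ∈ S₁ := by
    intro w hw hr hrX hi
    obtain ⟨k, hk, hkr⟩ := exists_strip_of_helixE_eq_zero hρ hw hr hi hrX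
    obtain ⟨h1, h2, h3⟩ := hz (k + 1) (by omega)
    rw [helixE_root_unique hρ (by omega : 1 ≤ k + 1) hw hkr hi h1 h2 h3]
    exact Finset.mem_image.2 ⟨k, Finset.mem_range.2 hk, rfl⟩
  have hdiff : ∀ w ∈ Icc (-X) X ×ℂ Icc 0 X, w ∉ S₁ ∪ S₂ → DifferentiableAt ℂ (helixF ρ) w := by
    rintro w ⟨⟨hr1, hr2⟩, hi1, hi2⟩ hwS
    refine differentiableAt_helixF ?_
    by_contra! hc
    obtain ⟨hw, hw0⟩ := hc
    have hi : 0 < w.im := by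
      refine lt_of_le_of_ne hi1 fun h => ?_
      refine helixE_ne_zero_of_im_eq_zero hρ h.symm (fun hr => hw0 ?_) hw
      exact Complex.ext hr h.symm
    rcases lt_trichotomy w.re 0 with hr | hr | hr
    · refine hwS (Finset.mem_union_right _ ?_)
      have := hposre (-(starRingEnd ℂ) w) (by rw [helixE_neg_conj, hw, map_zero])
        (by simpa using hr) (by simpa using neg_le.1 hr1) (by simpa using hi)
      obtain ⟨k, hk, hkw⟩ := Finset.mem_image.1 this
      refine Finset.mem_image.2 ⟨k, hk, ?_⟩
      simp [hkw]
    · exact helixE_ne_zero_of_re_eq_zero hρ hr hi.ne' hw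
    · exact hwS (Finset.mem_union_left _ (hposre w hw hr hr2 hi))
  have hres := rectIntegral_eq_sum_residues (by linarith : -X ≤ X) hXpos.le
    (fun s => ((ρ : ℂ) ^ 2 + 1) / helixE' ρ s) (S₁ ∪ S₂) (fun s hs => (hmemS s hs).2) (helixF ρ)
    hdiff (fun s hs => by
      obtain ⟨h1, _, h2, _⟩ := hmemS s hs
      have h2 : 0 < s.im := h2
      exact tendsto_sub_mul_helixF (by rintro rfl; simp at h2) h1 (helixE'_ne_zero h1 h2))
  have hdisj : Disjoint S₁ S₂ := by
    rw [Finset.disjoint_left]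
    intro s hs1 hs2
    obtain ⟨k, hk, rfl⟩ := Finset.mem_image.1 hs1
    obtain ⟨j, hj, hjk⟩ := Finset.mem_image.1 hs2
    have h1 := (hroot k (Finset.mem_range.1 hk)).2.1
    have h2 := (hroot j (Finset.mem_range.1 hj)).2.1
    rw [← hjk] at h1
    simp at h1
    linarith
  have hlt : ∀ i j : ℕ, i < j → (z (i + 1)).re < (z (j + 1)).re := by
    intro i j hij
    have h1 := (hz (i + 1) (by omega)).2.1.2
    have h2 := (hz (j + 1) (by omega)).2.1.1
    have : (i : ℝ) + 1 ≤ j := by exact_mod_cast hij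
    push_cast at h1 h2
    nlinarith
  have hinj : Function.Injective fun k => z (k + 1) := by
    intro i j hij
    have hij' : (z (i + 1)).re = (z (j + 1)).re := congrArg Complex.re hij
    rcases lt_trichotomy i j with h | h | h
    · exact absurd hij' (hlt i j h).ne
    · exact h
    · exact absurd hij' (hlt j i h).ne'
  have hinj' : Function.Injective fun k => -(starRingEnd ℂ) (z (k + 1)) := fun i j hij =>
    hinj ((starRingEnd ℂ).injective (neg_injective hij))
  rw [hres, Finset.sum_union hdisj, hS₁, hS₂, Finset.sum_image hinj.injOn,
    Finset.sum_image hinj'.injOn, ← Finset.sum_add_distrib]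
  have hterm : ∀ k, ((ρ : ℂ) ^ 2 + 1) / helixE' ρ (z (k + 1)) +
      ((ρ : ℂ) ^ 2 + 1) / helixE' ρ (-(starRingEnd ℂ) (z (k + 1))) =
      ((ρ : ℂ) ^ 2 + 1) * (2 * I) * ((1 / helixE' ρ (z (k + 1))).im : ℂ) := by
    intro k
    rw [helixE'_neg_conj]
    have h := Complex.sub_conj (1 / helixE' ρ (z (k + 1)))
    rw [map_div₀, map_one] at h
    push_cast at h
    rw [div_neg]
    linear_combination ((ρ : ℂ) ^ 2 + 1) * h
  rw [Finset.sum_congr rfl fun k _ => hterm k, ← Finset.mul_sum]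
  push_cast
  linear_combination (4 * π * ((ρ : ℂ) ^ 2 + 1) *
    ∑ k ∈ Finset.range N, ((1 / helixE' ρ (z (k + 1))).im : ℂ)) * Complex.I_sq

theorem norm_integral_helixF_sub_sum_le {ρ : ℝ} (hρ : 0 < ρ) {z : ℕ → ℂ}
    (hz : ∀ k : ℕ, 1 ≤ k → helixE ρ (z k) = 0 ∧
      (z k).re ∈ Set.Icc ((2 * (k : ℝ) - 1) * π) (2 * (k : ℝ) * π) ∧ 0 < (z k).im)
    {N : ℕ} (hN : 16 * ρ ≤ (2 * (N : ℝ) + 1) * π) :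
    ‖(∫ t : ℝ in (-((2 * (N : ℝ) + 1) * π))..((2 * (N : ℝ) + 1) * π), helixF ρ t) -
      ((-4 * π * (ρ ^ 2 + 1) *
        ∑ k ∈ Finset.range N, (1 / helixE' ρ (z (k + 1))).im : ℝ) : ℂ)‖ ≤
      4 * ((ρ ^ 2 + 1) / (3 / 4 * ρ ^ 2) + 1) / ((2 * (N : ℝ) + 1) * π) := by
  rw [← sum_residues_eq_rectIntegral hρ hz hN, rectIntegral]
  have hcos : Real.cos ((2 * (N : ℝ) + 1) * π) = -1 := by
    rw [← Real.cos_nat_mul_two_pi_add_pi N]; congr 1; ring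
  have hπ := Real.pi_pos
  set X := (2 * (N : ℝ) + 1) * π with hX
  have hXpos : 0 < X := by positivity
  set C := (ρ ^ 2 + 1) / (3 / 4 * ρ ^ 2) + 1 with hC
  have hside : ∀ x : ℝ, |x| = X → Real.cos x = -1 → ∀ y : ℝ,
      ‖helixF ρ (x + y * I)‖ ≤ C / X ^ 2 := by
    intro x hx hcx y
    have hre : (x + y * I : ℂ).re = x := by simp
    refine norm_helixF_le hρ hXpos ?_ ?_
    · have := Complex.abs_re_le_norm (x + y * I : ℂ)
      rwa [hre, hx] at this
    · have := norm_helixE_ge_of_cos_re (ρ := ρ) (z := x + y * I) (by rw [hre, hcx])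
      rwa [hre, ← sq_abs x, hx] at this
  have htop : ∀ x ∈ uIoc (-X) X, ‖helixF ρ (x + X * I)‖ ≤ C / X ^ 2 := by
    intro x hx
    rw [uIoc_of_le (by linarith)] at hx
    have hre : (x + X * I : ℂ).re = x := by simp
    have him : (x + X * I : ℂ).im = X := by simp
    refine norm_helixF_le hρ hXpos ?_ ?_
    · have := (le_abs_self _).trans (Complex.abs_im_le_norm (x + X * I : ℂ))
      rwa [him] at this
    · have := norm_helixE_ge_of_im hρ (z := x + X * I) (by rw [him]; exact hN)
        (by rw [hre, him, abs_le]; exact ⟨hx.1.le, hx.2⟩)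
      rw [him] at this
      refine le_trans ?_ this
      gcongr
      norm_num
  have b1 := intervalIntegral.norm_integral_le_of_norm_le_const htop
  have b2 := intervalIntegral.norm_integral_le_of_norm_le_const (a := 0) (b := X)
    fun y _ => hside X (abs_of_pos hXpos) hcos y
  have b3 := intervalIntegral.norm_integral_le_of_norm_le_const (a := 0) (b := X)
    fun y _ => hside (-X) (by rw [abs_neg, abs_of_pos hXpos]) (by rw [Real.cos_neg, hcos]) y
  rw [sub_neg_eq_add, abs_of_pos (by linarith)] at b1
  rw [sub_zero, abs_of_pos hXpos] at b2 b3
  have e : ∀ a t r l : ℂ, a - (a - t + I * r - I * l) = t - I * r + I * l := fun _ _ _ _ => by ring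
  have e0 : ∀ x : ℝ, helixF ρ (x + (0 : ℝ) * I) = helixF ρ x := fun x => by simp
  simp only [e0]
  rw [e]
  refine (norm_add_le _ _).trans ((add_le_add (norm_sub_le _ _) le_rfl).trans ?_)
  rw [norm_mul, norm_mul, Complex.norm_I, one_mul, one_mul]
  refine (add_le_add (add_le_add b1 b2) b3).trans (le_of_eq ?_)
  field_simp
  ring

/-- The residue-series representation of `I(ρ)`: if `z k` is for each `k ≥ 1` a root of `E_ρ`
in the half-strip `[(2k-1)π, 2kπ] × ℝ⁺`, then
`I(ρ) = -4π(ρ²+1) Σ_{k≥1} Im (1/E'_ρ(z_k))`, the series converging absolutely. -/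
theorem helixI_residue_series (ρ : ℝ) (hρ : 0 < ρ) (z : ℕ → ℂ)
    (hz : ∀ k : ℕ, 1 ≤ k → helixE ρ (z k) = 0 ∧
      (z k).re ∈ Set.Icc ((2 * (k : ℝ) - 1) * π) (2 * (k : ℝ) * π) ∧ 0 < (z k).im) :
    Summable (fun k : ℕ => |(1 / helixE' ρ (z (k + 1))).im|) ∧
    helixI ρ = -4 * π * (ρ ^ 2 + 1) * ∑' k : ℕ, (1 / helixE' ρ (z (k + 1))).im := by
  have hsum := summable_abs_im_inv_helixE' hρ hz
  refine ⟨hsum, ?_⟩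
  have hX : Tendsto (fun N : ℕ => (2 * (N : ℝ) + 1) * π) atTop atTop :=
    (tendsto_atTop_add_const_right _ _
      (tendsto_natCast_atTop_atTop.const_mul_atTop two_pos)).atTop_mul_const Real.pi_pos
  have hIntegral := intervalIntegral_tendsto_integral (integrable_helixF_ofReal hρ)
    (tendsto_neg_atTop_atBot.comp hX) hX
  rw [← ofReal_helixI] at hIntegral
  have hdiff := squeeze_zero_norm' ((hX.eventually_ge_atTop (16 * ρ)).mono fun N hN =>
    norm_integral_helixF_sub_sum_le hρ hz hN) (hX.const_div_atTop _)
  have hlim := hIntegral.sub hdiff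
  simp only [Function.comp_apply, sub_sub_cancel, sub_zero] at hlim
  have hlim' : Tendsto (fun N : ℕ => -4 * π * (ρ ^ 2 + 1) *
      ∑ k ∈ Finset.range N, (1 / helixE' ρ (z (k + 1))).im) atTop (𝓝 (helixI ρ)) := by
    have h := (Complex.continuous_re.tendsto _).comp hlim
    simpa only [Function.comp_def, Complex.ofReal_re] using h
  exact tendsto_nhds_unique hlim' (hsum.of_abs.hasSum.tendsto_sum_nat.const_mul _)
end

section
/- As ρ → 0⁺, G(ρ) is asymptotically equivalent to log(1/ρ); that is, lim_{ρ→0⁺} G(ρ)/log(1/ρ) = 1. -/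
open Real Filter

/-- The auxiliary series `G(ρ) = Σ_{k≥1} 1/(k√((kπρ)² + 1))`. -/
noncomputable def helixG (ρ : ℝ) : ℝ :=
  ∑' k : ℕ, 1 / (((k : ℝ) + 1) * Real.sqrt ((((k : ℝ) + 1) * π * ρ) ^ 2 + 1))

/-- The general term of the series defining `helixG`. -/
noncomputable def helixTerm (ρ : ℝ) (k : ℕ) : ℝ :=
  1 / (((k : ℝ) + 1) * Real.sqrt ((((k : ℝ) + 1) * π * ρ) ^ 2 + 1))

theorem helixTerm_nonneg (ρ : ℝ) (k : ℕ) : 0 ≤ helixTerm ρ k := by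
  unfold helixTerm
  positivity

theorem helixTerm_le_inv (ρ : ℝ) (k : ℕ) : helixTerm ρ k ≤ ((k : ℝ) + 1)⁻¹ := by
  rw [helixTerm, one_div]
  have h1 : 1 ≤ Real.sqrt ((((k : ℝ) + 1) * π * ρ) ^ 2 + 1) :=
    Real.one_le_sqrt.2 (by nlinarith [sq_nonneg (((k : ℝ) + 1) * π * ρ)])
  apply inv_anti₀ (by positivity)
  exact le_mul_of_one_le_right (by positivity) h1

theorem inv_sub_le_helixTerm {ρ : ℝ} (hρ : 0 < ρ) (k : ℕ) :
    ((k : ℝ) + 1)⁻¹ - π * ρ ≤ helixTerm ρ k := by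
  have hx : 0 < ((k : ℝ) + 1) * π * ρ := by positivity
  have hs : Real.sqrt ((((k : ℝ) + 1) * π * ρ) ^ 2 + 1) ≤ ((k : ℝ) + 1) * π * ρ + 1 :=
    Real.sqrt_le_iff.2 ⟨by positivity, by nlinarith⟩
  calc ((k : ℝ) + 1)⁻¹ - π * ρ
      ≤ 1 / (((k : ℝ) + 1) * (((k : ℝ) + 1) * π * ρ + 1)) := by
        rw [le_div_iff₀ (by positivity)]
        have h : (((k : ℝ) + 1)⁻¹ - π * ρ) * (((k : ℝ) + 1) * (((k : ℝ) + 1) * π * ρ + 1))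
            = 1 - (((k : ℝ) + 1) * π * ρ) ^ 2 := by
          field_simp
          ring
        rw [h]
        nlinarith [sq_nonneg (((k : ℝ) + 1) * π * ρ)]
    _ ≤ helixTerm ρ k := by
        unfold helixTerm
        gcongr

theorem helixTerm_le_telescope {ρ : ℝ} (hρ : 0 < ρ) {k : ℕ} (hk : 0 < k) :
    helixTerm ρ k ≤ (π * ρ)⁻¹ * ((k : ℝ)⁻¹ - ((k : ℝ) + 1)⁻¹) := by
  have hk' : (0 : ℝ) < k := by exact_mod_cast hk
  have hs : (k : ℝ) * π * ρ ≤ Real.sqrt ((((k : ℝ) + 1) * π * ρ) ^ 2 + 1) := by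
    apply Real.le_sqrt_of_sq_le
    have : (k : ℝ) * π * ρ ≤ ((k : ℝ) + 1) * π * ρ := by gcongr; linarith
    nlinarith [show 0 < (k : ℝ) * π * ρ by positivity]
  calc helixTerm ρ k ≤ 1 / (((k : ℝ) + 1) * ((k : ℝ) * π * ρ)) := by
        unfold helixTerm
        gcongr
    _ = _ := by
        field_simp
        ring

theorem sum_range_helixTerm_le_harmonic (ρ : ℝ) (N : ℕ) :
    ∑ k ∈ Finset.range N, helixTerm ρ k ≤ (harmonic N : ℝ) := by
  simp only [harmonic, Rat.cast_sum, Rat.cast_inv, Rat.cast_natCast]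
  push_cast
  exact Finset.sum_le_sum fun k _ => helixTerm_le_inv ρ k

theorem harmonic_sub_le_sum_range_helixTerm {ρ : ℝ} (hρ : 0 < ρ) (N : ℕ) :
    (harmonic N : ℝ) - N * (π * ρ) ≤ ∑ k ∈ Finset.range N, helixTerm ρ k := by
  have h := Finset.sum_le_sum fun k (_ : k ∈ Finset.range N) => inv_sub_le_helixTerm hρ k
  simpa [harmonic, Finset.sum_sub_distrib] using h

theorem sum_range_add_helixTerm_le {ρ : ℝ} (hρ : 0 < ρ) {N : ℕ} (hN : 0 < N) (m : ℕ) :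
    ∑ k ∈ Finset.range (N + m), helixTerm ρ k
      ≤ harmonic N + (π * ρ)⁻¹ * ((N : ℝ)⁻¹ - ((N + m : ℕ) : ℝ)⁻¹) := by
  induction m with
  | zero => simpa using sum_range_helixTerm_le_harmonic ρ N
  | succ m ih =>
    rw [← add_assoc, Finset.sum_range_succ]
    have h := helixTerm_le_telescope hρ (k := N + m) (by omega)
    rw [Nat.cast_succ (N + m)]
    linarith

theorem sum_range_helixTerm_le {ρ : ℝ} (hρ : 0 < ρ) {N : ℕ} (hN : 0 < N) (n : ℕ) :
    ∑ k ∈ Finset.range n, helixTerm ρ k ≤ harmonic N + (π * ρ)⁻¹ * (N : ℝ)⁻¹ := by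
  calc ∑ k ∈ Finset.range n, helixTerm ρ k
      ≤ ∑ k ∈ Finset.range (N + n), helixTerm ρ k :=
        Finset.sum_le_sum_of_subset_of_nonneg (Finset.range_mono (by omega))
          fun k _ _ => helixTerm_nonneg ρ k
    _ ≤ _ := sum_range_add_helixTerm_le hρ hN n
    _ ≤ _ := by
        gcongr
        exact sub_le_self _ (by positivity)

theorem summable_helixTerm {ρ : ℝ} (hρ : 0 < ρ) : Summable (helixTerm ρ) :=
  summable_of_sum_range_le (helixTerm_nonneg ρ) (sum_range_helixTerm_le hρ one_pos)

theorem log_sub_pi_le_helixG {ρ : ℝ} (hρ : 0 < ρ) : Real.log (1 / ρ) - π ≤ helixG ρ := by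
  have h0 : 0 ≤ 1 / ρ := by positivity
  have hlog := log_le_harmonic_floor (1 / ρ) h0
  have hsum := harmonic_sub_le_sum_range_helixTerm hρ ⌊1 / ρ⌋₊
  have hG : ∑ k ∈ Finset.range ⌊1 / ρ⌋₊, helixTerm ρ k ≤ helixG ρ :=
    (summable_helixTerm hρ).sum_le_tsum _ fun k _ => helixTerm_nonneg ρ k
  have hfl : (⌊1 / ρ⌋₊ : ℝ) * (π * ρ) ≤ π := by
    calc (⌊1 / ρ⌋₊ : ℝ) * (π * ρ) ≤ 1 / ρ * (π * ρ) := by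
          gcongr
          exact Nat.floor_le h0
      _ = π := by field_simp
  linarith

theorem helixG_le_log_add_two {ρ : ℝ} (hρ : 0 < ρ) (hρ1 : ρ ≤ 1) :
    helixG ρ ≤ Real.log (1 / ρ) + 2 := by
  have h1 : 1 ≤ 1 / ρ := by rwa [le_div_iff₀ hρ, one_mul]
  have hN : 0 < ⌊1 / ρ⌋₊ := Nat.floor_pos.2 h1
  have hN' : (1 : ℝ) ≤ ⌊1 / ρ⌋₊ := by exact_mod_cast hN
  have hlt := Nat.lt_floor_add_one (1 / ρ)
  have hG : helixG ρ ≤ harmonic ⌊1 / ρ⌋₊ + (π * ρ)⁻¹ * (⌊1 / ρ⌋₊ : ℝ)⁻¹ :=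
    Real.tsum_le_of_sum_range_le (helixTerm_nonneg ρ) (sum_range_helixTerm_le hρ hN)
  have hlog := harmonic_floor_le_one_add_log (1 / ρ) h1
  have htail : (π * ρ)⁻¹ * (⌊1 / ρ⌋₊ : ℝ)⁻¹ ≤ 1 := by
    rw [← mul_inv]
    apply inv_le_one_of_one_le₀
    rw [div_lt_iff₀ hρ] at hlt
    nlinarith [Real.pi_gt_three, mul_pos hρ (zero_lt_one.trans_le hN')]
  linarith

theorem helixG_asymptotics :
    Filter.Tendsto (fun ρ : ℝ => helixG ρ / Real.log (1 / ρ))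
      (nhdsWithin 0 (Set.Ioi 0)) (nhds 1) := by
  have hL : Tendsto (fun ρ : ℝ => Real.log (1 / ρ)) (nhdsWithin 0 (Set.Ioi 0)) atTop := by
    simpa only [one_div, Function.comp_def] using
      Real.tendsto_log_atTop.comp (tendsto_inv_nhdsGT_zero (𝕜 := ℝ))
  have hlow : Tendsto (fun ρ : ℝ => 1 - π / Real.log (1 / ρ))
      (nhdsWithin 0 (Set.Ioi 0)) (nhds 1) := by
    simpa using (hL.const_div_atTop π).const_sub 1
  have hupp : Tendsto (fun ρ : ℝ => 1 + 2 / Real.log (1 / ρ))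
      (nhdsWithin 0 (Set.Ioi 0)) (nhds 1) := by
    simpa using (hL.const_div_atTop 2).const_add 1
  refine tendsto_of_tendsto_of_tendsto_of_le_of_le' hlow hupp ?_ ?_
  · filter_upwards [hL.eventually_gt_atTop 0, self_mem_nhdsWithin] with ρ hlog hρ
    rw [one_sub_div hlog.ne']
    exact div_le_div_of_nonneg_right (log_sub_pi_le_helixG hρ) hlog.le
  · filter_upwards [hL.eventually_gt_atTop 0, Ioc_mem_nhdsGT one_pos] with ρ hlog hρ
    rw [one_add_div hlog.ne']
    exact div_le_div_of_nonneg_right (helixG_le_log_add_two hρ.1 hρ.2) hlog.le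
end

section
/- For every ρ > 0, the two-sided bound log((1 + √((πρ)² + 1))/π) ≤ G(ρ) − log(1/ρ) ≤ 1/√((πρ)² + 1) + log((1 + √((πρ)² + 1))/π) holds. -/
open Real Filter

/-- The summand `1 / (x √((a x)² + 1))` is minus the derivative of `arsinh (1 / (a x))`. -/
theorem hasDerivAt_arsinh_one_div {a x : ℝ} (ha : 0 < a) (hx : 0 < x) :
    HasDerivAt (fun y => arsinh (1 / (a * y))) (-(1 / (x * √((a * x) ^ 2 + 1)))) x := by
  have hax : 0 < a * x := mul_pos ha hx
  have hlin : HasDerivAt (fun y : ℝ => a * y) a x := by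
    simpa using (hasDerivAt_id x).const_mul a
  have hinv : HasDerivAt (fun y : ℝ => 1 / (a * y)) (-a / (a * x) ^ 2) x := by
    simpa only [one_div] using hlin.fun_inv hax.ne'
  have hsqrt : √(1 + (1 / (a * x)) ^ 2) = √((a * x) ^ 2 + 1) / (a * x) := by
    rw [show 1 + (1 / (a * x)) ^ 2 = ((a * x) ^ 2 + 1) / (a * x) ^ 2 by field_simp,
      sqrt_div' _ (sq_nonneg _), sqrt_sq hax.le]
  have hpos : 0 < √((a * x) ^ 2 + 1) := by positivity
  refine hinv.arsinh.congr_deriv ?_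
  rw [hsqrt, smul_eq_mul]
  field_simp

theorem one_div_mul_sqrt_anti {a x y : ℝ} (ha : 0 < a) (hx : 0 < x) (hxy : x ≤ y) :
    1 / (y * √((a * y) ^ 2 + 1)) ≤ 1 / (x * √((a * x) ^ 2 + 1)) := by
  have hy : 0 < y := hx.trans_le hxy
  gcongr

theorem arsinh_one_div_sub_mem_Icc {a x : ℝ} (ha : 0 < a) (hx : 0 < x) :
    arsinh (1 / (a * x)) - arsinh (1 / (a * (x + 1))) ∈
      Set.Icc (1 / ((x + 1) * √((a * (x + 1)) ^ 2 + 1))) (1 / (x * √((a * x) ^ 2 + 1))) := by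
  obtain ⟨c, ⟨hxc, hcx⟩, hc⟩ := exists_hasDerivAt_eq_slope
    (fun y => arsinh (1 / (a * y))) (fun y => -(1 / (y * √((a * y) ^ 2 + 1))))
    (lt_add_one x)
    (fun y hy => (hasDerivAt_arsinh_one_div ha (hx.trans_le hy.1)).continuousAt.continuousWithinAt)
    (fun y hy => hasDerivAt_arsinh_one_div ha (hx.trans hy.1))
  rw [add_sub_cancel_left, div_one] at hc
  have hlo := one_div_mul_sqrt_anti ha (hx.trans hxc) hcx.le
  have hhi := one_div_mul_sqrt_anti ha hx hxc.le
  constructor <;> linarith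

theorem hasSum_arsinh_one_div_sub {a : ℝ} (ha : 0 < a) :
    HasSum (fun k : ℕ => arsinh (1 / (a * ((k : ℝ) + 1))) - arsinh (1 / (a * ((k : ℝ) + 1 + 1))))
      (arsinh (1 / a)) := by
  rw [hasSum_iff_tendsto_nat_of_nonneg]
  · have hsum (n : ℕ) : ∑ k ∈ Finset.range n,
        (arsinh (1 / (a * ((k : ℝ) + 1))) - arsinh (1 / (a * ((k : ℝ) + 1 + 1)))) =
          arsinh (1 / a) - arsinh (1 / a * (1 / ((n : ℝ) + 1))) := by
      have h := Finset.sum_range_sub' (fun k : ℕ => arsinh (1 / (a * ((k : ℝ) + 1)))) n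
      push_cast at h
      rw [h, zero_add, mul_one, one_div_mul_one_div]
    simp_rw [hsum]
    have hlim := (continuous_arsinh.tendsto _).comp
      (tendsto_one_div_add_atTop_nhds_zero_nat (𝕜 := ℝ) |>.const_mul (1 / a))
    simpa using hlim.const_sub (arsinh (1 / a))
  · intro k
    have hk : (0 : ℝ) < (k : ℝ) + 1 := by positivity
    exact le_trans (by positivity) (arsinh_one_div_sub_mem_Icc ha hk).1

theorem arsinh_one_div_eq_log {a : ℝ} (ha : 0 < a) :
    arsinh (1 / a) = log ((1 + √(a ^ 2 + 1)) / a) := by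
  rw [arsinh, show 1 + (1 / a) ^ 2 = (a ^ 2 + 1) / a ^ 2 by field_simp,
    sqrt_div' _ (sq_nonneg _), sqrt_sq ha.le, ← add_div]

/-- Integral-test bounds for `∑ 1 / (k √((a k)² + 1))`. -/
theorem tsum_one_div_mul_sqrt_mem_Icc {a : ℝ} (ha : 0 < a) :
    ∑' k : ℕ, 1 / (((k : ℝ) + 1) * √((a * ((k : ℝ) + 1)) ^ 2 + 1)) ∈
      Set.Icc (arsinh (1 / a)) (1 / √(a ^ 2 + 1) + arsinh (1 / a)) := by
  set f : ℕ → ℝ := fun k => 1 / (((k : ℝ) + 1) * √((a * ((k : ℝ) + 1)) ^ 2 + 1)) with hf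
  have hF := hasSum_arsinh_one_div_sub ha
  have hbound (k : ℕ) := arsinh_one_div_sub_mem_Icc ha (x := (k : ℝ) + 1) (by positivity)
  have hsucc (k : ℕ) : f (k + 1) ≤
      arsinh (1 / (a * ((k : ℝ) + 1))) - arsinh (1 / (a * ((k : ℝ) + 1 + 1))) := by
    simpa [hf] using (hbound k).1
  have htail : Summable fun k => f (k + 1) :=
    .of_nonneg_of_le (fun k => by positivity) hsucc hF.summable
  have hsum : Summable f := (summable_nat_add_iff 1).1 htail
  constructor
  · exact hasSum_le (fun k => (hbound k).2) hF hsum.hasSum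
  · rw [hsum.tsum_eq_zero_add]
    have hzero : f 0 = 1 / √(a ^ 2 + 1) := by simp [hf]
    rw [hzero]
    gcongr
    exact hasSum_le hsucc htail.hasSum hF

theorem helixG_two_sided_bound (ρ : ℝ) (hρ : 0 < ρ) :
    Real.log ((1 + Real.sqrt ((π * ρ) ^ 2 + 1)) / π) ≤ helixG ρ - Real.log (1 / ρ) ∧
    helixG ρ - Real.log (1 / ρ) ≤
      1 / Real.sqrt ((π * ρ) ^ 2 + 1) + Real.log ((1 + Real.sqrt ((π * ρ) ^ 2 + 1)) / π) := by
  have ha : 0 < π * ρ := mul_pos pi_pos hρ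
  have hG : helixG ρ =
      ∑' k : ℕ, 1 / (((k : ℝ) + 1) * √((π * ρ * ((k : ℝ) + 1)) ^ 2 + 1)) := by
    simp only [helixG, mul_assoc, mul_comm]
  have hlog : arsinh (1 / (π * ρ)) =
      log ((1 + √((π * ρ) ^ 2 + 1)) / π) + log (1 / ρ) := by
    rw [arsinh_one_div_eq_log ha, ← log_mul (by positivity) (by positivity), div_mul_div_comm,
      mul_one]
  have hmem := tsum_one_div_mul_sqrt_mem_Icc ha
  rw [← hG, hlog] at hmem
  obtain ⟨hlo, hhi⟩ := hmem
  constructor <;> linarith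
end

section
/- Define Ĩ(ρ) = −4π(ρ² + 1) · Σ_{k=1}^∞ Im(1/E'_ρ(w_k(ρ))). Then the series converges absolutely for every ρ > 0, and as ρ → 0⁺, Ĩ(ρ) is asymptotically equivalent to log(1/ρ)/ρ; that is, lim_{ρ→0⁺} ρ·Ĩ(ρ)/log(1/ρ) = 1. -/
open Real Complex Filter

/-- The approximate roots `w_k(ρ) = 2πk + 2i·arcsinh(kπρ)`. -/
noncomputable def helixW (ρ : ℝ) (k : ℕ) : ℂ :=
  (2 * π * (k : ℝ) : ℝ) + 2 * Complex.I * (Real.arsinh ((k : ℝ) * π * ρ) : ℂ)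

/-- The approximate residue series `Ĩ(ρ) = -4π(ρ²+1) Σ_{k≥1} Im (1/E'_ρ(w_k(ρ)))`. -/
noncomputable def helixItilde (ρ : ℝ) : ℝ :=
  -4 * π * (ρ ^ 2 + 1) * ∑' k : ℕ, (1 / helixE' ρ (helixW ρ (k + 1))).im

/-- `arsinh (1 / x)` is an antiderivative of `-1 / (x √(1 + x²))` on the positive half-line. -/
lemma hasDerivAt_arsinh_inv {x : ℝ} (hx : 0 < x) :
    HasDerivAt (fun y : ℝ => Real.arsinh y⁻¹) (-(1 / (x * √(1 + x ^ 2)))) x := by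
  have h := (Real.hasDerivAt_arsinh x⁻¹).comp x (hasDerivAt_inv hx.ne')
  refine h.congr_deriv ?_
  have h1 : √(1 + x⁻¹ ^ 2) = √(1 + x ^ 2) / x := by
    rw [show 1 + x⁻¹ ^ 2 = (1 + x ^ 2) / x ^ 2 by field_simp; ring,
      Real.sqrt_div (by positivity), Real.sqrt_sq hx.le]
  have h2 : 0 < √(1 + x ^ 2) := Real.sqrt_pos.2 (by positivity)
  rw [h1]
  field_simp

lemma one_div_mul_sqrt_antitone {x y : ℝ} (hx : 0 < x) (hxy : x ≤ y) :
    1 / (y * √(1 + y ^ 2)) ≤ 1 / (x * √(1 + x ^ 2)) := by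
  have h2 : 0 < √(1 + x ^ 2) := Real.sqrt_pos.2 (by positivity)
  have hy : 0 ≤ y := hx.le.trans hxy
  gcongr

/-- Comparison of the integral of `1 / (t √(1 + t²))` over `[x, y]` with its endpoint values. -/
lemma arsinh_inv_sub_bounds {x y : ℝ} (hx : 0 < x) (hxy : x < y) :
    (y - x) * (1 / (y * √(1 + y ^ 2))) ≤ Real.arsinh x⁻¹ - Real.arsinh y⁻¹ ∧
    Real.arsinh x⁻¹ - Real.arsinh y⁻¹ ≤ (y - x) * (1 / (x * √(1 + x ^ 2))) := by
  obtain ⟨c, ⟨hc1, hc2⟩, hc⟩ := exists_hasDerivAt_eq_slope (fun y : ℝ => Real.arsinh y⁻¹)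
    (fun x => -(1 / (x * √(1 + x ^ 2)))) hxy
    (fun z hz => (hasDerivAt_arsinh_inv (hx.trans_le hz.1)).continuousAt.continuousWithinAt)
    (fun z hz => hasDerivAt_arsinh_inv (hx.trans hz.1))
  have hd : 0 < y - x := sub_pos.2 hxy
  have key : Real.arsinh x⁻¹ - Real.arsinh y⁻¹ = (y - x) * (1 / (c * √(1 + c ^ 2))) := by
    rw [eq_div_iff hd.ne'] at hc
    linarith
  rw [key]
  exact ⟨mul_le_mul_of_nonneg_left (one_div_mul_sqrt_antitone (hx.trans hc1) hc2.le) hd.le,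
    mul_le_mul_of_nonneg_left (one_div_mul_sqrt_antitone hx hc1.le) hd.le⟩

/-- The `k`-th term of the Riemann sum of step `h` for `1 / (x √(1 + x²))` at `h, 2h, …`. -/
noncomputable def riemannTerm (h : ℝ) (k : ℕ) : ℝ :=
  h * (1 / (((k + 1 : ℕ) * h) * √(1 + ((k + 1 : ℕ) * h) ^ 2)))

lemma riemannTerm_nonneg {h : ℝ} (hh : 0 < h) (k : ℕ) : 0 ≤ riemannTerm h k := by
  unfold riemannTerm
  positivity

lemma riemannTerm_zero_le_one {h : ℝ} (hh : 0 < h) : riemannTerm h 0 ≤ 1 := by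
  have h1 : 1 ≤ √(1 + h ^ 2) := Real.one_le_sqrt.2 (by nlinarith)
  have : riemannTerm h 0 = 1 / √(1 + h ^ 2) := by
    simp only [riemannTerm, zero_add, Nat.cast_one, one_mul]
    field_simp
  rw [this]
  exact (div_le_one (by linarith)).2 h1

lemma riemannTerm_step_bounds {h : ℝ} (hh : 0 < h) (k : ℕ) :
    riemannTerm h (k + 1) ≤
      Real.arsinh ((k + 1 : ℕ) * h)⁻¹ - Real.arsinh ((k + 1 + 1 : ℕ) * h)⁻¹ ∧
    Real.arsinh ((k + 1 : ℕ) * h)⁻¹ - Real.arsinh ((k + 1 + 1 : ℕ) * h)⁻¹ ≤ riemannTerm h k := by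
  have hs : ((k + 1 + 1 : ℕ) : ℝ) * h - ((k + 1 : ℕ) : ℝ) * h = h := by push_cast; ring
  have hb := arsinh_inv_sub_bounds (x := ((k + 1 : ℕ) : ℝ) * h)
    (y := ((k + 1 + 1 : ℕ) : ℝ) * h) (by positivity) (by linarith)
  rwa [hs] at hb

lemma sum_range_riemannTerm_le {h : ℝ} (hh : 0 < h) (n : ℕ) :
    ∑ k ∈ Finset.range n, riemannTerm h k ≤ 1 + Real.arsinh h⁻¹ := by
  have h0 : ∑ k ∈ Finset.range n, riemannTerm h k ≤
      ∑ k ∈ Finset.range (n + 1), riemannTerm h k :=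
    Finset.sum_le_sum_of_subset_of_nonneg (Finset.range_mono n.le_succ)
      fun k _ _ => riemannTerm_nonneg hh k
  have h1 := Finset.sum_le_sum fun k (_ : k ∈ Finset.range n) => (riemannTerm_step_bounds hh k).1
  rw [Finset.sum_range_sub' (fun k : ℕ => Real.arsinh ((k + 1 : ℕ) * h)⁻¹)] at h1
  rw [Finset.sum_range_succ'] at h0
  have h2 : 0 ≤ Real.arsinh (((n + 1 : ℕ) : ℝ) * h)⁻¹ := Real.arsinh_nonneg_iff.2 (by positivity)
  have h3 := riemannTerm_zero_le_one hh
  simp only [zero_add, Nat.cast_one, one_mul] at h1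
  linarith

lemma summable_riemannTerm {h : ℝ} (hh : 0 < h) : Summable (riemannTerm h) :=
  summable_of_sum_range_le (riemannTerm_nonneg hh) (sum_range_riemannTerm_le hh)

lemma tsum_riemannTerm_le {h : ℝ} (hh : 0 < h) :
    ∑' k, riemannTerm h k ≤ 1 + Real.arsinh h⁻¹ :=
  Real.tsum_le_of_sum_range_le (riemannTerm_nonneg hh) (sum_range_riemannTerm_le hh)

lemma arsinh_inv_le_tsum_riemannTerm {h : ℝ} (hh : 0 < h) :
    Real.arsinh h⁻¹ ≤ ∑' k, riemannTerm h k := by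
  have hlim : Tendsto (fun n : ℕ => Real.arsinh h⁻¹ - Real.arsinh (((n + 1 : ℕ) : ℝ) * h)⁻¹)
      atTop (nhds (Real.arsinh h⁻¹ - Real.arsinh 0)) := by
    refine tendsto_const_nhds.sub ((Real.continuous_arsinh.tendsto 0).comp ?_)
    refine tendsto_inv_atTop_zero.comp (Tendsto.atTop_mul_const hh ?_)
    exact tendsto_natCast_atTop_atTop.comp (tendsto_add_atTop_nat 1)
  rw [Real.arsinh_zero, sub_zero] at hlim
  refine le_of_tendsto' hlim fun n => ?_
  have h1 := Finset.sum_le_sum fun k (_ : k ∈ Finset.range n) => (riemannTerm_step_bounds hh k).2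
  rw [Finset.sum_range_sub' (fun k : ℕ => Real.arsinh ((k + 1 : ℕ) * h)⁻¹)] at h1
  simp only [zero_add, Nat.cast_one, one_mul] at h1
  exact h1.trans ((summable_riemannTerm hh).sum_le_tsum _ fun k _ => riemannTerm_nonneg hh k)

/-- `E'_ρ(w_k)` in Cartesian form. -/
lemma helixE'_helixW (ρ : ℝ) (k : ℕ) :
    helixE' ρ (helixW ρ k) =
      ⟨4 * (ρ * (k * (π * ρ))), 4 * (ρ ^ 2 * Real.arsinh (k * (π * ρ)) +
        k * (π * ρ) * √(1 + (k * (π * ρ)) ^ 2))⟩ := by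
  have hsin : Complex.sin (helixW ρ k) =
      2 * (k * (π * ρ) : ℝ) * (√(1 + (k * (π * ρ)) ^ 2) : ℝ) * Complex.I := by
    have hw : helixW ρ k =
        (2 * (Real.arsinh (k * (π * ρ)) : ℝ)) * Complex.I + (k : ℂ) * (2 * π) := by
      simp only [helixW, mul_assoc]
      push_cast
      ring
    rw [hw, Complex.sin_add_nat_mul_two_pi, Complex.sin_mul_I, Complex.sinh_two_mul,
      ← Complex.ofReal_sinh, ← Complex.ofReal_cosh, Real.sinh_arsinh, Real.cosh_arsinh]
  rw [helixE', hsin]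
  apply Complex.ext
  · simp [helixW, ← Complex.ofReal_pow, -Complex.ofReal_mul]
    ring
  · simp [helixW, ← Complex.ofReal_pow]
    ring_nf

/-- Two-sided estimate for `B / (A² + B²)` when `c ≤ B ≤ (1 + r) c` and `A² ≤ r c²`. -/
lemma div_sq_add_sq_bounds {A B c r : ℝ} (hc : 0 < c) (hB : c ≤ B)
    (hB' : B ≤ (1 + r) * c) (hA : A ^ 2 ≤ r * c ^ 2) :
    1 / c / (1 + 2 * r) ≤ B / (A ^ 2 + B ^ 2) ∧ B / (A ^ 2 + B ^ 2) ≤ 1 / c := by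
  have hBpos : 0 < B := hc.trans_le hB
  have hr : 0 ≤ r := by nlinarith
  have hden : 0 < A ^ 2 + B ^ 2 := by positivity
  constructor
  · rw [div_div, div_le_div_iff₀ (by positivity) hden]
    have h1 : r * c ^ 2 ≤ r * (c * B) := by gcongr; nlinarith
    nlinarith [mul_le_mul_of_nonneg_left hB' hBpos.le]
  · rw [div_le_div_iff₀ hden hc]
    nlinarith [sq_nonneg A]

lemma arsinh_le_self {x : ℝ} (hx : 0 ≤ x) : Real.arsinh x ≤ x := by
  have h := Real.self_le_sinh_iff.2 (Real.arsinh_nonneg_iff.2 hx)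
  rwa [Real.sinh_arsinh] at h

lemma im_one_div_helixE'_bounds {ρ : ℝ} (hρ : 0 < ρ) (k : ℕ) :
    riemannTerm (π * ρ) k / (1 + 2 * ρ ^ 2) ≤
      π * ρ * (-4 * (1 / helixE' ρ (helixW ρ (k + 1))).im) ∧
    π * ρ * (-4 * (1 / helixE' ρ (helixW ρ (k + 1))).im) ≤ riemannTerm (π * ρ) k := by
  have hh : 0 < π * ρ := by positivity
  set x : ℝ := ((k + 1 : ℕ) : ℝ) * (π * ρ) with hx
  have hxpos : 0 < x := by positivity
  have hs : 1 ≤ √(1 + x ^ 2) := Real.one_le_sqrt.2 (by nlinarith)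
  have hxs : x ≤ x * √(1 + x ^ 2) := le_mul_of_one_le_right hxpos.le hs
  have ha0 : 0 ≤ Real.arsinh x := Real.arsinh_nonneg_iff.2 hxpos.le
  have ha : Real.arsinh x ≤ x := arsinh_le_self hxpos.le
  have hρ2 : 0 < ρ ^ 2 := by positivity
  obtain ⟨h1, h2⟩ := div_sq_add_sq_bounds (A := ρ * x)
    (B := ρ ^ 2 * Real.arsinh x + x * √(1 + x ^ 2)) (c := x * √(1 + x ^ 2)) (r := ρ ^ 2)
    (by positivity) (by nlinarith) (by nlinarith) (by rw [mul_pow]; gcongr)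
  have him : -4 * (1 / helixE' ρ (helixW ρ (k + 1))).im =
      (ρ ^ 2 * Real.arsinh x + x * √(1 + x ^ 2)) /
        ((ρ * x) ^ 2 + (ρ ^ 2 * Real.arsinh x + x * √(1 + x ^ 2)) ^ 2) := by
    rw [helixE'_helixW, one_div, Complex.inv_im, Complex.normSq_mk, ← hx]
    have : 0 < (ρ * x) ^ 2 + (ρ ^ 2 * Real.arsinh x + x * √(1 + x ^ 2)) ^ 2 := by positivity
    generalize ρ ^ 2 * Real.arsinh x + x * √(1 + x ^ 2) = B at *
    generalize ρ * x = A at *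
    rw [show 4 * A * (4 * A) + 4 * B * (4 * B) = 16 * (A ^ 2 + B ^ 2) by ring]
    field_simp
    ring
  rw [him, riemannTerm, ← hx, mul_div_assoc]
  exact ⟨mul_le_mul_of_nonneg_left h1 hh.le, mul_le_mul_of_nonneg_left h2 hh.le⟩

lemma summable_abs_im_one_div_helixE' {ρ : ℝ} (hρ : 0 < ρ) :
    Summable (fun k : ℕ => |(1 / helixE' ρ (helixW ρ (k + 1))).im|) := by
  have hh : 0 < π * ρ := by positivity
  refine Summable.of_nonneg_of_le (fun _ => abs_nonneg _) (fun k => ?_)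
    ((summable_riemannTerm hh).mul_left (4 * (π * ρ))⁻¹)
  obtain ⟨h1, h2⟩ := im_one_div_helixE'_bounds hρ k
  have h0 : 0 ≤ riemannTerm (π * ρ) k / (1 + 2 * ρ ^ 2) :=
    div_nonneg (riemannTerm_nonneg hh k) (by positivity)
  rw [inv_mul_eq_div, le_div_iff₀ (by positivity)]
  have hneg : (1 / helixE' ρ (helixW ρ (k + 1))).im ≤ 0 := by
    by_contra! hpos
    nlinarith [mul_pos hh hpos]
  rw [abs_of_nonpos hneg]
  linarith

lemma mul_helixItilde_bounds {ρ : ℝ} (hρ : 0 < ρ) :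
    (ρ ^ 2 + 1) / (1 + 2 * ρ ^ 2) * Real.arsinh (π * ρ)⁻¹ ≤ ρ * helixItilde ρ ∧
    ρ * helixItilde ρ ≤ (ρ ^ 2 + 1) * (1 + Real.arsinh (π * ρ)⁻¹) := by
  have hh : 0 < π * ρ := by positivity
  have hsum : Summable fun k : ℕ => π * ρ * (-4 * (1 / helixE' ρ (helixW ρ (k + 1))).im) :=
    ((summable_abs_im_one_div_helixE' hρ).of_abs.mul_left _).mul_left _
  have heq : ρ * helixItilde ρ =
      (ρ ^ 2 + 1) * ∑' k : ℕ, π * ρ * (-4 * (1 / helixE' ρ (helixW ρ (k + 1))).im) := by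
    rw [tsum_mul_left, tsum_mul_left, helixItilde]
    ring
  have hR := summable_riemannTerm hh
  have hlow := (hR.div_const (1 + 2 * ρ ^ 2)).tsum_le_tsum
    (fun k => (im_one_div_helixE'_bounds hρ k).1) hsum
  have hupp := hsum.tsum_le_tsum (fun k => (im_one_div_helixE'_bounds hρ k).2) hR
  rw [tsum_div_const] at hlow
  rw [heq, div_mul_eq_mul_div, mul_div_assoc]
  constructor
  · gcongr
    refine le_trans ?_ hlow
    gcongr
    exact arsinh_inv_le_tsum_riemannTerm hh
  · gcongr
    exact hupp.trans (tsum_riemannTerm_le hh)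

lemma tendsto_log_one_div_nhdsGT_zero :
    Tendsto (fun ρ : ℝ => Real.log (1 / ρ)) (nhdsWithin 0 (Set.Ioi 0)) atTop := by
  simp only [one_div]
  exact Real.tendsto_log_atTop.comp tendsto_inv_nhdsGT_zero

lemma arsinh_inv_pi_mul {ρ : ℝ} (hρ : 0 < ρ) :
    Real.arsinh (π * ρ)⁻¹ =
      Real.log (1 / ρ) + (Real.log (1 + √(1 + (π * ρ) ^ 2)) - Real.log π) := by
  have hh : 0 < π * ρ := by positivity
  have h1 : √(1 + (π * ρ)⁻¹ ^ 2) = √(1 + (π * ρ) ^ 2) / (π * ρ) := by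
    rw [show 1 + (π * ρ)⁻¹ ^ 2 = (1 + (π * ρ) ^ 2) / (π * ρ) ^ 2 by field_simp; ring,
      Real.sqrt_div (by positivity), Real.sqrt_sq hh.le]
  rw [Real.arsinh, h1, show (π * ρ)⁻¹ + √(1 + (π * ρ) ^ 2) / (π * ρ) =
      (1 / ρ) * ((1 + √(1 + (π * ρ) ^ 2)) / π) by field_simp,
    Real.log_mul (by positivity) (by positivity),
    Real.log_div (y := π) (by positivity) (by positivity)]

lemma tendsto_arsinh_inv_pi_mul_div_log :
    Tendsto (fun ρ : ℝ => Real.arsinh (π * ρ)⁻¹ / Real.log (1 / ρ))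
      (nhdsWithin 0 (Set.Ioi 0)) (nhds 1) := by
  have hc : Tendsto (fun ρ : ℝ => Real.log (1 + √(1 + (π * ρ) ^ 2)) - Real.log π)
      (nhdsWithin 0 (Set.Ioi 0)) (nhds (Real.log (1 + √(1 + (π * 0) ^ 2)) - Real.log π)) := by
    refine (ContinuousAt.tendsto ?_).mono_left nhdsWithin_le_nhds
    have : 1 + √(1 + (π * 0) ^ 2) ≠ 0 := by positivity
    fun_prop (disch := assumption)
  have h := (hc.div_atTop tendsto_log_one_div_nhdsGT_zero).const_add 1
  rw [add_zero] at h
  refine h.congr' ?_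
  filter_upwards [self_mem_nhdsWithin, tendsto_log_one_div_nhdsGT_zero.eventually_gt_atTop 0]
    with ρ hρ hlog
  rw [arsinh_inv_pi_mul hρ, add_div, div_self hlog.ne']

/-- The series defining `Ĩ(ρ)` converges absolutely for every `ρ > 0`, and
`Ĩ(ρ) ∼ log(1/ρ)/ρ` as `ρ → 0⁺`. -/
theorem helixItilde_asymptotics :
    (∀ ρ > (0 : ℝ), Summable (fun k : ℕ => |(1 / helixE' ρ (helixW ρ (k + 1))).im|)) ∧
    Filter.Tendsto (fun ρ : ℝ => ρ * helixItilde ρ / Real.log (1 / ρ))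
      (nhdsWithin 0 (Set.Ioi 0)) (nhds 1) := by
  refine ⟨fun ρ hρ => summable_abs_im_one_div_helixE' hρ, ?_⟩
  have hlow : Tendsto (fun ρ : ℝ => (ρ ^ 2 + 1) / (1 + 2 * ρ ^ 2) *
      (Real.arsinh (π * ρ)⁻¹ / Real.log (1 / ρ))) (nhdsWithin 0 (Set.Ioi 0)) (nhds 1) := by
    have h : Tendsto (fun ρ : ℝ => (ρ ^ 2 + 1) / (1 + 2 * ρ ^ 2)) (nhdsWithin 0 (Set.Ioi 0))
        (nhds ((0 ^ 2 + 1) / (1 + 2 * 0 ^ 2))) := by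
      refine (ContinuousAt.tendsto ?_).mono_left nhdsWithin_le_nhds
      have : (1 + 2 * 0 ^ 2 : ℝ) ≠ 0 := by norm_num
      fun_prop (disch := assumption)
    simpa using h.mul tendsto_arsinh_inv_pi_mul_div_log
  have hupp : Tendsto (fun ρ : ℝ => (ρ ^ 2 + 1) *
      (1 / Real.log (1 / ρ) + Real.arsinh (π * ρ)⁻¹ / Real.log (1 / ρ)))
      (nhdsWithin 0 (Set.Ioi 0)) (nhds 1) := by
    have h : Tendsto (fun ρ : ℝ => ρ ^ 2 + 1) (nhdsWithin 0 (Set.Ioi 0))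
        (nhds (0 ^ 2 + 1)) :=
      (Continuous.tendsto (by fun_prop) 0).mono_left nhdsWithin_le_nhds
    simpa using h.mul ((tendsto_log_one_div_nhdsGT_zero.const_div_atTop 1).add
      tendsto_arsinh_inv_pi_mul_div_log)
  refine tendsto_of_tendsto_of_tendsto_of_le_of_le' hlow hupp ?_ ?_
  all_goals
    filter_upwards [self_mem_nhdsWithin, tendsto_log_one_div_nhdsGT_zero.eventually_gt_atTop 0]
      with ρ hρ hlog
  · rw [← mul_div_assoc]
    exact div_le_div_of_nonneg_right (mul_helixItilde_bounds hρ).1 hlog.le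
  · rw [← add_div, ← mul_div_assoc]
    exact div_le_div_of_nonneg_right (mul_helixItilde_bounds hρ).2 hlog.le
end

section
/- For every ρ > 0, the integral of N_ρ over the circular arc of radius R√2 centered at 0 joining R + iR to −R + iR tends to 0 as R → ∞: with the parametrization z(θ) = R√2·e^{iθ}, θ ∈ [π/4, 3π/4], one has lim_{R→∞} ∫_{π/4}^{3π/4} N_ρ(R√2·e^{iθ}) · i·R√2·e^{iθ} dθ = 0 (for all sufficiently large R the integrand is defined, i.e. the denominator is nonvanishing on the arc). -/
open Real Complex Filter

/-- The unregularized Möbius density `N_ρ(z) = 1/(ρ²z² + 4 sin²(z/2))`. -/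
noncomputable def helixN (ρ : ℝ) (z : ℂ) : ℂ :=
  1 / ((ρ : ℂ) ^ 2 * z ^ 2 + 4 * Complex.sin (z / 2) ^ 2)

/-- The sine grows exponentially away from the real axis. -/
theorem exp_im_sub_one_le_two_mul_norm_sin (w : ℂ) (hw : 0 ≤ w.im) :
    Real.exp w.im - 1 ≤ 2 * ‖Complex.sin w‖ := by
  have h2 : 2 * ‖Complex.sin w‖ = ‖Complex.exp (-w * I) - Complex.exp (w * I)‖ := by
    rw [Complex.sin]
    simp
    ring
  have h3 := norm_sub_norm_le (Complex.exp (-w * I)) (Complex.exp (w * I))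
  rw [Complex.norm_exp, Complex.norm_exp] at h3
  simp only [mul_re, neg_re, I_re, mul_zero, neg_im, I_im, mul_one, zero_sub, neg_neg] at h3
  have h4 : Real.exp (-w.im) ≤ 1 := Real.exp_le_one_iff.mpr (by linarith)
  linarith

/-- Far from the origin, in the region `|z|² = 2R²`, `Im z ≥ R`, the exponential growth of the
sine dominates the quadratic term of the denominator of `N_ρ`. -/
theorem sq_le_norm_helix_denominator (ρ R : ℝ) (hR : 64 * (2 * ρ ^ 2 + 1) ≤ R) (z : ℂ)
    (hz : ‖z‖ = R * √2) (him : R ≤ z.im) :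
    R ^ 2 ≤ ‖(ρ : ℂ) ^ 2 * z ^ 2 + 4 * Complex.sin (z / 2) ^ 2‖ := by
  have hR1 : 1 ≤ R := by nlinarith [sq_nonneg ρ]
  have him2 : (z / 2).im = z.im / 2 := by simp
  have hsin := exp_im_sub_one_le_two_mul_norm_sin (z / 2) (by rw [him2]; linarith)
  have hexp := Real.quadratic_le_exp_of_nonneg (x := R / 2) (by linarith)
  have hmono : Real.exp (R / 2) ≤ Real.exp (z / 2).im :=
    Real.exp_le_exp.mpr (by rw [him2]; linarith)
  have hlow : R ^ 2 / 8 ≤ 2 * ‖Complex.sin (z / 2)‖ := by nlinarith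
  have hsq : (R ^ 2 / 8) ^ 2 ≤ (2 * ‖Complex.sin (z / 2)‖) ^ 2 := by gcongr
  have hquad : ‖(ρ : ℂ) ^ 2 * z ^ 2‖ = 2 * ρ ^ 2 * R ^ 2 := by
    rw [norm_mul, norm_pow, norm_pow, hz, Complex.norm_real, Real.norm_eq_abs, sq_abs, mul_pow,
      Real.sq_sqrt zero_le_two]
    ring
  have hfour : ‖4 * Complex.sin (z / 2) ^ 2‖ = (2 * ‖Complex.sin (z / 2)‖) ^ 2 := by
    rw [norm_mul, norm_pow, Complex.norm_ofNat]
    ring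
  have htri := norm_sub_le_norm_add (4 * Complex.sin (z / 2) ^ 2) ((ρ : ℂ) ^ 2 * z ^ 2)
  rw [hquad, hfour, add_comm] at htri
  have hR2 : 64 * (2 * ρ ^ 2 + 1) ≤ R ^ 2 := by nlinarith
  nlinarith [mul_le_mul_of_nonneg_right hR2 (sq_nonneg R)]

theorem norm_arc_point (R θ : ℝ) (hR : 0 ≤ R) :
    ‖((R * √2 : ℝ) : ℂ) * Complex.exp (I * (θ : ℂ))‖ = R * √2 := by
  rw [norm_mul, mul_comm I, Complex.norm_exp_ofReal_mul_I, mul_one, Complex.norm_real,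
    Real.norm_of_nonneg (by positivity)]

theorem le_im_arc_point (R θ : ℝ) (hR : 0 ≤ R) (hθ : θ ∈ Set.Icc (π / 4) (3 * π / 4)) :
    R ≤ (((R * √2 : ℝ) : ℂ) * Complex.exp (I * (θ : ℂ))).im := by
  rw [Complex.im_ofReal_mul, mul_comm I, Complex.exp_ofReal_mul_I_im]
  have hsin : √2 / 2 ≤ Real.sin θ := by
    rw [← Real.cos_pi_div_four, ← Real.cos_sub_pi_div_two, ← Real.cos_abs (θ - π / 2)]
    refine Real.cos_le_cos_of_nonneg_of_le_pi (abs_nonneg _) (by linarith [Real.pi_pos]) ?_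
    rw [abs_le]
    constructor <;> linarith [hθ.1, hθ.2]
  calc R = R * √2 * (√2 / 2) := by
        linear_combination (-R / 2) * Real.sq_sqrt (zero_le_two (α := ℝ))
    _ ≤ R * √2 * Real.sin θ := by gcongr

/-- For every `ρ > 0`, the denominator of `N_ρ` is eventually nonvanishing on the circular
arc of radius `R√2` joining `R + iR` to `-R + iR`, and the contour integral of `N_ρ` over
this arc tends to `0` as `R → ∞`. -/
theorem contour_arc_integral_limit (ρ : ℝ) (hρ : 0 < ρ) :
    (∃ R₀ : ℝ, ∀ R : ℝ, R₀ ≤ R → ∀ θ ∈ Set.Icc (π / 4) (3 * π / 4),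
      (ρ : ℂ) ^ 2 * ((R * Real.sqrt 2 : ℝ) * Complex.exp (Complex.I * (θ : ℂ))) ^ 2 +
        4 * Complex.sin ((R * Real.sqrt 2 : ℝ) * Complex.exp (Complex.I * (θ : ℂ)) / 2) ^ 2
        ≠ 0) ∧
    Filter.Tendsto
      (fun R : ℝ => ∫ θ in (π / 4)..(3 * π / 4),
        helixN ρ ((R * Real.sqrt 2 : ℝ) * Complex.exp (Complex.I * (θ : ℂ))) *
          (Complex.I * (R * Real.sqrt 2 : ℝ) * Complex.exp (Complex.I * (θ : ℂ))))
      Filter.atTop (nhds 0) := by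
  have hpos : ∀ R : ℝ, 64 * (2 * ρ ^ 2 + 1) ≤ R → 0 < R := fun R hR =>
    lt_of_lt_of_le (by positivity) hR
  have hden : ∀ R : ℝ, 64 * (2 * ρ ^ 2 + 1) ≤ R → ∀ θ ∈ Set.Icc (π / 4) (3 * π / 4),
      R ^ 2 ≤ ‖(ρ : ℂ) ^ 2 * ((R * √2 : ℝ) * Complex.exp (I * (θ : ℂ))) ^ 2 +
        4 * Complex.sin ((R * √2 : ℝ) * Complex.exp (I * (θ : ℂ)) / 2) ^ 2‖ :=
    fun R hR θ hθ => sq_le_norm_helix_denominator ρ R hR _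
      (norm_arc_point R θ (hpos R hR).le) (le_im_arc_point R θ (hpos R hR).le hθ)
  refine ⟨⟨64 * (2 * ρ ^ 2 + 1), fun R hR θ hθ => ?_⟩, ?_⟩
  · exact norm_pos_iff.mp ((pow_pos (hpos R hR) 2).trans_le (hden R hR θ hθ))
  · have hlim : Tendsto (fun R : ℝ => √2 / R * |3 * π / 4 - π / 4|) atTop (nhds 0) := by
      simpa using (tendsto_const_nhds.div_atTop tendsto_id).mul_const |3 * π / 4 - π / 4|
    refine squeeze_zero_norm' ?_ hlim
    filter_upwards [eventually_ge_atTop (64 * (2 * ρ ^ 2 + 1))] with R hR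
    have hR0 := hpos R hR
    refine intervalIntegral.norm_integral_le_of_norm_le_const fun θ hθ => ?_
    rw [Set.uIoc_of_le (by linarith [Real.pi_pos])] at hθ
    rw [helixN, norm_mul, norm_div, norm_one, mul_assoc, norm_mul I, Complex.norm_I, one_mul,
      norm_arc_point R θ hR0.le]
    calc _ ≤ 1 / R ^ 2 * (R * √2) := by
          gcongr
          exact hden R hR θ (Set.Ioc_subset_Icc_self hθ)
      _ = √2 / R := by field_simp
end
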